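/- Gradient bound for truncations of configurations with regular jump set (core estimate of Theorem 2.7). Let d ≥ 2 and let Q ⊂ ℝ^d be an open cube. There is a constant C > 0 depending only on Q and d such that for every u ∈ W(Q) with jump set Γ_u, every M > 0 and every i ∈ {1,…,d} one has ∫_{Q ∩ {|u_i| < M}} |∇u_i(x)| dx ≤ C·M·(H^{d−1}(Γ_u) + 1) + C·‖e(u)‖_{L²(Q)}. -/

import Mathlib

open MeasureTheory Set
open scoped ENNReal NNReal

noncomputable section

/-- `d`-dimensional Euclidean space. -/
abbrev Ed (d : ℕ) := EuclideanSpace ℝ (Fin d)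

/-- The open axis-parallel cube with corner `a` and sidelength `l`. -/
def cube {d : ℕ} (a : Ed d) (l : ℝ) : Set (Ed d) := {x | ∀ i : Fin d, x i ∈ Ioo (a i) (a i + l)}

/-- Frobenius norm of a `d × d` real matrix. -/
def matNormD {d : ℕ} (A : Matrix (Fin d) (Fin d) ℝ) : ℝ :=
  Real.sqrt (∑ i : Fin d, ∑ j : Fin d, (A i j) ^ 2)

/-- The (a.e.) gradient of `u` as a matrix, defined via `fderiv`
(it vanishes at points of non-differentiability). -/
def mgradD {d : ℕ} (u : Ed d → Ed d) (x : Ed d) : Matrix (Fin d) (Fin d) ℝ :=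
  fun i j => fderiv ℝ u x (EuclideanSpace.single j (1 : ℝ)) i

/-- The symmetrized gradient `e(u) = (∇u + (∇u)ᵀ)/2`. -/
def symGradD {d : ℕ} (u : Ed d → Ed d) (x : Ed d) : Matrix (Fin d) (Fin d) ℝ :=
  fun i j => (mgradD u x i j + mgradD u x j i) / 2

/-- The Euclidean norm of the gradient of the `i`-th component of `u`. -/
def rowGradNorm {d : ℕ} (u : Ed d → Ed d) (i : Fin d) (x : Ed d) : ℝ :=
  Real.sqrt (∑ j : Fin d, (mgradD u x i j) ^ 2)

/-- `Γ` is a finite union of closed `(d-1)`-dimensional simplices. -/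
def FinSimplexUnion (d : ℕ) (Γ : Set (Ed d)) : Prop :=
  ∃ (n : ℕ) (f : Fin n → Fin d → Ed d),
    (∀ k, AffineIndependent ℝ (f k)) ∧ Γ = ⋃ k : Fin n, convexHull ℝ (Set.range (f k))

/-- `u ∈ W(Q)` with jump set `Γ`: `u` is bounded on `Q`, `Γ` is a finite union of
closed `(d-1)`-simplices, and `u` is locally Lipschitz on `Q \ Γ` with essentially
bounded a.e. gradient there. -/
def IsWd (d : ℕ) (Q : Set (Ed d)) (u : Ed d → Ed d) (Γ : Set (Ed d)) : Prop :=
  (∃ M : ℝ, ∀ x ∈ Q, ‖u x‖ ≤ M) ∧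
  FinSimplexUnion d Γ ∧
  (∀ x ∈ Q \ Γ, ∃ t ∈ nhds x, ∃ L : ℝ≥0, LipschitzOnWith L u t) ∧
  (∃ K : ℝ, ∀ᵐ x ∂volume, x ∈ Q \ Γ → matNormD (mgradD u x) ≤ K)

/-- Lattice points at `ℓ^∞` distance at most `n` from `x`. -/
def bx (x : ℤ × ℤ) (n : ℤ) : Finset (ℤ × ℤ) :=
  Finset.Icc (x.1 - n) (x.1 + n) ×ˢ Finset.Icc (x.2 - n) (x.2 + n)

theorem mem_bx {x z : ℤ × ℤ} {n : ℤ} :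
    z ∈ bx x n ↔ (x.1 - n ≤ z.1 ∧ z.1 ≤ x.1 + n) ∧ (x.2 - n ≤ z.2 ∧ z.2 ≤ x.2 + n) := by
  simp [bx]

/-- Discrete displacement components `f, g` whose bond strains are at most `t` off the
broken cells `Br`. -/
structure Compat (f g t : ℤ × ℤ → ℝ) (Br : Finset (ℤ × ℤ)) : Prop where
  nonneg : ∀ z, 0 ≤ t z
  horiz : ∀ z, z ∉ Br → |f (z + (1, 0)) - f z| ≤ t z
  vert : ∀ z, z ∉ Br → |g (z + (0, 1)) - g z| ≤ t z
  diag : ∀ z, z ∉ Br → |(f + g) (z + (1, 1)) - (f + g) z| ≤ t z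

/-- The sum of `t` over the level set `l = i` inside `D`. -/
def lineSum (D : Finset (ℤ × ℤ)) (t : ℤ × ℤ → ℝ) (l : ℤ × ℤ → ℤ) (i : ℤ) : ℝ :=
  ∑ z ∈ D with l z = i, t z

/-- The level set `l = i` has no broken cell in `D`. -/
def LineFree (D Br : Finset (ℤ × ℤ)) (l : ℤ × ℤ → ℤ) (i : ℤ) : Prop :=
  ∀ z ∈ D, l z = i → z ∉ Br

theorem abs_sub_le_lineSum {D Br : Finset (ℤ × ℤ)} {t h : ℤ × ℤ → ℝ} {l : ℤ × ℤ → ℤ}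
    {v : ℤ × ℤ} (hv : v ≠ 0) (ht : ∀ z, 0 ≤ t z)
    (hh : ∀ z, z ∉ Br → |h (z + v) - h z| ≤ t z) (hl : ∀ z, l (z + v) = l z)
    {i : ℤ} (hfree : LineFree D Br l i) (z : ℤ × ℤ) (hz : l z = i) (k : ℕ)
    (hD : ∀ m : ℕ, m < k → z + m • v ∈ D) :
    |h (z + k • v) - h z| ≤ lineSum D t l i := by
  have hlm : ∀ m : ℕ, l (z + m • v) = i := by
    intro m
    induction m with
    | zero => simpa using hz
    | succ m ih => rw [succ_nsmul, ← add_assoc, hl, ih]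
  have h1 : |h (z + k • v) - h z| ≤ ∑ m ∈ Finset.range k, t (z + m • v) := by
    clear hz
    induction k with
    | zero => simp
    | succ k ih =>
      rw [Finset.sum_range_succ]
      have h2 := ih (fun m hm => hD m (by omega))
      have h3 := hh (z + k • v) (hfree _ (hD k (by omega)) (hlm k))
      rw [add_assoc, ← succ_nsmul] at h3
      have := abs_sub_le (h (z + (k+1) • v)) (h (z + k • v)) (h z)
      linarith
  refine h1.trans ?_
  have hinj : Function.Injective (fun m : ℕ => z + m • v) := by
    intro a b hab
    have hab' : a • v = b • v := by simpa using hab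
    have h5 := congrArg Prod.fst hab'
    have h6 := congrArg Prod.snd hab'
    simp only [nsmul_eq_mul] at h5 h6
    by_contra hne
    have hne' : (a : ℤ) ≠ b := by exact_mod_cast hne
    apply hv
    ext
    · by_contra h0
      exact hne' (mul_right_cancel₀ h0 h5)
    · by_contra h0
      exact hne' (mul_right_cancel₀ h0 h6)
  rw [← Finset.sum_image (f := t) (g := fun m : ℕ => z + m • v) (s := Finset.range k)
    (fun a _ b _ hab => hinj hab)]
  apply Finset.sum_le_sum_of_subset_of_nonneg
  · intro w hw
    simp only [Finset.mem_image, Finset.mem_range] at hw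
    obtain ⟨m, hm, rfl⟩ := hw
    rw [Finset.mem_filter]; exact ⟨hD m hm, hlm m⟩
  · intro w _ _; exact ht w

/-- Level sets that are broken or carry a large sum. -/
def badLines (D Br : Finset (ℤ × ℤ)) (t : ℤ × ℤ → ℝ) (l : ℤ × ℤ → ℤ) (E : ℝ) : Finset ℤ := by
  classical
  exact (D.image l).filter (fun i => ¬ (LineFree D Br l i ∧ lineSum D t l i ≤ E))

theorem lineFree_of_notMem {D Br : Finset (ℤ × ℤ)} {t : ℤ × ℤ → ℝ} {l : ℤ × ℤ → ℤ} {E : ℝ}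
    (hE : 0 ≤ E) {i : ℤ} (hi : i ∉ badLines D Br t l E) :
    LineFree D Br l i ∧ lineSum D t l i ≤ E := by
  classical
  by_cases him : i ∈ D.image l
  · by_contra hcon
    exact hi (by simp only [badLines, Finset.mem_filter]; exact ⟨him, hcon⟩)
  · have hne : ∀ z ∈ D, l z ≠ i := fun z hz h => him (Finset.mem_image.2 ⟨z, hz, h⟩)
    refine ⟨fun z hz h => absurd h (hne z hz), ?_⟩
    have : D.filter (fun z => l z = i) = ∅ := by
      rw [Finset.filter_eq_empty_iff]; exact fun z hz => hne z hz
    simp [lineSum, this, hE]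

theorem lineSum_nonneg {D : Finset (ℤ × ℤ)} {t : ℤ × ℤ → ℝ} (ht : ∀ z, 0 ≤ t z)
    (l : ℤ × ℤ → ℤ) (i : ℤ) : 0 ≤ lineSum D t l i := Finset.sum_nonneg fun z _ => ht z

theorem card_badLines_le {D Br : Finset (ℤ × ℤ)} {t : ℤ × ℤ → ℝ} (ht : ∀ z, 0 ≤ t z)
    (l : ℤ × ℤ → ℤ) {c : ℝ} (hc : 0 < c) :
    ((badLines D Br t l ((∑ z ∈ D, t z) / c)).card : ℝ) ≤ (Br ∩ D).card + c := by
  classical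
  set E := (∑ z ∈ D, t z) / c with hE
  have hE0 : 0 ≤ E := div_nonneg (Finset.sum_nonneg fun z _ => ht z) hc.le
  have hEc : E * c = ∑ z ∈ D, t z := by rw [hE]; field_simp
  set S := (D.image l).filter (fun i => E < lineSum D t l i) with hS
  have hsub : badLines D Br t l E ⊆ (Br ∩ D).image l ∪ S := by
    intro i hi
    simp only [badLines, Finset.mem_filter] at hi
    obtain ⟨him, hi⟩ := hi
    by_cases hf : LineFree D Br l i
    · have : E < lineSum D t l i := by
        by_contra h; exact hi ⟨hf, not_lt.1 h⟩
      exact Finset.mem_union_right _ (by rw [hS, Finset.mem_filter]; exact ⟨him, this⟩)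
    · apply Finset.mem_union_left
      unfold LineFree at hf
      push Not at hf
      obtain ⟨z, hz, hzi, hzB⟩ := hf
      exact Finset.mem_image.2 ⟨z, Finset.mem_inter.2 ⟨hzB, hz⟩, hzi⟩
  have hcard : ((badLines D Br t l E).card : ℝ) ≤ (Br ∩ D).card + S.card := by
    have h1 := Finset.card_le_card hsub
    have h2 := Finset.card_union_le ((Br ∩ D).image l) S
    have h3 : ((Br ∩ D).image l).card ≤ (Br ∩ D).card := Finset.card_image_le
    exact_mod_cast (h1.trans h2).trans (by omega)
  have hsum : E * S.card ≤ E * c := by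
    have h1 : ∑ i ∈ D.image l, lineSum D t l i = ∑ z ∈ D, t z :=
      Finset.sum_fiberwise_of_maps_to (fun z hz => Finset.mem_image_of_mem l hz) t
    rw [hEc, ← h1]
    calc E * S.card = ∑ i ∈ S, E := by simp [mul_comm]
      _ ≤ ∑ i ∈ S, lineSum D t l i := Finset.sum_le_sum fun i hi => by
          rw [hS, Finset.mem_filter] at hi; exact hi.2.le
      _ ≤ _ := Finset.sum_le_sum_of_subset_of_nonneg (Finset.filter_subset _ _)
          fun i _ _ => lineSum_nonneg ht l i
  rcases hE0.eq_or_lt with h0 | h0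
  · have hSe : S = ∅ := by
      rw [hS, Finset.filter_eq_empty_iff]
      intro i _
      have h1 : lineSum D t l i ≤ ∑ z ∈ D, t z :=
        Finset.sum_le_sum_of_subset_of_nonneg (Finset.filter_subset _ _) fun z _ _ => ht z
      rw [← hEc, ← h0, zero_mul] at h1
      rw [← h0]; exact not_lt.2 h1
    rw [hSe] at hcard
    simp only [Finset.card_empty, Nat.cast_zero, add_zero] at hcard
    linarith
  · have := le_of_mul_le_mul_left hsum h0
    linarith

theorem exists_avoid (a b : ℤ) (B : Fin 4 → Finset ℤ) (e : Fin 4 → ℤ → ℤ)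
    (he : ∀ i, Function.Injective (e i)) (hc : (∑ i, ((B i).card : ℤ)) < b - a + 1) :
    ∃ y ∈ Finset.Icc a b, ∀ i, e i y ∉ B i := by
  classical
  by_contra hcon
  push Not at hcon
  have hsub : Finset.Icc a b ⊆ Finset.univ.biUnion
      (fun i : Fin 4 => (B i).preimage (e i) ((he i).injOn)) := by
    intro y hy
    obtain ⟨i, hi⟩ := hcon y hy
    simp only [Finset.mem_biUnion, Finset.mem_univ, true_and, Finset.mem_preimage]
    exact ⟨i, hi⟩
  have h1 := (Finset.card_le_card hsub).trans Finset.card_biUnion_le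
  have h2 : ∀ i : Fin 4, ((B i).preimage (e i) ((he i).injOn)).card ≤ (B i).card := by
    intro i
    rw [← Finset.card_image_of_injective _ (he i)]
    apply Finset.card_le_card
    intro w hw
    simp only [Finset.mem_image, Finset.mem_preimage] at hw
    obtain ⟨y, hy, rfl⟩ := hw
    exact hy
  have h3 : (Finset.Icc a b).card ≤ ∑ i, (B i).card :=
    h1.trans (Finset.sum_le_sum fun i _ => h2 i)
  rw [Int.card_Icc] at h3
  have h4 : (((b + 1 - a).toNat : ℕ) : ℤ) ≤ ∑ i, ((B i).card : ℤ) := by exact_mod_cast h3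
  omega

/-- An approximately additive function on `[0,n]` is approximately linear. -/
theorem approx_additive {n : ℤ} (hn : 0 < n) (φ : ℤ → ℝ) {ε : ℝ}
    (h : ∀ s s', 0 ≤ s → 0 ≤ s' → s + s' ≤ n → |φ (s + s') - φ s - φ s'| ≤ ε) :
    ∀ s, 0 ≤ s → s ≤ n → |φ s - φ n / n * s| ≤ 3 * ε := by
  set A := φ n / n with hA
  have hnR : (0 : ℝ) < n := by exact_mod_cast hn
  have hne : (Finset.Icc 0 n).Nonempty := ⟨0, by simp; omega⟩
  obtain ⟨m, hm, hmax⟩ := Finset.exists_max_image (Finset.Icc 0 n) (fun s => |φ s - A * s|) hne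
  rw [Finset.mem_Icc] at hm
  have hψ : ∀ s s', 0 ≤ s → 0 ≤ s' → s + s' ≤ n →
      |(φ (s + s') - A * ((s + s' : ℤ) : ℝ)) - (φ s - A * s) - (φ s' - A * s')| ≤ ε := by
    intro s s' h1 h2 h3
    have := h s s' h1 h2 h3
    convert this using 2
    push_cast; ring
  have hψn : φ n - A * n = 0 := by rw [hA]; field_simp; ring
  have key : |φ m - A * m| ≤ 3 * ε := by
    by_cases h2 : m + m ≤ n
    · have h3 := hψ m m hm.1 hm.1 h2
      have h4 := hmax (m + m) (by rw [Finset.mem_Icc]; omega)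
      rw [abs_le] at *
      have := abs_nonneg (φ m - A * m)
      rcases abs_cases (φ m - A * m) with h5 | h5 <;>
      rcases abs_cases (φ (m+m) - A * ((m+m : ℤ) : ℝ)) with h6 | h6 <;> constructor <;> linarith
    · set p := n - m with hp
      have h3 := hψ m p hm.1 (by omega) (by omega)
      have h3' : m + p = n := by omega
      rw [h3', hψn] at h3
      have h4 := hψ p p (by omega) (by omega) (by omega)
      have h5 := hmax (p + p) (by rw [Finset.mem_Icc]; omega)
      have h6 : |φ (p+p) - A * ((p+p : ℤ) : ℝ)| ≤ |φ m - A * m| := h5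
      generalize φ (p+p) - A * ((p+p : ℤ) : ℝ) = X at *
      generalize φ p - A * (p:ℝ) = Y at *
      generalize φ m - A * (m:ℝ) = Z at *
      rw [abs_le] at *
      rcases abs_cases Z with h7 | h7 <;> rw [h7.1] at h6 <;> constructor <;> linarith
  intro s h1 h2
  exact (hmax s (by rw [Finset.mem_Icc]; omega)).trans key

theorem col_path {f g t : ℤ × ℤ → ℝ} {Br : Finset (ℤ × ℤ)} (hC : Compat f g t Br)
    {D : Finset (ℤ × ℤ)} {c : ℤ} (hf : LineFree D Br Prod.fst c) {a b : ℤ}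
    (hD : ∀ y, a ≤ y → y ≤ b → (c, y) ∈ D) {y y' : ℤ} (hy : a ≤ y) (hyb : y ≤ b) (hy' : a ≤ y')
    (hyb' : y' ≤ b) : |g (c, y) - g (c, y')| ≤ lineSum D t Prod.fst c := by
  wlog hle : y' ≤ y generalizing y y'
  · rw [abs_sub_comm]; exact this hy' hyb' hy hyb (by omega)
  have h := abs_sub_le_lineSum (D := D) (Br := Br) (t := t) (h := g) (l := Prod.fst) (v := (0, 1))
    (by simp) hC.nonneg hC.vert (by simp) hf (c, y') rfl (y - y').toNat
    (fun m hm => by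
      have : ((c, y') : ℤ × ℤ) + m • (0, 1) = (c, y' + m) := by ext <;> simp
      rw [this]; exact hD _ (by omega) (by omega))
  have h2 : ((c, y') : ℤ × ℤ) + (y - y').toNat • (0, 1) = (c, y) := by
    ext
    · simp
    · simp; omega
  rwa [h2] at h

theorem row_path {f g t : ℤ × ℤ → ℝ} {Br : Finset (ℤ × ℤ)} (hC : Compat f g t Br)
    {D : Finset (ℤ × ℤ)} {y : ℤ} (hf : LineFree D Br Prod.snd y) {a b : ℤ}
    (hD : ∀ c, a ≤ c → c ≤ b → (c, y) ∈ D) {c c' : ℤ} (hy : a ≤ c) (hyb : c ≤ b) (hy' : a ≤ c')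
    (hyb' : c' ≤ b) : |f (c, y) - f (c', y)| ≤ lineSum D t Prod.snd y := by
  wlog hle : c' ≤ c generalizing c c'
  · rw [abs_sub_comm]; exact this hy' hyb' hy hyb (by omega)
  have h := abs_sub_le_lineSum (D := D) (Br := Br) (t := t) (h := f) (l := Prod.snd) (v := (1, 0))
    (by simp) hC.nonneg hC.horiz (by simp) hf (c', y) rfl (c - c').toNat
    (fun m hm => by
      have : ((c', y) : ℤ × ℤ) + m • (1, 0) = (c' + m, y) := by ext <;> simp
      rw [this]; exact hD _ (by omega) (by omega))
  have h2 : ((c', y) : ℤ × ℤ) + (c - c').toNat • (1, 0) = (c, y) := by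
    ext
    · simp; omega
    · simp
  rwa [h2] at h

theorem diag_path {f g t : ℤ × ℤ → ℝ} {Br : Finset (ℤ × ℤ)} (hC : Compat f g t Br)
    {D : Finset (ℤ × ℤ)} {c y s : ℤ} (hs : 0 ≤ s)
    (hf : LineFree D Br (fun z => z.1 - z.2) (c - y))
    (hD : ∀ m, 0 ≤ m → m < s → (c + m, y + m) ∈ D) :
    |(f + g) (c + s, y + s) - (f + g) (c, y)| ≤ lineSum D t (fun z => z.1 - z.2) (c - y) := by
  have h := abs_sub_le_lineSum (D := D) (Br := Br) (t := t) (h := f + g)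
    (l := fun z => z.1 - z.2) (v := (1, 1))
    (by simp) hC.nonneg hC.diag (by simp) hf (c, y) rfl s.toNat
    (fun m hm => by
      have : ((c, y) : ℤ × ℤ) + m • (1, 1) = (c + m, y + m) := by ext <;> simp
      rw [this]; exact hD _ (by omega) (by omega))
  have h2 : ((c, y) : ℤ × ℤ) + s.toNat • (1, 1) = (c + s, y + s) := by
    ext
    · simp; omega
    · simp; omega
  rwa [h2] at h

theorem increment_bound {f g t : ℤ × ℤ → ℝ} {Br : Finset (ℤ × ℤ)} (hC : Compat f g t Br)
    {x : ℤ × ℤ} {n : ℤ} {c y s : ℤ} (hs : 0 ≤ s)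
    (hc : x.1 - n ≤ c) (hc' : c + s ≤ x.1 + n) (hy : x.2 - n ≤ y) (hy' : y + s ≤ x.2 + n)
    (h1 : LineFree (bx x n) Br Prod.fst c) (h2 : LineFree (bx x n) Br Prod.fst (c + s))
    (h3 : LineFree (bx x n) Br Prod.snd y) (h4 : LineFree (bx x n) Br Prod.snd (y + s))
    (h5 : LineFree (bx x n) Br (fun z => z.1 - z.2) (c - y)) :
    |(g (c + s, x.2) - g (c, x.2)) + (f (x.1, y + s) - f (x.1, y))| ≤
      lineSum (bx x n) t Prod.fst c + lineSum (bx x n) t Prod.fst (c + s) +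
      lineSum (bx x n) t Prod.snd y + lineSum (bx x n) t Prod.snd (y + s) +
      lineSum (bx x n) t (fun z => z.1 - z.2) (c - y) := by
  have hm : ∀ p q : ℤ, x.1 - n ≤ p → p ≤ x.1 + n → x.2 - n ≤ q → q ≤ x.2 + n →
      (p, q) ∈ bx x n := fun p q a b c d => mem_bx.2 ⟨⟨a, b⟩, c, d⟩
  have e1 := col_path hC h1 (a := x.2 - n) (b := x.2 + n)
    (fun q a b => hm _ _ hc (by omega) a b) (y := y) (y' := x.2)
    (by omega) (by omega) (by omega) (by omega)
  have e2 := col_path hC h2 (a := x.2 - n) (b := x.2 + n)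
    (fun q a b => hm _ _ (by omega) (by omega) a b) (y := y + s) (y' := x.2)
    (by omega) (by omega) (by omega) (by omega)
  have e3 := row_path hC h3 (a := x.1 - n) (b := x.1 + n)
    (fun q a b => hm _ _ a b (by omega) (by omega)) (c := c) (c' := x.1)
    (by omega) (by omega) (by omega) (by omega)
  have e4 := row_path hC h4 (a := x.1 - n) (b := x.1 + n)
    (fun q a b => hm _ _ a b (by omega) (by omega)) (c := c + s) (c' := x.1)
    (by omega) (by omega) (by omega) (by omega)
  have e5 := diag_path hC hs h5
    (fun m a b => hm _ _ (by omega) (by omega) (by omega) (by omega))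
  simp only [Pi.add_apply] at e5
  rw [abs_le] at *
  constructor <;> linarith

/-- On a box with few broken cells, the displacement is close to an infinitesimal rigid motion
along every free row and column. -/
theorem exists_rigid_fit {f g t : ℤ × ℤ → ℝ} {Br : Finset (ℤ × ℤ)} (hC : Compat f g t Br)
    (x : ℤ × ℤ) {n : ℤ} (hn : 0 < n) (hb : 100 * ((Br ∩ bx x n).card : ℤ) ≤ n) :
    ∃ A α β : ℝ,
      (∀ c, |c - x.1| * 2 ≤ n → LineFree (bx x n) Br Prod.fst c →
        ∀ y, x.2 - n ≤ y → y ≤ x.2 + n → |g (c, y) - (α + A * c)| ≤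
          30000 * (lineSum (bx x n) t Prod.fst c + (∑ z ∈ bx x n, t z) / n)) ∧
      (∀ y, |y - x.2| * 2 ≤ n → LineFree (bx x n) Br Prod.snd y →
        ∀ c, x.1 - n ≤ c → c ≤ x.1 + n → |f (c, y) - (β - A * y)| ≤
          30000 * (lineSum (bx x n) t Prod.snd y + (∑ z ∈ bx x n, t z) / n)) := by
  set D := bx x n with hD
  have hnR : (0 : ℝ) < n := by exact_mod_cast hn
  set E := (∑ z ∈ D, t z) / ((n : ℝ) / 100) with hE
  have hE0 : 0 ≤ E := div_nonneg (Finset.sum_nonneg fun z _ => hC.nonneg z) (by positivity)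
  have hEE : (∑ z ∈ D, t z) / (n : ℝ) = E / 100 := by rw [hE]; field_simp
  have hbR : 100 * ((Br ∩ D).card : ℝ) ≤ n := by exact_mod_cast hb
  have hcard : ∀ l : ℤ × ℤ → ℤ, 50 * ((badLines D Br t l E).card : ℤ) ≤ n := by
    intro l
    have := card_badLines_le (D := D) (Br := Br) hC.nonneg l (c := (n : ℝ) / 100) (by positivity)
    rw [← hE] at this
    have h2 : 50 * ((badLines D Br t l E).card : ℝ) ≤ n := by linarith
    exact_mod_cast h2
  set BC := badLines D Br t Prod.fst E with hBC
  set BR := badLines D Br t Prod.snd E with hBR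
  set BD := badLines D Br t (fun z => z.1 - z.2) E with hBD
  have cC := hcard Prod.fst
  have cR := hcard Prod.snd
  have cD := hcard (fun z => z.1 - z.2)
  rw [← hBC] at cC
  rw [← hBR] at cR
  rw [← hBD] at cD
  have fC : ∀ {c}, c ∉ BC → LineFree D Br Prod.fst c ∧ lineSum D t Prod.fst c ≤ E :=
    fun h => lineFree_of_notMem hE0 h
  have fR : ∀ {c}, c ∉ BR → LineFree D Br Prod.snd c ∧ lineSum D t Prod.snd c ≤ E :=
    fun h => lineFree_of_notMem hE0 h
  have fD : ∀ {c}, c ∉ BD → LineFree D Br (fun z => z.1 - z.2) c ∧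
      lineSum D t (fun z => z.1 - z.2) c ≤ E :=
    fun h => lineFree_of_notMem hE0 h
  set U1 : ℤ → ℝ := fun y => f (x.1, y) with hU1
  set U2 : ℤ → ℝ := fun c => g (c, x.2) with hU2
  have avoid : ∀ (a b : ℤ) (B1 B2 B3 B4 : Finset ℤ) (e1 e2 e3 e4 : ℤ → ℤ),
      Function.Injective e1 → Function.Injective e2 → Function.Injective e3 →
      Function.Injective e4 → 50 * (B1.card : ℤ) ≤ n → 50 * (B2.card : ℤ) ≤ n →
      50 * (B3.card : ℤ) ≤ n → 50 * (B4.card : ℤ) ≤ n → n ≤ b - a + 1 →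
      ∃ y, (a ≤ y ∧ y ≤ b) ∧ e1 y ∉ B1 ∧ e2 y ∉ B2 ∧ e3 y ∉ B3 ∧ e4 y ∉ B4 := by
    intro a b B1 B2 B3 B4 e1 e2 e3 e4 i1 i2 i3 i4 c1 c2 c3 c4 hab
    obtain ⟨y, hy, h⟩ := exists_avoid a b ![B1, B2, B3, B4] ![e1, e2, e3, e4]
      (by intro i; fin_cases i <;> assumption)
      (by simp only [Fin.sum_univ_four]; simp; omega)
    exact ⟨y, by simpa using hy, h 0, h 1, h 2, h 3⟩
  have inj1 : Function.Injective (fun y : ℤ => y) := fun a b h => h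
  have inj2 : ∀ s : ℤ, Function.Injective (fun y : ℤ => y + s) := fun s a b h => by simpa using h
  have inj3 : ∀ s : ℤ, Function.Injective (fun y : ℤ => s - y) := fun s a b h => by simpa using h
  have inj4 : ∀ s : ℤ, Function.Injective (fun y : ℤ => y - s) := fun s a b h => by simpa using h
  have c0 : 50 * ((∅ : Finset ℤ).card : ℤ) ≤ n := by simp; omega
  have hex : ∀ s : ℤ, ∃ c, 0 ≤ s → s ≤ n →
      (x.1 - n ≤ c ∧ c ≤ x.1 + n - s) ∧ c ∉ BC ∧ c + s ∉ BC := by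
    intro s
    by_cases hs : 0 ≤ s ∧ s ≤ n
    · obtain ⟨c, h1, h2, h3, -⟩ := avoid (x.1 - n) (x.1 + n - s) BC BC ∅ ∅ _ _ _ _ inj1 (inj2 s)
        inj1 inj1 cC cC c0 c0 (by omega)
      exact ⟨c, fun _ _ => ⟨h1, h2, h3⟩⟩
    · exact ⟨0, fun a b => absurd ⟨a, b⟩ hs⟩
  choose cs hcs using hex
  set φ : ℤ → ℝ := fun s => U2 (cs s + s) - U2 (cs s) with hφ
  -- increments along nice rows
  have hrow : ∀ s y, 0 ≤ s → s ≤ n → x.2 - n ≤ y → y + s ≤ x.2 + n → y ∉ BR → y + s ∉ BR →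
      |(U1 (y + s) - U1 y) + φ s| ≤ 15 * E := by
    intro s y h0 h1 hy hy' hn1 hn2
    obtain ⟨⟨k1, k2⟩, k3, k4⟩ := hcs s h0 h1
    obtain ⟨c, ⟨m1, m2⟩, m3, m4, m5, -⟩ := avoid (x.1 - n) (x.1 + n - s) BC BC BD ∅ _ _ _ _
      inj1 (inj2 s) (inj4 y) inj1 cC cC cD c0 (by omega)
    obtain ⟨w, ⟨l1, l2⟩, l3, l4, l5, l6⟩ := avoid (x.2 - n) (x.2 + n - s) BR BR BD BD _ _ _ _
      inj1 (inj2 s) (inj3 c) (inj3 (cs s)) cR cR cD cD (by omega)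
    have e1 := increment_bound hC h0 m1 (by omega) hy (by omega) (fC m3).1 (fC m4).1
      (fR hn1).1 (fR hn2).1 (fD m5).1
    have e2 := increment_bound hC h0 m1 (by omega) l1 (by omega) (fC m3).1 (fC m4).1
      (fR l3).1 (fR l4).1 (fD l5).1
    have e3 := increment_bound hC h0 k1 (by omega) l1 (by omega) (fC k3).1 (fC k4).1
      (fR l3).1 (fR l4).1 (fD l6).1
    have b1 := (fC m3).2
    have b2 := (fC m4).2
    have b3 := (fC k3).2
    have b4 := (fC k4).2
    have b5 := (fR hn1).2
    have b6 := (fR hn2).2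
    have b7 := (fR l3).2
    have b8 := (fR l4).2
    have b9 := (fD m5).2
    have b10 := (fD l5).2
    have b11 := (fD l6).2
    simp only [hφ, hU1, hU2]
    rw [abs_le] at *
    constructor <;> linarith
  have hcol : ∀ s c, 0 ≤ s → s ≤ n → x.1 - n ≤ c → c + s ≤ x.1 + n → LineFree D Br Prod.fst c →
      LineFree D Br Prod.fst (c + s) →
      |(U2 (c + s) - U2 c) - φ s| ≤
        lineSum D t Prod.fst c + lineSum D t Prod.fst (c + s) + 18 * E := by
    intro s c h0 h1 hy hy' hn1 hn2
    obtain ⟨w, ⟨l1, l2⟩, l3, l4, l5, -⟩ := avoid (x.2 - n) (x.2 + n - s) BR BR BD ∅ _ _ _ _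
      inj1 (inj2 s) (inj3 c) inj1 cR cR cD c0 (by omega)
    have e2 := increment_bound hC h0 hy (by omega) l1 (by omega) hn1 hn2
      (fR l3).1 (fR l4).1 (fD l5).1
    have e3 := hrow s w h0 h1 l1 (by omega) l3 l4
    have b7 := (fR l3).2
    have b8 := (fR l4).2
    have b9 := (fD l5).2
    simp only [hU1, hU2] at *
    rw [abs_le] at *
    constructor <;> linarith
  have hrow' : ∀ s y, 0 ≤ s → s ≤ n → x.2 - n ≤ y → y + s ≤ x.2 + n → LineFree D Br Prod.snd y →
      LineFree D Br Prod.snd (y + s) →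
      |(U1 (y + s) - U1 y) + φ s| ≤
        lineSum D t Prod.snd y + lineSum D t Prod.snd (y + s) + 23 * E := by
    intro s y h0 h1 hy hy' hn1 hn2
    obtain ⟨c, ⟨m1, m2⟩, m3, m4, m5, -⟩ := avoid (x.1 - n) (x.1 + n - s) BC BC BD ∅ _ _ _ _
      inj1 (inj2 s) (inj4 y) inj1 cC cC cD c0 (by omega)
    have e2 := increment_bound hC h0 m1 (by omega) hy hy' (fC m3).1 (fC m4).1 hn1 hn2 (fD m5).1
    have e3 := hcol s c h0 h1 m1 (by omega) (fC m3).1 (fC m4).1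
    have b7 := (fC m3).2
    have b8 := (fC m4).2
    have b9 := (fD m5).2
    simp only [hU1, hU2] at *
    rw [abs_le] at *
    constructor <;> linarith
  have hadd : ∀ s s', 0 ≤ s → 0 ≤ s' → s + s' ≤ n → |φ (s + s') - φ s - φ s'| ≤ 60 * E := by
    intro s s' h0 h1 h2
    obtain ⟨c, ⟨m1, m2⟩, m3, m4, m5, -⟩ := avoid (x.1 - n) (x.1 + n - (s + s')) BC BC BC ∅ _ _ _ _
      inj1 (inj2 s) (inj2 (s + s')) inj1 cC cC cC c0 (by omega)
    have e1 := hcol (s + s') c (by omega) (by omega) m1 (by omega) (fC m3).1 (fC m5).1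
    have e2 := hcol s c (by omega) (by omega) m1 (by omega) (fC m3).1 (fC m4).1
    have e3 := hcol s' (c + s) (by omega) (by omega) (by omega) (by omega) (fC m4).1
      (by rw [add_assoc]; exact (fC m5).1)
    rw [add_assoc] at e3
    have b7 := (fC m3).2
    have b8 := (fC m4).2
    have b9 := (fC m5).2
    simp only [hU2] at *
    rw [abs_le] at *
    constructor <;> linarith
  have hlin := approx_additive hn φ hadd
  set A := φ n / n with hA
  obtain ⟨c', ⟨m1, m2⟩, m3, -, -, -⟩ := avoid (x.1 - n / 2) (x.1 + n / 2) BC ∅ ∅ ∅ _ _ _ _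
      inj1 inj1 inj1 inj1 cC c0 c0 c0 (by omega)
  obtain ⟨y', ⟨l1, l2⟩, l3, -, -, -⟩ := avoid (x.2 - n / 2) (x.2 + n / 2) BR ∅ ∅ ∅ _ _ _ _
      inj1 inj1 inj1 inj1 cR c0 c0 c0 (by omega)
  have b1 := (fC m3).2
  have b2 := (fR l3).2
  refine ⟨A, U2 c' - A * c', U1 y' + A * y', ?_, ?_⟩
  · intro c hc hfree y hy hy'
    have hc2 : c - x.1 ≤ n / 2 ∧ x.1 - c ≤ n / 2 := by
      rcases abs_cases (c - x.1) with h | h <;> omega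
    have hS := lineSum_nonneg (D := D) hC.nonneg Prod.fst c
    have hp := col_path hC hfree (a := x.2 - n) (b := x.2 + n)
      (fun q a b => mem_bx.2 ⟨⟨by simp only; omega, by simp only; omega⟩, a, b⟩)
      (y := y) (y' := x.2) hy hy' (by omega) (by omega)
    have key : |U2 c - U2 c' - A * (c - c')| ≤ lineSum D t Prod.fst c + 199 * E := by
      rcases le_total c' c with h | h
      · have e1 := hcol (c - c') c' (by omega) (by omega) (by omega) (by omega) (fC m3).1
          (by simpa using hfree)
        have e2 := hlin (c - c') (by omega) (by omega)
        rw [add_sub_cancel] at e1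
        push_cast at e2
        rw [abs_le] at *
        constructor <;> linarith
      · have e1 := hcol (c' - c) c (by omega) (by omega) (by omega) (by omega) hfree
          (by simpa using (fC m3).1)
        have e2 := hlin (c' - c) (by omega) (by omega)
        rw [add_sub_cancel] at e1
        push_cast at e2
        rw [abs_le] at *
        constructor <;> linarith
    rw [hEE]
    simp only [hU2] at *
    rw [abs_le] at *
    constructor <;> linarith
  · intro y hc hfree c hy hy'
    have hc2 : y - x.2 ≤ n / 2 ∧ x.2 - y ≤ n / 2 := by
      rcases abs_cases (y - x.2) with h | h <;> omega
    have hS := lineSum_nonneg (D := D) hC.nonneg Prod.snd y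
    have hp := row_path hC hfree (a := x.1 - n) (b := x.1 + n)
      (fun q a b => mem_bx.2 ⟨⟨a, b⟩, by simp only; omega, by simp only; omega⟩)
      (c := c) (c' := x.1) hy hy' (by omega) (by omega)
    have key : |U1 y - U1 y' + A * (y - y')| ≤ lineSum D t Prod.snd y + 204 * E := by
      rcases le_total y' y with h | h
      · have e1 := hrow' (y - y') y' (by omega) (by omega) (by omega) (by omega) (fR l3).1
          (by simpa using hfree)
        have e2 := hlin (y - y') (by omega) (by omega)
        rw [add_sub_cancel] at e1
        push_cast at e2
        rw [abs_le] at *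
        constructor <;> linarith
      · have e1 := hrow' (y' - y) y (by omega) (by omega) (by omega) (by omega) hfree
          (by simpa using (fR l3).1)
        have e2 := hlin (y' - y) (by omega) (by omega)
        rw [add_sub_cancel] at e1
        push_cast at e2
        rw [abs_le] at *
        constructor <;> linarith
    rw [hEE]
    simp only [hU1] at *
    rw [abs_le] at *
    constructor <;> linarith

/-- The parameters `p = (A, α, β)` describe a rigid motion close to `(f, g)` along free lines of
the box `bx x n`. -/
structure IsFit (f g t : ℤ × ℤ → ℝ) (Br : Finset (ℤ × ℤ)) (x : ℤ × ℤ) (n : ℤ)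
    (p : ℝ × ℝ × ℝ) : Prop where
  col : ∀ c, |c - x.1| * 2 ≤ n → LineFree (bx x n) Br Prod.fst c →
    ∀ y, x.2 - n ≤ y → y ≤ x.2 + n → |g (c, y) - (p.2.1 + p.1 * c)| ≤
      30000 * (lineSum (bx x n) t Prod.fst c + (∑ z ∈ bx x n, t z) / n)
  row : ∀ y, |y - x.2| * 2 ≤ n → LineFree (bx x n) Br Prod.snd y →
    ∀ c, x.1 - n ≤ c → c ≤ x.1 + n → |f (c, y) - (p.2.2 - p.1 * y)| ≤
      30000 * (lineSum (bx x n) t Prod.snd y + (∑ z ∈ bx x n, t z) / n)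

theorem exists_isFit {f g t : ℤ × ℤ → ℝ} {Br : Finset (ℤ × ℤ)} (hC : Compat f g t Br)
    (x : ℤ × ℤ) {n : ℤ} (hn : 0 < n) (hb : 100 * ((Br ∩ bx x n).card : ℤ) ≤ n) :
    ∃ p, IsFit f g t Br x n p := by
  obtain ⟨A, α, β, h1, h2⟩ := exists_rigid_fit hC x hn hb
  exact ⟨(A, α, β), h1, h2⟩

/-- Two affine functions close at two distant points are close. -/
theorem affine_close {a A a' A' c₁ c₂ r e : ℝ} (hr : 0 < r) (h12 : r ≤ c₂ - c₁)
    (h1 : |(a + A * c₁) - (a' + A' * c₁)| ≤ e) (h2 : |(a + A * c₂) - (a' + A' * c₂)| ≤ e) :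
    |A - A'| ≤ 2 * e / r ∧ ∀ c, |(a + A * c) - (a' + A' * c)| ≤ e + 2 * e / r * |c - c₁| := by
  have key : |A - A'| ≤ 2 * e / r := by
    rw [le_div_iff₀ hr]
    have h3 : (A - A') * (c₂ - c₁) = ((a + A * c₂) - (a' + A' * c₂)) -
      ((a + A * c₁) - (a' + A' * c₁)) := by ring
    have h4 : |A - A'| * (c₂ - c₁) ≤ 2 * e := by
      have h6 : |(A - A') * (c₂ - c₁)| ≤ 2 * e := by
        rw [h3]
        exact (abs_sub _ _).trans (by linarith)
      rw [abs_mul, abs_of_nonneg (by linarith : (0 : ℝ) ≤ c₂ - c₁)] at h6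
      exact h6
    nlinarith [abs_nonneg (A - A')]
  refine ⟨key, fun c => ?_⟩
  have h3 : (a + A * c) - (a' + A' * c) = ((a + A * c₁) - (a' + A' * c₁)) +
    (A - A') * (c - c₁) := by ring
  rw [h3]
  refine (abs_add_le _ _).trans ?_
  rw [abs_mul]
  have := mul_le_mul_of_nonneg_right key (abs_nonneg (c - c₁))
  linarith

set_option maxHeartbeats 1000000 in
theorem fit_compare {f g t : ℤ × ℤ → ℝ} {Br : Finset (ℤ × ℤ)} (hC : Compat f g t Br)
    {x x' : ℤ × ℤ} {n n' r : ℤ} {p p' : ℝ × ℝ × ℝ} (hp : IsFit f g t Br x n p)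
    (hp' : IsFit f g t Br x' n' p') (hr : 0 < r) (hrn : 2 * r ≤ n)
    (hx1 : 2 * (|x'.1 - x.1| + r) ≤ n') (hx2 : 2 * (|x'.2 - x.2| + r) ≤ n')
    (hb : 100 * ((Br ∩ bx x n).card : ℤ) ≤ r) (hb' : 100 * ((Br ∩ bx x' n').card : ℤ) ≤ r)
    {ρ : ℝ} (hρ : (r : ℝ) ≤ ρ) :
    |p.1 - p'.1| ≤ 10000000 * (∑ z ∈ bx x n, t z + ∑ z ∈ bx x' n', t z) / r ^ 2 ∧
    (∀ c : ℝ, |c - x.1| ≤ ρ → |(p.2.1 + p.1 * c) - (p'.2.1 + p'.1 * c)| ≤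
      25000000 * (∑ z ∈ bx x n, t z + ∑ z ∈ bx x' n', t z) / r ^ 2 * ρ) ∧
    (∀ c : ℝ, |c - x.2| ≤ ρ → |(p.2.2 - p.1 * c) - (p'.2.2 - p'.1 * c)| ≤
      25000000 * (∑ z ∈ bx x n, t z + ∑ z ∈ bx x' n', t z) / r ^ 2 * ρ) := by
  set D := bx x n with hD
  set D' := bx x' n' with hD'
  have hrR : (0 : ℝ) < r := by exact_mod_cast hr
  set S := ∑ z ∈ D, t z with hS
  set S' := ∑ z ∈ D', t z with hS'
  have hS0 : 0 ≤ S := Finset.sum_nonneg fun z _ => hC.nonneg z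
  have hS0' : 0 ≤ S' := Finset.sum_nonneg fun z _ => hC.nonneg z
  have hn' : 2 * r ≤ n' := by have := abs_nonneg (x'.1 - x.1); omega
  have hq : S / (n : ℝ) ≤ S / r :=
    div_le_div_of_nonneg_left hS0 hrR (by exact_mod_cast (by omega : r ≤ n))
  have hq' : S' / (n' : ℝ) ≤ S' / r :=
    div_le_div_of_nonneg_left hS0' hrR (by exact_mod_cast (by omega : r ≤ n'))
  have hE : S / ((r : ℝ) / 100) = 100 * (S / r) := by field_simp
  have hE' : S' / ((r : ℝ) / 100) = 100 * (S' / r) := by field_simp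
  have hcard : ∀ l : ℤ × ℤ → ℤ, 50 * ((badLines D Br t l (S / ((r : ℝ) / 100))).card : ℤ) ≤ r := by
    intro l
    have := card_badLines_le (D := D) (Br := Br) hC.nonneg l (c := (r : ℝ) / 100) (by positivity)
    have hbR : 100 * ((Br ∩ D).card : ℝ) ≤ r := by exact_mod_cast hb
    have h2 : 50 * ((badLines D Br t l (S / ((r : ℝ) / 100))).card : ℝ) ≤ r := by linarith
    exact_mod_cast h2
  have hcard' : ∀ l : ℤ × ℤ → ℤ,
      50 * ((badLines D' Br t l (S' / ((r : ℝ) / 100))).card : ℤ) ≤ r := by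
    intro l
    have := card_badLines_le (D := D') (Br := Br) hC.nonneg l (c := (r : ℝ) / 100) (by positivity)
    have hbR : 100 * ((Br ∩ D').card : ℝ) ≤ r := by exact_mod_cast hb'
    have h2 : 50 * ((badLines D' Br t l (S' / ((r : ℝ) / 100))).card : ℝ) ≤ r := by linarith
    exact_mod_cast h2
  have inj1 : Function.Injective (fun y : ℤ => y) := fun a b h => h
  have avoid : ∀ (l : ℤ × ℤ → ℤ) (a b : ℤ), r ≤ 2 * (b - a) + 1 → ∃ y, (a ≤ y ∧ y ≤ b) ∧
      y ∉ badLines D Br t l (S / ((r : ℝ) / 100)) ∧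
      y ∉ badLines D' Br t l (S' / ((r : ℝ) / 100)) := by
    intro l a b hab
    have h1 := hcard l
    have h2 := hcard' l
    obtain ⟨y, hy, h⟩ := exists_avoid a b ![badLines D Br t l (S / ((r : ℝ) / 100)),
      badLines D' Br t l (S' / ((r : ℝ) / 100)), ∅, ∅] (fun _ y => y)
      (by intro i; exact inj1)
      (by simp only [Fin.sum_univ_four]; simp; omega)
    exact ⟨y, by simpa using hy, h 0, h 1⟩
  have hx1' := abs_le.1 (le_refl |x'.1 - x.1|)
  have hx2' := abs_le.1 (le_refl |x'.2 - x.2|)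
  set e := 7000000 / 2 * ((S + S') / r) with he
  have he' : 3030000 * (S / r) + 3030000 * (S' / r) ≤ e := by
    rw [he, add_div]
    have := div_nonneg hS0 hrR.le
    have := div_nonneg hS0' hrR.le
    linarith
  have he0 : 0 ≤ e := by rw [he]; positivity
  have hcol : ∀ c : ℤ, |c - x.1| ≤ r → c ∉ badLines D Br t Prod.fst (S / ((r : ℝ) / 100)) →
      c ∉ badLines D' Br t Prod.fst (S' / ((r : ℝ) / 100)) →
      |(p.2.1 + p.1 * c) - (p'.2.1 + p'.1 * c)| ≤ e := by
    intro c hc h1 h2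
    rw [abs_le] at hc
    obtain ⟨k1, k2⟩ := lineFree_of_notMem (by positivity) h1
    obtain ⟨k3, k4⟩ := lineFree_of_notMem (by positivity) h2
    have e1 := hp.col c (by rcases abs_cases (c - x.1) with h | h <;> omega) k1 x.2
      (by omega) (by omega)
    have e2 := hp'.col c (by rcases abs_cases (c - x'.1) with h | h <;> omega) k3 x.2
      (by omega) (by omega)
    rw [hE] at k2
    rw [hE'] at k4
    rw [abs_le] at *
    constructor <;> linarith
  have hrow : ∀ c : ℤ, |c - x.2| ≤ r → c ∉ badLines D Br t Prod.snd (S / ((r : ℝ) / 100)) →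
      c ∉ badLines D' Br t Prod.snd (S' / ((r : ℝ) / 100)) →
      |(p.2.2 + (-p.1) * c) - (p'.2.2 + (-p'.1) * c)| ≤ e := by
    intro c hc h1 h2
    rw [abs_le] at hc
    obtain ⟨k1, k2⟩ := lineFree_of_notMem (by positivity) h1
    obtain ⟨k3, k4⟩ := lineFree_of_notMem (by positivity) h2
    have e1 := hp.row c (by rcases abs_cases (c - x.2) with h | h <;> omega) k1 x.1
      (by omega) (by omega)
    have e2 := hp'.row c (by rcases abs_cases (c - x'.2) with h | h <;> omega) k3 x.1
      (by omega) (by omega)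
    rw [hE] at k2
    rw [hE'] at k4
    rw [abs_le] at *
    constructor <;> linarith
  have hfin : ∀ {u : ℝ} {c₁ x₀ c : ℝ}, |c₁ - x₀| ≤ r → |c - x₀| ≤ ρ →
      u ≤ e + 2 * e / r * |c - c₁| → u ≤ 25000000 * (S + S') / r ^ 2 * ρ := by
    intro u c₁ x₀ c h1 h2 h3
    have h4 : |c - c₁| ≤ 2 * ρ := by
      rw [abs_le] at *; constructor <;> linarith
    have h5 : 2 * e / r * |c - c₁| ≤ 2 * e / r * (2 * ρ) :=
      mul_le_mul_of_nonneg_left h4 (by positivity)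
    have h6 : e ≤ e / r * ρ := by
      rw [div_mul_eq_mul_div, le_div_iff₀ hrR]; exact mul_le_mul_of_nonneg_left hρ he0
    have h7 : 25000000 * (S + S') / r ^ 2 * ρ = (50 / 7) * (e / r * ρ) := by
      rw [he]; field_simp; ring
    have h8 : 0 ≤ e / r * ρ := by have := hrR.le.trans hρ; positivity
    rw [h7]
    have h9 : 2 * e / r * (2 * ρ) = 4 * (e / r * ρ) := by ring
    linarith
  have hA : 2 * e / (r : ℝ) ≤ 10000000 * (S + S') / r ^ 2 := by
    rw [he, div_le_div_iff₀ hrR (by positivity)]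
    have : 2 * (7000000 / 2 * ((S + S') / (r : ℝ))) * r ^ 2 = 7000000 * (S + S') * r := by
      field_simp
    rw [this]
    have : 0 ≤ (S + S') * r := by positivity
    nlinarith
  obtain ⟨c₁, ⟨i1, i2⟩, i3, i4⟩ := avoid Prod.fst (x.1 - r) (x.1 - r + r / 2) (by omega)
  obtain ⟨c₂, ⟨j1, j2⟩, j3, j4⟩ := avoid Prod.fst (x.1 + r - r / 2) (x.1 + r) (by omega)
  obtain ⟨d₁, ⟨k1, k2⟩, k3, k4⟩ := avoid Prod.snd (x.2 - r) (x.2 - r + r / 2) (by omega)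
  obtain ⟨d₂, ⟨l1, l2⟩, l3, l4⟩ := avoid Prod.snd (x.2 + r - r / 2) (x.2 + r) (by omega)
  have hac := affine_close hrR (c₁ := c₁) (c₂ := c₂)
    (by exact_mod_cast (by omega : r ≤ c₂ - c₁))
    (hcol c₁ (by rw [abs_le]; constructor <;> omega) i3 i4)
    (hcol c₂ (by rw [abs_le]; constructor <;> omega) j3 j4)
  have har := affine_close hrR (c₁ := d₁) (c₂ := d₂)
    (by exact_mod_cast (by omega : r ≤ d₂ - d₁))
    (hrow d₁ (by rw [abs_le]; constructor <;> omega) k3 k4)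
    (hrow d₂ (by rw [abs_le]; constructor <;> omega) l3 l4)
  refine ⟨hac.1.trans hA, fun c hc => hfin (c₁ := c₁) (x₀ := x.1) ?_ hc (hac.2 c),
    fun c hc => hfin (c₁ := d₁) (x₀ := x.2) ?_ hc ?_⟩
  · rw [abs_le]; constructor
    · have : (-r : ℤ) ≤ c₁ - x.1 := by omega
      exact_mod_cast this
    · have : c₁ - x.1 ≤ r := by omega
      exact_mod_cast this
  · rw [abs_le]; constructor
    · have : (-r : ℤ) ≤ d₁ - x.2 := by omega
      exact_mod_cast this
    · have : d₁ - x.2 ≤ r := by omega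
      exact_mod_cast this
  · have := har.2 c
    simp only [neg_mul, ← sub_eq_add_neg] at this
    exact this

/-- The length of scale `s`. -/
@[irreducible] def rad (s : ℕ) : ℤ := 1024 ^ (s + 1)

theorem rad_pos (s : ℕ) : 0 < rad s := by unfold rad; positivity

theorem rad_succ (s : ℕ) : rad (s + 1) = 1024 * rad s := by unfold rad; ring

theorem rad_mono {s s' : ℕ} (h : s ≤ s') : rad s ≤ rad s' := by
  unfold rad; exact pow_le_pow_right₀ (by norm_num) (by omega)

theorem rad_pos' (s : ℕ) : (0 : ℝ) < rad s := by exact_mod_cast rad_pos s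

theorem one_le_rad (s : ℕ) : (1 : ℝ) ≤ rad s := by exact_mod_cast rad_pos s

/-- Few broken cells near `x` at scale `s`, measured by the density `θ s`. -/
def Good (Br : Finset (ℤ × ℤ)) (θ : ℕ → ℝ) (s : ℕ) (x : ℤ × ℤ) : Prop :=
  ((Br ∩ bx x (64 * rad s)).card : ℝ) ≤ θ s * rad s

/-- A chosen rigid fit around `x` at scale `s`. -/
def fitp (f g t : ℤ × ℤ → ℝ) (Br : Finset (ℤ × ℤ)) (s : ℕ) (x : ℤ × ℤ) : ℝ × ℝ × ℝ := by
  classical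
  exact if h : ∃ p, IsFit f g t Br x (64 * rad s) p then h.choose else 0

theorem Good.card_le {Br : Finset (ℤ × ℤ)} {θ : ℕ → ℝ} (hθ : ∀ s, θ s ≤ 1 / 2 ^ 20) {s : ℕ}
    {x : ℤ × ℤ} (h : Good Br θ s x) : 2 ^ 20 * ((Br ∩ bx x (64 * rad s)).card : ℤ) ≤ rad s := by
  unfold Good at h
  have h1 := mul_le_mul_of_nonneg_right (hθ s) (rad_pos' s).le
  have h2 : 2 ^ 20 * ((Br ∩ bx x (64 * rad s)).card : ℝ) ≤ rad s := by linarith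
  exact_mod_cast h2

theorem Good.isFit {f g t : ℤ × ℤ → ℝ} {Br : Finset (ℤ × ℤ)} (hC : Compat f g t Br) {θ : ℕ → ℝ}
    (hθ : ∀ s, θ s ≤ 1 / 2 ^ 20) {s : ℕ} {x : ℤ × ℤ} (h : Good Br θ s x) :
    IsFit f g t Br x (64 * rad s) (fitp f g t Br s x) := by
  classical
  have hex : ∃ p, IsFit f g t Br x (64 * rad s) p := by
    have := h.card_le hθ
    have := rad_pos s
    exact exists_isFit hC x (by omega) (by omega)
  unfold fitp
  rw [dif_pos hex]
  exact hex.choose_spec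

/-- The size of the rigid motion with parameters `p` on the box of size `r` around `x`. -/
def nrm (x : ℤ × ℤ) (r : ℝ) (p : ℝ × ℝ × ℝ) : ℝ :=
  |p.1| * r + |p.2.1 + p.1 * x.1| + |p.2.2 - p.1 * x.2|

theorem nrm_nonneg (x : ℤ × ℤ) {r : ℝ} (hr : 0 ≤ r) (p : ℝ × ℝ × ℝ) : 0 ≤ nrm x r p := by
  unfold nrm; positivity

theorem nrm_zero (x : ℤ × ℤ) (r : ℝ) : nrm x r 0 = 0 := by simp [nrm]

theorem nrm_add (x : ℤ × ℤ) {r : ℝ} (hr : 0 ≤ r) (p q : ℝ × ℝ × ℝ) :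
    nrm x r (p + q) ≤ nrm x r p + nrm x r q := by
  unfold nrm
  have h1 := mul_le_mul_of_nonneg_right (abs_add_le p.1 q.1) hr
  have h2 := abs_add_le (p.2.1 + p.1 * x.1) (q.2.1 + q.1 * x.1)
  have h3 := abs_add_le (p.2.2 - p.1 * x.2) (q.2.2 - q.1 * x.2)
  simp only [Prod.fst_add, Prod.snd_add]
  have e2 : p.2.1 + q.2.1 + (p.1 + q.1) * x.1 =
    p.2.1 + p.1 * x.1 + (q.2.1 + q.1 * x.1) := by ring
  have e3 : p.2.2 + q.2.2 - (p.1 + q.1) * x.2 =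
    p.2.2 - p.1 * x.2 + (q.2.2 - q.1 * x.2) := by ring
  rw [e2, e3]
  linarith

theorem nrm_smul (x : ℤ × ℤ) (r : ℝ) (c : ℝ) (p : ℝ × ℝ × ℝ) :
    nrm x r (c • p) = |c| * nrm x r p := by
  unfold nrm
  simp only [Prod.smul_fst, Prod.smul_snd, smul_eq_mul]
  have e2 : c * p.2.1 + c * p.1 * x.1 = c * (p.2.1 + p.1 * x.1) := by ring
  have e3 : c * p.2.2 - c * p.1 * x.2 = c * (p.2.2 - p.1 * x.2) := by ring
  rw [e2, e3, abs_mul, abs_mul, abs_mul]; ring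

theorem nrm_sub_comm (x : ℤ × ℤ) (r : ℝ) (p q : ℝ × ℝ × ℝ) :
    nrm x r (p - q) = nrm x r (q - p) := by
  have : p - q = (-1 : ℝ) • (q - p) := by simp
  rw [this, nrm_smul]; simp

theorem nrm_sum (x : ℤ × ℤ) {r : ℝ} (hr : 0 ≤ r) {ι : Type*} (S : Finset ι)
    (p : ι → ℝ × ℝ × ℝ) : nrm x r (∑ i ∈ S, p i) ≤ ∑ i ∈ S, nrm x r (p i) := by
  classical
  induction S using Finset.induction_on with
  | empty => simp [nrm_zero]
  | insert a S ha ih =>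
    rw [Finset.sum_insert ha, Finset.sum_insert ha]
    exact (nrm_add x hr _ _).trans (by linarith)

theorem nrm_mono (x : ℤ × ℤ) {r r' : ℝ} (h : r ≤ r') (p : ℝ × ℝ × ℝ) :
    nrm x r p ≤ nrm x r' p := by
  unfold nrm
  have := mul_le_mul_of_nonneg_left h (abs_nonneg p.1)
  linarith

theorem bx_subset {x y : ℤ × ℤ} {m n : ℤ} (h1 : |x.1 - y.1| + m ≤ n) (h2 : |x.2 - y.2| + m ≤ n) :
    bx x m ⊆ bx y n := by
  intro z hz
  rw [mem_bx] at *
  have := abs_le.1 (le_refl |x.1 - y.1|)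
  have := abs_le.1 (le_refl |x.2 - y.2|)
  omega

/-- The normalised strain near `x` at scale `s`. -/
def tau (t : ℤ × ℤ → ℝ) (s : ℕ) (x : ℤ × ℤ) : ℝ :=
  (∑ z ∈ bx x (100 * rad s), t z) / (rad s : ℝ) ^ 2

theorem tau_nonneg {t : ℤ × ℤ → ℝ} (ht : ∀ z, 0 ≤ t z) (s : ℕ) (x : ℤ × ℤ) : 0 ≤ tau t s x :=
  div_nonneg (Finset.sum_nonneg fun z _ => ht z) (by positivity)

theorem nrm_fitp_sub {f g t : ℤ × ℤ → ℝ} {Br : Finset (ℤ × ℤ)} (hC : Compat f g t Br) {θ : ℕ → ℝ}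
    (hθ : ∀ s, θ s ≤ 1 / 2 ^ 20) {s s' : ℕ} (hs : s' = s ∨ s' = s + 1) {x x' y : ℤ × ℤ}
    (h : Good Br θ s x) (h' : Good Br θ s' x')
    (hx : x' ∈ bx x (8 * rad s')) (hy : y ∈ bx x (8 * rad s')) :
    nrm y (rad s') (fitp f g t Br s x - fitp f g t Br s' x') ≤
      10 ^ 15 * (rad s' * tau t s' y) := by
  have hr0 := rad_pos s
  have hr1 : rad s ≤ rad s' := rad_mono (by omega)
  have hr2 : rad s' ≤ 1024 * rad s := by
    rcases hs with rfl | rfl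
    · omega
    · rw [rad_succ]
  have hr0' := rad_pos' s
  have hr1' : (rad s : ℝ) ≤ rad s' := by exact_mod_cast hr1
  have hr2' : (rad s' : ℝ) ≤ 1024 * rad s := by exact_mod_cast hr2
  have hR := rad_pos' s'
  rw [mem_bx] at hx hy
  have c1 := h.card_le hθ
  have c2 := h'.card_le hθ
  obtain ⟨k1, k2, k3⟩ := fit_compare hC (h.isFit hC hθ) (h'.isFit hC hθ) hr0 (by omega)
    (by rcases abs_cases (x'.1 - x.1) with h | h <;> omega)
    (by rcases abs_cases (x'.2 - x.2) with h | h <;> omega) (by omega) (by omega)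
    (ρ := 8 * rad s') (by linarith)
  set p := fitp f g t Br s x
  set p' := fitp f g t Br s' x'
  have hS : (∑ z ∈ bx x (64 * rad s), t z + ∑ z ∈ bx x' (64 * rad s'), t z) / (rad s : ℝ) ^ 2
      ≤ 2 ^ 21 * tau t s' y := by
    have s1 : ∑ z ∈ bx x (64 * rad s), t z ≤ ∑ z ∈ bx y (100 * rad s'), t z :=
      Finset.sum_le_sum_of_subset_of_nonneg (bx_subset
        (by rcases abs_cases (x.1 - y.1) with h | h <;> omega)
        (by rcases abs_cases (x.2 - y.2) with h | h <;> omega)) fun z _ _ => hC.nonneg z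
    have s2 : ∑ z ∈ bx x' (64 * rad s'), t z ≤ ∑ z ∈ bx y (100 * rad s'), t z :=
      Finset.sum_le_sum_of_subset_of_nonneg (bx_subset
        (by rcases abs_cases (x'.1 - y.1) with h | h <;> omega)
        (by rcases abs_cases (x'.2 - y.2) with h | h <;> omega)) fun z _ _ => hC.nonneg z
    have s0 : 0 ≤ ∑ z ∈ bx y (100 * rad s'), t z := Finset.sum_nonneg fun z _ => hC.nonneg z
    unfold tau
    rw [div_le_iff₀ (by positivity), mul_div_assoc', div_mul_eq_mul_div, le_div_iff₀ (by positivity)]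
    have q : (rad s' : ℝ) ^ 2 ≤ 2 ^ 20 * (rad s) ^ 2 := by nlinarith
    set U := ∑ z ∈ bx y (100 * rad s'), t z
    calc _ ≤ (2 * U) * (rad s' : ℝ) ^ 2 := by gcongr; linarith
      _ ≤ (2 * U) * (2 ^ 20 * (rad s) ^ 2) := by gcongr
      _ = _ := by ring
  have hyy : |(y.1 : ℝ) - x.1| ≤ 8 * rad s' ∧ |(y.2 : ℝ) - x.2| ≤ 8 * rad s' := by
    constructor <;> rw [abs_le] <;> constructor
    · have : -(8 * rad s') ≤ y.1 - x.1 := by omega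
      exact_mod_cast this
    · have : y.1 - x.1 ≤ 8 * rad s' := by omega
      exact_mod_cast this
    · have : -(8 * rad s') ≤ y.2 - x.2 := by omega
      exact_mod_cast this
    · have : y.2 - x.2 ≤ 8 * rad s' := by omega
      exact_mod_cast this
  have k2' := k2 y.1 hyy.1
  have k3' := k3 y.2 hyy.2
  rw [mul_div_assoc] at k1 k2' k3'
  set Z := (∑ z ∈ bx x (64 * rad s), t z + ∑ z ∈ bx x' (64 * rad s'), t z) / (rad s : ℝ) ^ 2
  have j1 := mul_le_mul_of_nonneg_right (k1.trans (mul_le_mul_of_nonneg_left hS (by norm_num)))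
    hR.le
  have j2 := mul_le_mul_of_nonneg_right hS hR.le
  have e2 : (p - p').2.1 + (p - p').1 * y.1 =
    (p.2.1 + p.1 * y.1) - (p'.2.1 + p'.1 * y.1) := by
      simp only [Prod.fst_sub, Prod.snd_sub]; ring
  have e3 : (p - p').2.2 - (p - p').1 * y.2 =
    (p.2.2 - p.1 * y.2) - (p'.2.2 - p'.1 * y.2) := by
      simp only [Prod.fst_sub, Prod.snd_sub]; ring
  unfold nrm
  rw [e2, e3, Prod.fst_sub]
  have : 0 ≤ (rad s' : ℝ) * tau t s' y := mul_nonneg hR.le (tau_nonneg hC.nonneg _ _)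
  nlinarith

/-- The average of the chosen fits over the square with lower corner `x` at scale `s`. -/
def avgp (F : ℕ → ℤ × ℤ → ℝ × ℝ × ℝ) (s : ℕ) (x : ℤ × ℤ) : ℝ × ℝ × ℝ :=
  ((rad s : ℝ) ^ 2)⁻¹ • ∑ p ∈ Finset.Ico 0 (rad s) ×ˢ Finset.Ico 0 (rad s), F s (x + p)

theorem card_square (r : ℤ) (hr : 0 ≤ r) :
    (((Finset.Ico 0 r ×ˢ Finset.Ico 0 r).card : ℕ) : ℝ) = (r : ℝ) ^ 2 := by
  rw [Finset.card_product, Int.card_Ico]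
  have : ((r - 0).toNat : ℝ) = r := by
    have : ((r - 0).toNat : ℤ) = r := by omega
    exact_mod_cast this
  push_cast
  rw [this]; ring

theorem nrm_avgp_sub_le {F : ℕ → ℤ × ℤ → ℝ × ℝ × ℝ} {s : ℕ} {x y : ℤ × ℤ} {r B : ℝ} (hr : 0 ≤ r)
    {a : ℝ × ℝ × ℝ}
    (h : ∀ p ∈ Finset.Ico 0 (rad s) ×ˢ Finset.Ico 0 (rad s), nrm y r (F s (x + p) - a) ≤ B) :
    nrm y r (avgp F s x - a) ≤ B := by
  have hR := rad_pos' s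
  have e : avgp F s x - a = ((rad s : ℝ) ^ 2)⁻¹ •
      ∑ p ∈ Finset.Ico 0 (rad s) ×ˢ Finset.Ico 0 (rad s), (F s (x + p) - a) := by
    rw [Finset.sum_sub_distrib, smul_sub, Finset.sum_const, ← Nat.cast_smul_eq_nsmul ℝ,
      card_square _ (rad_pos s).le, smul_smul, inv_mul_cancel₀ (by positivity), one_smul]
    rfl
  rw [e, nrm_smul, abs_of_nonneg (by positivity)]
  calc _ ≤ ((rad s : ℝ) ^ 2)⁻¹ * ∑ p ∈ Finset.Ico 0 (rad s) ×ˢ Finset.Ico 0 (rad s), B := by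
        gcongr
        exact (nrm_sum y hr _ _).trans (Finset.sum_le_sum h)
    _ = B := by
        rw [Finset.sum_const, nsmul_eq_mul, card_square _ (rad_pos s).le]; field_simp

theorem sum_Ico_shift {M : Type*} [AddCommGroup M] (r : ℤ) (hr : 0 ≤ r) (φ : ℤ → M) :
    ∑ p ∈ Finset.Ico 0 r, (φ (p + 1) - φ p) = φ r - φ 0 := by
  obtain ⟨n, rfl⟩ := Int.eq_ofNat_of_zero_le hr
  induction n with
  | zero => simp
  | succ n ih =>
    have : Finset.Ico (0 : ℤ) ((n + 1 : ℕ) : ℤ) = insert (n : ℤ) (Finset.Ico 0 (n : ℤ)) := by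
      ext z; simp only [Finset.mem_Ico, Finset.mem_insert]; push_cast; omega
    rw [this, Finset.sum_insert (by simp), ih (by omega)]
    push_cast
    abel

/-- Bond differences of the averaged fits gain a factor of the scale. -/
theorem nrm_avgp_shift {F : ℕ → ℤ × ℤ → ℝ × ℝ × ℝ} {s : ℕ} {x y : ℤ × ℤ} {r B : ℝ} (hr : 0 ≤ r)
    (h : ∀ p ∈ Finset.Icc 0 (rad s) ×ˢ Finset.Icc 0 (rad s),
      ∀ q ∈ Finset.Icc 0 (rad s) ×ˢ Finset.Icc 0 (rad s), nrm y r (F s (x + p) - F s (x + q)) ≤ B)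
    {b : ℤ × ℤ} (hb : b = (1, 0) ∨ b = (0, 1) ∨ b = (1, 1)) :
    nrm y r (avgp F s (x + b) - avgp F s x) ≤ 2 * B / rad s := by
  have hR := rad_pos' s
  have hRi := rad_pos s
  set I := Finset.Ico 0 (rad s) with hI
  set φ : ℤ × ℤ → ℝ × ℝ × ℝ := fun p => F s (x + p) with hφ
  have hB : 0 ≤ B := (nrm_nonneg y hr _).trans
    (h (0, 0) (by simp; omega) (0, 0) (by simp; omega))
  have hIc : (I.card : ℝ) = rad s := by
    rw [hI, Int.card_Ico]
    have : ((rad s - 0).toNat : ℤ) = rad s := by omega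
    exact_mod_cast this
  have h1 : ∀ k : ℤ, 0 ≤ k → k ≤ 1 →
      nrm y r (∑ p ∈ I ×ˢ I, (φ (p.1 + 1, p.2 + k) - φ (p.1, p.2 + k))) ≤ rad s * B := by
    intro k hk0 hk1
    rw [Finset.sum_product_right]
    refine (nrm_sum y hr _ _).trans ?_
    rw [← hIc, ← nsmul_eq_mul, ← Finset.sum_const]
    refine Finset.sum_le_sum fun q hq => ?_
    rw [hI, Finset.mem_Ico] at hq
    have := sum_Ico_shift (rad s) hRi.le (fun p => φ (p, q + k))
    simp only at this ⊢
    rw [hI, this]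
    exact h _ (by simp; omega) _ (by simp; omega)
  have h2 : nrm y r (∑ p ∈ I ×ˢ I, (φ (p.1, p.2 + 1) - φ (p.1, p.2))) ≤ rad s * B := by
    rw [Finset.sum_product]
    refine (nrm_sum y hr _ _).trans ?_
    rw [← hIc, ← nsmul_eq_mul, ← Finset.sum_const]
    refine Finset.sum_le_sum fun q hq => ?_
    rw [hI, Finset.mem_Ico] at hq
    have := sum_Ico_shift (rad s) hRi.le (fun p => φ (q, p))
    simp only at this ⊢
    rw [hI, this]
    exact h _ (by simp; omega) _ (by simp; omega)
  have e : avgp F s (x + b) - avgp F s x = ((rad s : ℝ) ^ 2)⁻¹ •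
      ∑ p ∈ I ×ˢ I, (φ (p + b) - φ p) := by
    rw [Finset.sum_sub_distrib, smul_sub]
    unfold avgp
    congr 3
    ext1 p
    simp only [hφ]
    congr 1; abel
  have h3 : nrm y r (∑ p ∈ I ×ˢ I, (φ (p + b) - φ p)) ≤ 2 * (rad s * B) := by
    have hnn : 0 ≤ (rad s : ℝ) * B := by positivity
    rcases hb with rfl | rfl | rfl
    · have := h1 0 le_rfl (by norm_num)
      have e2 : ∑ p ∈ I ×ˢ I, (φ (p + (1, 0)) - φ p) =
        ∑ p ∈ I ×ˢ I, (φ (p.1 + 1, p.2 + 0) - φ (p.1, p.2 + 0)) :=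
        Finset.sum_congr rfl fun p _ => by simp [Prod.add_def]
      rw [e2]; linarith
    · have e2 : ∑ p ∈ I ×ˢ I, (φ (p + (0, 1)) - φ p) =
        ∑ p ∈ I ×ˢ I, (φ (p.1, p.2 + 1) - φ (p.1, p.2)) :=
        Finset.sum_congr rfl fun p _ => by simp [Prod.add_def]
      rw [e2]; linarith
    · have := h1 1 (by norm_num) le_rfl
      have e2 : ∑ p ∈ I ×ˢ I, (φ (p + (1, 1)) - φ p) =
        ∑ p ∈ I ×ˢ I, (φ (p.1 + 1, p.2 + 1) - φ (p.1, p.2 + 1)) +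
        ∑ p ∈ I ×ˢ I, (φ (p.1, p.2 + 1) - φ (p.1, p.2)) := by
        rw [← Finset.sum_add_distrib]
        exact Finset.sum_congr rfl fun p _ => by simp [Prod.add_def]
      rw [e2]
      exact (nrm_add y hr _ _).trans (by linarith)
  rw [e, nrm_smul, abs_of_nonneg (by positivity)]
  calc _ ≤ ((rad s : ℝ) ^ 2)⁻¹ * (2 * (rad s * B)) := by gcongr
    _ = _ := by field_simp

/-- The `ℓ^∞` distance on the lattice. -/
def dst (x z : ℤ × ℤ) : ℤ := max |x.1 - z.1| |x.2 - z.2|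

theorem dst_le {x z : ℤ × ℤ} {n : ℤ} : dst x z ≤ n ↔
    (-n ≤ x.1 - z.1 ∧ x.1 - z.1 ≤ n) ∧ (-n ≤ x.2 - z.2 ∧ x.2 - z.2 ≤ n) := by
  rw [dst, max_le_iff, abs_le, abs_le]

theorem mem_bx_iff_dst {x z : ℤ × ℤ} {n : ℤ} : z ∈ bx x n ↔ dst x z ≤ n := by
  rw [mem_bx, dst_le]; omega

theorem dst_comm (x z : ℤ × ℤ) : dst x z = dst z x := by
  rw [dst, dst, abs_sub_comm, abs_sub_comm x.2]

theorem dst_triangle (x y z : ℤ × ℤ) : dst x z ≤ dst x y + dst y z := by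
  have h1 := dst_le.1 (le_refl (dst x y))
  have h2 := dst_le.1 (le_refl (dst y z))
  rw [dst_le]; omega

theorem dst_nonneg (x z : ℤ × ℤ) : 0 ≤ dst x z := le_max_of_le_left (abs_nonneg _)

theorem dst_self (x : ℤ × ℤ) : dst x x = 0 := by simp [dst]

/-- How deep `x` lies inside the neighbourhoods of bad points of scales at most `j`. -/
def rho (Br : Finset (ℤ × ℤ)) (θ : ℕ → ℝ) (j : ℕ) (x : ℤ × ℤ) : ℕ :=
  sSup {m : ℕ | m = 0 ∨ ∃ s ≤ j, ∃ z, ¬ Good Br θ s z ∧ dst x z + m ≤ 2 ^ 24 * rad s}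

section rho
variable {Br : Finset (ℤ × ℤ)} {θ : ℕ → ℝ} {j : ℕ}

theorem rho_bddAbove (x : ℤ × ℤ) :
    BddAbove {m : ℕ | m = 0 ∨ ∃ s ≤ j, ∃ z, ¬ Good Br θ s z ∧ dst x z + m ≤ 2 ^ 24 * rad s} := by
  refine ⟨(2 ^ 24 * rad j).toNat, ?_⟩
  rintro m (rfl | ⟨s, hs, z, -, hm⟩)
  · omega
  · have := rad_mono hs
    have := dst_nonneg x z
    omega

theorem rho_cases (x : ℤ × ℤ) : rho Br θ j x = 0 ∨
    ∃ s ≤ j, ∃ z, ¬ Good Br θ s z ∧ dst x z + rho Br θ j x ≤ 2 ^ 24 * rad s :=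
  Nat.sSup_mem (s := {m : ℕ | m = 0 ∨ ∃ s ≤ j, ∃ z, ¬ Good Br θ s z ∧
    dst x z + m ≤ 2 ^ 24 * rad s}) ⟨0, Or.inl rfl⟩ (rho_bddAbove x)

theorem rho_ge {s : ℕ} (hs : s ≤ j) {z : ℤ × ℤ} (hz : ¬ Good Br θ s z) (x : ℤ × ℤ) :
    2 ^ 24 * rad s - dst x z ≤ rho Br θ j x := by
  by_cases h : 0 ≤ 2 ^ 24 * rad s - dst x z
  · have : (2 ^ 24 * rad s - dst x z).toNat ≤ rho Br θ j x :=
      le_csSup (rho_bddAbove x) (Or.inr ⟨s, hs, z, hz, by omega⟩)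
    omega
  · omega

theorem rho_lip (x y : ℤ × ℤ) : (rho Br θ j x : ℤ) ≤ rho Br θ j y + dst x y := by
  rcases rho_cases (Br := Br) (θ := θ) (j := j) x with h | ⟨s, hs, z, hz, h⟩
  · have := dst_nonneg x y; omega
  · have := rho_ge hs hz y
    have := dst_triangle y x z
    rw [dst_comm y x] at this
    omega

theorem good_of_rho {x z : ℤ × ℤ} {s s' : ℕ} (hx : 2 * (rho Br θ j x : ℤ) ≤ 2 ^ 24 * rad s)
    (hs : s ≤ s') (hs' : s' ≤ j) (hz : dst x z ≤ 2 ^ 22 * rad s') : Good Br θ s' z := by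
  by_contra hb
  have h1 := rho_ge hs' hb x
  have h2 := rad_mono hs
  have h3 := rad_pos s'
  omega

end rho

/-- Cumulative weights of the scale decomposition. -/
def cumw (j s : ℕ) (ρ : ℝ) : ℝ :=
  if s = 0 then 0 else if j < s then 1 else min 1 (max 0 (2 - 8 * ρ / (2 ^ 24 * rad (s - 1))))

theorem cumw_nonneg (j s : ℕ) (ρ : ℝ) : 0 ≤ cumw j s ρ := by
  unfold cumw; split_ifs
  · exact le_rfl
  · norm_num
  · exact le_min (by norm_num) (le_max_left _ _)

theorem cumw_le_one (j s : ℕ) (ρ : ℝ) : cumw j s ρ ≤ 1 := by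
  unfold cumw; split_ifs
  · norm_num
  · exact le_rfl
  · exact min_le_left _ _

theorem cumw_mono (j : ℕ) {s : ℕ} {ρ : ℝ} (hρ : 0 ≤ ρ) : cumw j s ρ ≤ cumw j (s + 1) ρ := by
  rcases Nat.eq_zero_or_pos s with rfl | hs
  · simpa [cumw] using cumw_nonneg j 1 ρ
  by_cases h1 : j < s + 1
  · have : cumw j (s + 1) ρ = 1 := by simp [cumw, h1]
    rw [this]; exact cumw_le_one _ _ _
  · have h2 : ¬ j < s := by omega
    unfold cumw
    rw [if_neg (by omega), if_neg h2, if_neg (by omega), if_neg h1]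
    have h4 : (rad (s - 1) : ℝ) ≤ rad (s + 1 - 1) := by exact_mod_cast rad_mono (by omega)
    have h5 := rad_pos' (s - 1)
    gcongr

theorem cumw_lip (j s : ℕ) (ρ ρ' : ℝ) :
    |cumw j (s + 1) ρ - cumw j (s + 1) ρ'| ≤ 8 / (2 ^ 24 * rad s) * |ρ - ρ'| := by
  have h5 := rad_pos' s
  by_cases h : j < s + 1
  · simp only [cumw, h, if_true, Nat.succ_ne_zero, if_false, sub_self, abs_zero]; positivity
  · simp only [cumw, h, Nat.succ_ne_zero, if_false, Nat.add_sub_cancel]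
    refine (abs_min_sub_min_le_max _ _ _ _).trans ?_
    rw [sub_self, abs_zero, max_eq_right (abs_nonneg _)]
    refine (abs_max_sub_max_le_max _ _ _ _).trans ?_
    rw [sub_self, abs_zero, max_eq_right (abs_nonneg _)]
    have : (2 - 8 * ρ / (2 ^ 24 * (rad s : ℝ)) - (2 - 8 * ρ' / (2 ^ 24 * rad s))) =
      8 / (2 ^ 24 * rad s) * (ρ' - ρ) := by ring
    rw [this, abs_mul, abs_of_nonneg (by positivity), abs_sub_comm]

theorem cumw_pos_imp {j s : ℕ} {ρ : ℝ} (hs : s < j) (h : cumw j (s + 1) ρ ≠ 0) :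
    4 * ρ < 2 ^ 24 * rad s := by
  by_contra hcon
  push Not at hcon
  apply h
  have h5 := rad_pos' s
  unfold cumw
  rw [if_neg (by omega), if_neg (by omega), Nat.add_sub_cancel]
  have : 2 ≤ 8 * ρ / (2 ^ 24 * (rad s : ℝ)) := by
    rw [le_div_iff₀ (by positivity)]; linarith
  rw [max_eq_left (by linarith)]
  norm_num

theorem cumw_lt_imp {j s : ℕ} {ρ : ℝ} (h : cumw j (s + 1) ρ ≠ 1) :
    2 ^ 24 * rad s < 8 * ρ := by
  by_contra hcon
  push Not at hcon
  apply h
  have h5 := rad_pos' s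
  unfold cumw
  rw [if_neg (by omega)]
  split_ifs
  · rfl
  rw [Nat.add_sub_cancel]
  have : 8 * ρ / (2 ^ 24 * (rad s : ℝ)) ≤ 1 := by
    rw [div_le_iff₀ (by positivity)]; linarith
  apply min_eq_left
  exact le_max_of_le_right (by linarith)

theorem sum_cumw_parts {M : Type*} [AddCommGroup M] [Module ℝ M] (K : ℕ → ℝ) (u : ℕ → M) (j : ℕ) :
    ∑ s ∈ Finset.range (j + 1), (K (s + 1) - K s) • u s =
      K (j + 1) • u j - K 0 • u 0 + ∑ s ∈ Finset.range j, K (s + 1) • (u s - u (s + 1)) := by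
  induction j with
  | zero => simp [sub_smul]
  | succ j ih =>
    rw [Finset.sum_range_succ, ih, Finset.sum_range_succ, smul_sub, sub_smul]
    abel

/-- The multi-scale field of rigid motions. -/
def fld (F : ℕ → ℤ × ℤ → ℝ × ℝ × ℝ) (ρ : ℤ × ℤ → ℕ) (j : ℕ) (x : ℤ × ℤ) : ℝ × ℝ × ℝ :=
  ∑ s ∈ Finset.range (j + 1), (cumw j (s + 1) (ρ x) - cumw j s (ρ x)) • avgp F s x

/-- The scales that may contribute at a point of depth `ρ`. -/
def act (j : ℕ) (ρ : ℕ) : Finset ℕ :=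
  (Finset.range (j + 1)).filter
    (fun s => (s = 0 ∨ 2 ^ 24 * rad s ≤ 2 ^ 14 * (ρ : ℤ)) ∧ 2 * (ρ : ℤ) ≤ 2 ^ 24 * rad s)

theorem avgp_cross {f g t : ℤ × ℤ → ℝ} {Br : Finset (ℤ × ℤ)} (hC : Compat f g t Br) {θ : ℕ → ℝ}
    (hθ : ∀ s, θ s ≤ 1 / 2 ^ 20) {j s : ℕ} (hs : s + 1 ≤ j) {x x' : ℤ × ℤ}
    (hx : 2 * (rho Br θ j x : ℤ) ≤ 2 ^ 24 * rad s) (hx' : dst x x' ≤ 1) :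
    nrm x (rad (s + 1)) (avgp (fitp f g t Br) s x' - avgp (fitp f g t Br) (s + 1) x') ≤
      10 ^ 15 * (rad (s + 1) * tau t (s + 1) x) := by
  have hr := rad_pos s
  have hr1 := rad_succ s
  rw [dst_le] at hx'
  refine nrm_avgp_sub_le (rad_pos' _).le fun p hp => ?_
  rw [nrm_sub_comm]
  refine nrm_avgp_sub_le (rad_pos' _).le fun q hq => ?_
  rw [nrm_sub_comm]
  simp only [Finset.mem_product, Finset.mem_Ico] at hp hq
  apply nrm_fitp_sub hC hθ (Or.inr rfl)
  · apply good_of_rho hx le_rfl (by omega)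
    rw [dst_le]; simp only [Prod.fst_add, Prod.snd_add]; omega
  · apply good_of_rho hx (by omega) hs
    rw [dst_le]; simp only [Prod.fst_add, Prod.snd_add]; omega
  · rw [mem_bx]; simp only [Prod.fst_add, Prod.snd_add]; omega
  · rw [mem_bx]; simp only [Prod.fst_add, Prod.snd_add]; omega

theorem avgp_bond {f g t : ℤ × ℤ → ℝ} {Br : Finset (ℤ × ℤ)} (hC : Compat f g t Br) {θ : ℕ → ℝ}
    (hθ : ∀ s, θ s ≤ 1 / 2 ^ 20) {j s : ℕ} (hs : s ≤ j) {x b : ℤ × ℤ}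
    (hx : 2 * (rho Br θ j x : ℤ) ≤ 2 ^ 24 * rad s) (hb : b = (1, 0) ∨ b = (0, 1) ∨ b = (1, 1)) :
    nrm x 1 (avgp (fitp f g t Br) s (x + b) - avgp (fitp f g t Br) s x) ≤
      2 * 10 ^ 15 * tau t s x := by
  have hr := rad_pos s
  have hr' := rad_pos' s
  refine (nrm_mono x (one_le_rad s) _).trans ?_
  refine (nrm_avgp_shift (B := 10 ^ 15 * (rad s * tau t s x)) hr'.le (fun p hp q hq => ?_)
    hb).trans (le_of_eq ?_)
  · simp only [Finset.mem_product, Finset.mem_Icc] at hp hq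
    apply nrm_fitp_sub hC hθ (Or.inl rfl)
    · apply good_of_rho hx le_rfl (by omega)
      rw [dst_le]; simp only [Prod.fst_add, Prod.snd_add]; omega
    · apply good_of_rho hx le_rfl (by omega)
      rw [dst_le]; simp only [Prod.fst_add, Prod.snd_add]; omega
    · rw [mem_bx]; simp only [Prod.fst_add, Prod.snd_add]; omega
    · rw [mem_bx]; simp only [Prod.fst_add, Prod.snd_add]; omega
  · field_simp

theorem mem_act_of_weight {Br : Finset (ℤ × ℤ)} {θ : ℕ → ℝ} {j s : ℕ} (hs : s ≤ j) {x : ℤ × ℤ}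
    (hx : 2 * (rho Br θ j x : ℤ) ≤ 2 ^ 24 * rad j)
    (h : cumw j (s + 1) (rho Br θ j x) ≠ cumw j s (rho Br θ j x)) :
    s ∈ act j (rho Br θ j x) := by
  set ρ := rho Br θ j x
  have hmono := cumw_mono j (s := s) (ρ := ρ) (by positivity)
  have h1 : cumw j (s + 1) ρ ≠ 0 := by
    intro h0; exact h (le_antisymm (by rw [h0]; exact cumw_nonneg _ _ _) hmono)
  have h2 : cumw j s ρ ≠ 1 := by
    intro h0; exact h (le_antisymm (by rw [h0]; exact cumw_le_one _ _ _) hmono)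
  rw [act, Finset.mem_filter, Finset.mem_range]
  refine ⟨by omega, ?_, ?_⟩
  · rcases Nat.eq_zero_or_pos s with h0 | h0
    · exact Or.inl h0
    · right
      obtain ⟨s, rfl⟩ := Nat.exists_eq_add_of_lt h0
      rw [zero_add] at *
      have := cumw_lt_imp h2
      have : 2 ^ 24 * rad s < 8 * (ρ : ℤ) := by exact_mod_cast this
      rw [rad_succ]; omega
  · rcases hs.lt_or_eq with h0 | rfl
    · have := cumw_pos_imp h0 h1
      have : 4 * (ρ : ℤ) < 2 ^ 24 * rad s := by exact_mod_cast this
      omega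
    · exact hx

theorem dst_bond (x : ℤ × ℤ) {b : ℤ × ℤ} (hb : b = (1, 0) ∨ b = (0, 1) ∨ b = (1, 1)) :
    dst x (x + b) ≤ 1 := by
  rw [dst_le]
  rcases hb with rfl | rfl | rfl <;> simp

/-- The bond strain of the multi-scale field is controlled by the active scales. -/
theorem nrm_fld_bond {f g t : ℤ × ℤ → ℝ} {Br : Finset (ℤ × ℤ)} (hC : Compat f g t Br) {θ : ℕ → ℝ}
    (hθ : ∀ s, θ s ≤ 1 / 2 ^ 20) {j : ℕ} {x b : ℤ × ℤ}
    (hx : 2 * (rho Br θ j x : ℤ) ≤ 2 ^ 24 * rad j)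
    (hb : b = (1, 0) ∨ b = (0, 1) ∨ b = (1, 1)) :
    nrm x 1 (fld (fitp f g t Br) (rho Br θ j) j (x + b) -
      fld (fitp f g t Br) (rho Br θ j) j x) ≤
      3 * 10 ^ 15 * ∑ s ∈ act j (rho Br θ j x), tau t s x := by
  set F := fitp f g t Br
  set R := rho Br θ j with hR
  set c := fun s => avgp F s (x + b) with hc
  set d := fun s => avgp F s x with hd
  have hτ : ∀ s, 0 ≤ tau t s x := fun s => tau_nonneg hC.nonneg s x
  have e : fld F R j (x + b) - fld F R j x =
      ∑ s ∈ Finset.range (j + 1), (cumw j (s + 1) (R x) - cumw j s (R x)) • (c s - d s) +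
      ∑ s ∈ Finset.range j, (cumw j (s + 1) (R (x + b)) - cumw j (s + 1) (R x)) •
        (c s - c (s + 1)) := by
    have e1 := sum_cumw_parts (fun s => cumw j s (R (x + b)) - cumw j s (R x)) c j
    have e2 : cumw j (j + 1) (R (x + b)) - cumw j (j + 1) (R x) = 0 := by simp [cumw]
    have e3 : cumw j 0 (R (x + b)) - cumw j 0 (R x) = 0 := by simp [cumw]
    simp only [e2, e3, zero_smul, sub_zero, zero_add] at e1
    rw [← e1, fld, fld, ← Finset.sum_sub_distrib, ← Finset.sum_add_distrib]
    refine Finset.sum_congr rfl fun s _ => ?_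
    simp only [hc, hd]
    module
  have hact : ∀ s ∈ act j (R x), s ∈ Finset.range (j + 1) := fun s hs => by
    rw [act, Finset.mem_filter] at hs; exact hs.1
  have hd1 := dst_bond x hb
  have b1 : nrm x 1 (∑ s ∈ Finset.range (j + 1),
      (cumw j (s + 1) (R x) - cumw j s (R x)) • (c s - d s)) ≤
      ∑ s ∈ act j (R x), 2 * 10 ^ 15 * tau t s x := by
    refine (nrm_sum x zero_le_one _ _).trans ?_
    rw [← Finset.sum_subset (s₁ := act j (R x)) hact]
    · refine Finset.sum_le_sum fun s hs => ?_
      rw [act, Finset.mem_filter, Finset.mem_range] at hs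
      rw [nrm_smul]
      have h0 := avgp_bond hC hθ (by omega : s ≤ j) hs.2.2 hb
      have h1 := cumw_mono j (s := s) (ρ := R x) (by positivity)
      have h2 := cumw_le_one j (s + 1) (R x)
      have h3 := cumw_nonneg j s (R x)
      rw [abs_of_nonneg (by linarith)]
      have h4 := nrm_nonneg x zero_le_one (c s - d s)
      calc _ ≤ 1 * nrm x 1 (c s - d s) := by gcongr; linarith
        _ ≤ _ := by rw [one_mul]; exact h0
    · intro s hs hs'
      rw [nrm_smul]
      have : cumw j (s + 1) (R x) = cumw j s (R x) := by
        by_contra hne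
        exact hs' (mem_act_of_weight (by simp at hs; omega) hx hne)
      rw [this]; simp
  have b2 : nrm x 1 (∑ s ∈ Finset.range j,
      (cumw j (s + 1) (R (x + b)) - cumw j (s + 1) (R x)) • (c s - c (s + 1))) ≤
      ∑ s ∈ act j (R x), 10 ^ 15 * tau t s x := by
    refine (nrm_sum x zero_le_one _ _).trans ?_
    have h1 : ∀ s ∈ Finset.range j,
        nrm x 1 ((cumw j (s + 1) (R (x + b)) - cumw j (s + 1) (R x)) • (c s - c (s + 1))) ≤
        if s + 1 ∈ act j (R x) then 10 ^ 15 * tau t (s + 1) x else 0 := by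
      intro s hs
      rw [Finset.mem_range] at hs
      rw [nrm_smul]
      have l1 := rho_lip (Br := Br) (θ := θ) (j := j) (x + b) x
      have l2 := rho_lip (Br := Br) (θ := θ) (j := j) x (x + b)
      rw [dst_comm] at l1
      rw [← hR] at l1 l2
      have hp := rad_pos s
      by_cases hne : cumw j (s + 1) (R (x + b)) = cumw j (s + 1) (R x)
      · rw [hne]; simp only [sub_self, abs_zero, zero_mul]
        split_ifs
        · have := hτ (s + 1); positivity
        · exact le_rfl
      · have m1 : 4 * (R x : ℤ) < 2 ^ 24 * rad s + 4 := by
          by_cases h0 : cumw j (s + 1) (R x) = 0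
          · have := cumw_pos_imp hs (ρ := R (x + b)) (by rw [h0] at hne; exact hne)
            have : 4 * (R (x + b) : ℤ) < 2 ^ 24 * rad s := by exact_mod_cast this
            omega
          · have := cumw_pos_imp hs h0
            have : 4 * (R x : ℤ) < 2 ^ 24 * rad s := by exact_mod_cast this
            omega
        have m2 : 2 ^ 24 * rad s < 8 * (R x : ℤ) + 8 := by
          by_cases h0 : cumw j (s + 1) (R x) = 1
          · have := cumw_lt_imp (j := j) (s := s) (ρ := R (x + b)) (by rw [h0] at hne; exact hne)
            have : 2 ^ 24 * rad s < 8 * (R (x + b) : ℤ) := by exact_mod_cast this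
            omega
          · have := cumw_lt_imp h0
            have : 2 ^ 24 * rad s < 8 * (R x : ℤ) := by exact_mod_cast this
            omega
        have hmem : s + 1 ∈ act j (R x) := by
          rw [act, Finset.mem_filter, Finset.mem_range, rad_succ]
          exact ⟨by omega, Or.inr (by omega), by omega⟩
        rw [if_pos hmem]
        have h5 := avgp_cross hC hθ (by omega : s + 1 ≤ j) (x := x) (x' := x + b)
          (by rw [hR] at m1; omega) hd1
        have h6 := nrm_mono x (one_le_rad (s + 1)) (c s - c (s + 1))
        have h7 := cumw_lip j s (R (x + b)) (R x)
        have h8 : |((R (x + b) : ℕ) : ℝ) - (R x : ℕ)| ≤ 1 := by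
          have : |((R (x + b) : ℕ) : ℤ) - (R x : ℕ)| ≤ 1 := by rw [abs_le]; omega
          exact_mod_cast this
        have hrs := rad_pos' s
        have hq : (rad (s + 1) : ℝ) = 1024 * rad s := by exact_mod_cast rad_succ s
        have hT := hτ (s + 1)
        calc _ ≤ (8 / (2 ^ 24 * rad s) * 1) * (10 ^ 15 * (rad (s + 1) * tau t (s + 1) x)) := by
              refine mul_le_mul (h7.trans ?_) (h6.trans h5) (nrm_nonneg _ zero_le_one _)
                (by positivity)
              gcongr
          _ = 1 / 2048 * (10 ^ 15 * tau t (s + 1) x) := by rw [hq]; field_simp; norm_num; ring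
          _ ≤ _ := by
            have : 0 ≤ 10 ^ 15 * tau t (s + 1) x := by positivity
            linarith
    refine (Finset.sum_le_sum h1).trans ?_
    have h2 : ∑ s ∈ Finset.range j, (if s + 1 ∈ act j (R x) then 10 ^ 15 * tau t (s + 1) x else 0)
        ≤ ∑ s ∈ Finset.range (j + 1), (if s ∈ act j (R x) then 10 ^ 15 * tau t s x else 0) := by
      rw [Finset.sum_range_succ' _ j]
      have : 0 ≤ if 0 ∈ act j (R x) then 10 ^ 15 * tau t 0 x else 0 := by
        split_ifs
        · have := hτ 0; positivity
        · exact le_rfl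
      linarith
    refine h2.trans (le_of_eq ?_)
    rw [← Finset.sum_filter]
    congr 1
    ext s
    rw [Finset.mem_filter]
    exact ⟨fun h => h.2, fun h => ⟨hact s h, h⟩⟩
  rw [e]
  refine (nrm_add x zero_le_one _ _).trans ((add_le_add b1 b2).trans (le_of_eq ?_))
  rw [← Finset.mul_sum, ← Finset.mul_sum]; ring

/-- The multi-scale field is close to the coarsest rigid fit. -/
theorem nrm_fld_sub {f g t : ℤ × ℤ → ℝ} {Br : Finset (ℤ × ℤ)} (hC : Compat f g t Br) {θ : ℕ → ℝ}
    (hθ : ∀ s, θ s ≤ 1 / 2 ^ 20) {j : ℕ} {x x0 : ℤ × ℤ}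
    (hx : 2 * (rho Br θ j x : ℤ) ≤ 2 ^ 24 * rad j) (hx0 : dst x x0 ≤ 6 * rad j) :
    nrm x 1 (fld (fitp f g t Br) (rho Br θ j) j x - fitp f g t Br j x0) ≤
      2 * 10 ^ 15 * ∑ s ∈ Finset.range (j + 1), rad s * tau t s x := by
  set F := fitp f g t Br
  set R := rho Br θ j with hR
  have hτ : ∀ s, 0 ≤ tau t s x := fun s => tau_nonneg hC.nonneg s x
  have hr := rad_pos j
  have e : fld F R j x - F j x0 = (avgp F j x - F j x0) +
      ∑ s ∈ Finset.range j, cumw j (s + 1) (R x) • (avgp F s x - avgp F (s + 1) x) := by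
    rw [fld, sum_cumw_parts (fun s => cumw j s (R x)) (fun s => avgp F s x) j]
    have e2 : cumw j (j + 1) (R x) = 1 := by simp [cumw]
    have e3 : cumw j 0 (R x) = 0 := by simp [cumw]
    simp only [e2, e3, zero_smul, one_smul, sub_zero]
    abel
  have b1 : nrm x 1 (avgp F j x - F j x0) ≤ 10 ^ 15 * (rad j * tau t j x) := by
    refine (nrm_mono x (one_le_rad j) _).trans (nrm_avgp_sub_le (rad_pos' _).le fun p hp => ?_)
    simp only [Finset.mem_product, Finset.mem_Ico] at hp
    rw [dst_le] at hx0
    apply nrm_fitp_sub hC hθ (Or.inl rfl)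
    · apply good_of_rho hx le_rfl le_rfl
      rw [dst_le]; simp only [Prod.fst_add, Prod.snd_add]; omega
    · apply good_of_rho hx le_rfl le_rfl
      rw [dst_le]; omega
    · rw [mem_bx]; simp only [Prod.fst_add, Prod.snd_add]; omega
    · rw [mem_bx]; simp only [Prod.fst_add, Prod.snd_add]; omega
  have b2 : nrm x 1 (∑ s ∈ Finset.range j,
      cumw j (s + 1) (R x) • (avgp F s x - avgp F (s + 1) x)) ≤
      ∑ s ∈ Finset.range j, 10 ^ 15 * (rad (s + 1) * tau t (s + 1) x) := by
    refine (nrm_sum x zero_le_one _ _).trans (Finset.sum_le_sum fun s hs => ?_)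
    rw [Finset.mem_range] at hs
    rw [nrm_smul, abs_of_nonneg (cumw_nonneg _ _ _)]
    have hT := hτ (s + 1)
    have hrs := rad_pos' (s + 1)
    by_cases h0 : cumw j (s + 1) (R x) = 0
    · rw [h0, zero_mul]; positivity
    · have h1 := cumw_pos_imp hs h0
      have h2 : 4 * (R x : ℤ) < 2 ^ 24 * rad s := by exact_mod_cast h1
      have h3 := avgp_cross hC hθ (by omega : s + 1 ≤ j) (x := x) (x' := x)
        (by rw [hR] at h2; omega) (by rw [dst_self]; norm_num)
      have h4 := nrm_mono x (one_le_rad (s + 1)) (avgp F s x - avgp F (s + 1) x)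
      have h5 := nrm_nonneg x zero_le_one (avgp F s x - avgp F (s + 1) x)
      calc _ ≤ 1 * nrm x 1 (avgp F s x - avgp F (s + 1) x) := by
            gcongr; exact cumw_le_one _ _ _
        _ ≤ _ := by rw [one_mul]; exact h4.trans h3
  rw [e]
  refine (nrm_add x zero_le_one _ _).trans ((add_le_add b1 b2).trans ?_)
  have h7 : (rad j : ℝ) * tau t j x ≤ ∑ s ∈ Finset.range (j + 1), rad s * tau t s x :=
    Finset.single_le_sum (f := fun s => (rad s : ℝ) * tau t s x)
      (fun s _ => mul_nonneg (rad_pos' _).le (hτ _)) (Finset.self_mem_range_succ j)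
  have h8 : ∑ s ∈ Finset.range j, (rad (s + 1) : ℝ) * tau t (s + 1) x ≤
      ∑ s ∈ Finset.range (j + 1), rad s * tau t s x := by
    rw [Finset.sum_range_succ' _ j]
    exact le_add_of_nonneg_right (mul_nonneg (rad_pos' _).le (hτ _))
  rw [← Finset.mul_sum]
  linarith

theorem card_bx (x : ℤ × ℤ) {n : ℤ} (hn : 0 ≤ n) : ((bx x n).card : ℝ) = (2 * n + 1) ^ 2 := by
  have h : ∀ a : ℤ, ((Finset.Icc (a - n) (a + n)).card : ℝ) = 2 * n + 1 := fun a => by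
    have : ((Finset.Icc (a - n) (a + n)).card : ℤ) = 2 * n + 1 := by rw [Int.card_Icc]; omega
    exact_mod_cast this
  rw [bx, Finset.card_product, Nat.cast_mul, h, h]; ring

theorem mem_bx_comm {x z : ℤ × ℤ} {n : ℤ} : z ∈ bx x n ↔ x ∈ bx z n := by
  rw [mem_bx_iff_dst, mem_bx_iff_dst, dst_comm]

/-- Double counting of box sums. -/
theorem sum_sum_bx_le {w : ℤ × ℤ → ℝ} (hw : ∀ z, 0 ≤ w z) {X S : Finset (ℤ × ℤ)} {n : ℤ}
    (hn : 0 ≤ n) (hS : ∀ x ∈ X, bx x n ⊆ S) :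
    ∑ x ∈ X, ∑ z ∈ bx x n, w z ≤ (2 * n + 1) ^ 2 * ∑ z ∈ S, w z := by
  calc _ = ∑ x ∈ X, ∑ z ∈ S, if z ∈ bx x n then w z else 0 := by
        refine Finset.sum_congr rfl fun x hx => ?_
        rw [← Finset.sum_filter]
        refine Finset.sum_congr ?_ fun _ _ => rfl
        ext z; rw [Finset.mem_filter]
        exact ⟨fun h => ⟨hS x hx h, h⟩, fun h => h.2⟩
    _ = ∑ z ∈ S, ∑ x ∈ X, if z ∈ bx x n then w z else 0 := Finset.sum_comm
    _ ≤ ∑ z ∈ S, (2 * n + 1) ^ 2 * w z := by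
        refine Finset.sum_le_sum fun z _ => ?_
        rw [← Finset.sum_filter, Finset.sum_const, nsmul_eq_mul, ← card_bx z hn]
        refine mul_le_mul_of_nonneg_right ?_ (hw z)
        norm_cast
        refine Finset.card_le_card fun x hx => ?_
        rw [Finset.mem_filter] at hx
        exact mem_bx_comm.1 hx.2
    _ = _ := by rw [Finset.mul_sum]

theorem two_rad_bound (s : ℕ) {k m : ℤ} (hk : 0 ≤ k) (hm : 2 * k + 1 ≤ m) :
    (2 * ((k * rad s : ℤ) : ℝ) + 1) ^ 2 ≤ (m : ℝ) ^ 2 * (rad s : ℝ) ^ 2 := by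
  have h1 := one_le_rad s
  have hk' : (0 : ℝ) ≤ k := by exact_mod_cast hk
  have hm' : 2 * (k : ℝ) + 1 ≤ m := by exact_mod_cast hm
  rw [← mul_pow]
  refine pow_le_pow_left₀ (by push_cast; positivity) ?_ 2
  push_cast
  nlinarith

theorem tau_sq_le {t : ℤ × ℤ → ℝ} (s : ℕ) (x : ℤ × ℤ) :
    tau t s x ^ 2 ≤ 201 ^ 2 / (rad s : ℝ) ^ 2 * ∑ z ∈ bx x (100 * rad s), t z ^ 2 := by
  have hr := rad_pos' s
  have h1 : (∑ z ∈ bx x (100 * rad s), t z) ^ 2 ≤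
      (bx x (100 * rad s)).card * ∑ z ∈ bx x (100 * rad s), t z ^ 2 :=
    sq_sum_le_card_mul_sum_sq
  have h2 := two_rad_bound s (k := 100) (m := 201) (by norm_num) (by norm_num)
  rw [card_bx x (by have := rad_pos s; omega)] at h1
  have h3 : 0 ≤ ∑ z ∈ bx x (100 * rad s), t z ^ 2 := Finset.sum_nonneg fun _ _ => sq_nonneg _
  rw [tau, div_pow, div_mul_eq_mul_div, div_le_div_iff₀ (by positivity) (by positivity)]
  have h4 := h1.trans (mul_le_mul_of_nonneg_right h2 h3)
  push_cast at h4
  calc _ ≤ (201 ^ 2 * (rad s : ℝ) ^ 2 * ∑ z ∈ bx x (100 * rad s), t z ^ 2) * (rad s : ℝ) ^ 2 := by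
        gcongr
    _ = _ := by ring

theorem sum_tau_sq_le {t : ℤ × ℤ → ℝ} {s : ℕ} {X S : Finset (ℤ × ℤ)}
    (hS : ∀ x ∈ X, bx x (100 * rad s) ⊆ S) :
    ∑ x ∈ X, tau t s x ^ 2 ≤ 201 ^ 4 * ∑ z ∈ S, t z ^ 2 := by
  have hr := rad_pos' s
  have h3 : 0 ≤ ∑ z ∈ S, t z ^ 2 := Finset.sum_nonneg fun _ _ => sq_nonneg _
  have h2 := two_rad_bound s (k := 100) (m := 201) (by norm_num) (by norm_num)
  calc _ ≤ ∑ x ∈ X, 201 ^ 2 / (rad s : ℝ) ^ 2 * ∑ z ∈ bx x (100 * rad s), t z ^ 2 :=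
        Finset.sum_le_sum fun x _ => tau_sq_le s x
    _ = 201 ^ 2 / (rad s : ℝ) ^ 2 * ∑ x ∈ X, ∑ z ∈ bx x (100 * rad s), t z ^ 2 := by
        rw [Finset.mul_sum]
    _ ≤ 201 ^ 2 / (rad s : ℝ) ^ 2 * ((2 * ((100 * rad s : ℤ) : ℝ) + 1) ^ 2 * ∑ z ∈ S, t z ^ 2) := by
        gcongr
        exact sum_sum_bx_le (fun z => sq_nonneg _) (by have := rad_pos s; omega) hS
    _ ≤ 201 ^ 2 / (rad s : ℝ) ^ 2 * ((201 : ℤ) ^ 2 * (rad s : ℝ) ^ 2 * ∑ z ∈ S, t z ^ 2) := by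
        gcongr
    _ = _ := by push_cast; field_simp

/-- The scales comparable with a depth, together with the finest one. -/
def near (j : ℕ) (ρ : ℕ) : Finset ℕ :=
  (Finset.range (j + 1)).filter
    (fun s => s = 0 ∨ (512 * rad s ≤ (ρ : ℤ) ∧ (ρ : ℤ) ≤ 2 ^ 24 * rad s))

theorem card_near_le (j ρ : ℕ) : (near j ρ).card ≤ 3 := by
  classical
  by_cases h : ∃ s, s ≠ 0 ∧ s ∈ near j ρ
  · obtain ⟨h1, h2⟩ := Nat.find_spec h
    set s1 := Nat.find h
    have : near j ρ ⊆ {0, s1, s1 + 1} := by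
      intro s hs
      simp only [Finset.mem_insert, Finset.mem_singleton]
      by_contra! hcon
      have h3 : s1 ≤ s := Nat.find_min' h ⟨hcon.1, hs⟩
      have h4 : s1 + 2 ≤ s := by omega
      have h5 := rad_mono h4
      rw [rad_succ, rad_succ] at h5
      have h6 := rad_pos s1
      simp only [near, Finset.mem_filter] at h2 hs
      omega
    exact (Finset.card_le_card this).trans Finset.card_le_three
  · push Not at h
    have : near j ρ ⊆ {0} := fun s hs => by
      by_contra hcon
      exact h s (by simpa using hcon) hs
    exact (Finset.card_le_card this).trans (by simp)

/-- The active strains are square summable. -/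
theorem sum_act_sq_le {t : ℤ × ℤ → ℝ} {Br : Finset (ℤ × ℤ)} {θ : ℕ → ℝ} {j : ℕ}
    {X S : Finset (ℤ × ℤ)} (hS : ∀ x ∈ X, bx x (100 * rad j) ⊆ S) :
    ∑ x ∈ X, (∑ s ∈ act j (rho Br θ j x), tau t s x) ^ 2 ≤ 9 * 201 ^ 4 * ∑ z ∈ S, t z ^ 2 := by
  classical
  set R := rho Br θ j with hR
  have hact : ∀ x, act j (R x) ⊆ near j (R x) := fun x s hs => by
    simp only [act, near, Finset.mem_filter] at hs ⊢
    have := rad_pos s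
    refine ⟨hs.1, hs.2.1.imp_right fun h => ?_⟩
    omega
  have h1 : ∀ x ∈ X, (∑ s ∈ act j (R x), tau t s x) ^ 2 ≤
      3 * ∑ s ∈ Finset.range (j + 1), if s ∈ act j (R x) then tau t s x ^ 2 else 0 := by
    intro x _
    refine sq_sum_le_card_mul_sum_sq.trans ?_
    rw [← Finset.sum_filter]
    have e : (Finset.range (j + 1)).filter (fun s => s ∈ act j (R x)) = act j (R x) := by
      ext s; rw [Finset.mem_filter]
      exact ⟨fun h => h.2, fun h => ⟨(Finset.mem_filter.1 h).1, h⟩⟩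
    rw [e]
    refine mul_le_mul_of_nonneg_right ?_ (Finset.sum_nonneg fun _ _ => sq_nonneg _)
    exact_mod_cast (Finset.card_le_card (hact x)).trans (card_near_le _ _)
  have h2 : ∀ s ∈ Finset.range (j + 1),
      ∑ x ∈ X, (if s ∈ act j (R x) then tau t s x ^ 2 else 0) ≤
      201 ^ 4 * ∑ z ∈ S, if s ∈ near j (R z) then t z ^ 2 else 0 := by
    intro s hs
    have hsj : s ≤ j := by simpa [Nat.lt_succ_iff] using hs
    have hr := rad_pos s
    have hr' := rad_pos' s
    set w : ℤ × ℤ → ℝ := fun z => if s ∈ near j (R z) then t z ^ 2 else 0 with hw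
    have hw0 : ∀ z, 0 ≤ w z := fun z => by rw [hw]; dsimp only; split_ifs <;> positivity
    have hb := two_rad_bound s (k := 100) (m := 201) (by norm_num) (by norm_num)
    calc _ ≤ ∑ x ∈ X, 201 ^ 2 / (rad s : ℝ) ^ 2 * ∑ z ∈ bx x (100 * rad s), w z := by
          refine Finset.sum_le_sum fun x _ => ?_
          split_ifs with hx
          · refine (tau_sq_le s x).trans (le_of_eq ?_)
            congr 1
            refine Finset.sum_congr rfl fun z hz => ?_
            rw [hw]; dsimp only
            rw [if_pos]
            have l1 := rho_lip (Br := Br) (θ := θ) (j := j) x z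
            have l2 := rho_lip (Br := Br) (θ := θ) (j := j) z x
            rw [dst_comm] at l2
            rw [← hR] at l1 l2
            rw [mem_bx_iff_dst] at hz
            simp only [act, near, Finset.mem_filter] at hx ⊢
            refine ⟨hx.1, hx.2.1.imp_right fun h => ?_⟩
            omega
          · exact mul_nonneg (by positivity) (Finset.sum_nonneg fun z _ => hw0 z)
      _ = 201 ^ 2 / (rad s : ℝ) ^ 2 * ∑ x ∈ X, ∑ z ∈ bx x (100 * rad s), w z := by
          rw [Finset.mul_sum]
      _ ≤ 201 ^ 2 / (rad s : ℝ) ^ 2 * ((2 * ((100 * rad s : ℤ) : ℝ) + 1) ^ 2 * ∑ z ∈ S, w z) := by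
          gcongr
          refine sum_sum_bx_le hw0 (by omega) fun x hx => ?_
          refine (bx_subset ?_ ?_).trans (hS x hx) <;>
          · have := rad_mono hsj
            simp only [sub_self, abs_zero]; omega
      _ ≤ 201 ^ 2 / (rad s : ℝ) ^ 2 * ((201 : ℤ) ^ 2 * (rad s : ℝ) ^ 2 * ∑ z ∈ S, w z) := by
          have : 0 ≤ ∑ z ∈ S, w z := Finset.sum_nonneg fun z _ => hw0 z
          gcongr
      _ = _ := by push_cast; field_simp
  calc _ ≤ ∑ x ∈ X, 3 * ∑ s ∈ Finset.range (j + 1),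
        (if s ∈ act j (R x) then tau t s x ^ 2 else 0) := Finset.sum_le_sum h1
    _ = 3 * ∑ s ∈ Finset.range (j + 1), ∑ x ∈ X,
        (if s ∈ act j (R x) then tau t s x ^ 2 else 0) := by
        rw [← Finset.mul_sum, Finset.sum_comm]
    _ ≤ 3 * ∑ s ∈ Finset.range (j + 1), 201 ^ 4 * ∑ z ∈ S,
        (if s ∈ near j (R z) then t z ^ 2 else 0) := by
        gcongr with s hs; exact h2 s hs
    _ = 3 * (201 ^ 4 * ∑ z ∈ S, ∑ s ∈ Finset.range (j + 1),
        (if s ∈ near j (R z) then t z ^ 2 else 0)) := by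
        rw [← Finset.mul_sum, Finset.sum_comm]
    _ ≤ 3 * (201 ^ 4 * ∑ z ∈ S, 3 * t z ^ 2) := by
        gcongr with z _
        rw [← Finset.sum_filter, Finset.sum_const, nsmul_eq_mul]
        refine mul_le_mul_of_nonneg_right ?_ (sq_nonneg _)
        refine le_trans ?_ (show ((3 : ℕ) : ℝ) ≤ 3 by norm_num)
        norm_cast
        refine (Finset.card_le_card ?_).trans (card_near_le j (R z))
        intro s hs; exact (Finset.mem_filter.1 hs).2
    _ = _ := by rw [← Finset.mul_sum]; ring

theorem sum_rad_le (j : ℕ) : ∑ s ∈ Finset.range (j + 1), (rad s : ℝ) ≤ 2 * rad j := by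
  induction j with
  | zero => simp; linarith [rad_pos' 0]
  | succ j ih =>
    rw [Finset.sum_range_succ]
    have : (rad (j + 1) : ℝ) = 1024 * rad j := by exact_mod_cast rad_succ j
    have := rad_pos' j
    linarith

/-- The weighted strains over all scales are square summable. -/
theorem sum_scales_sq_le {t : ℤ × ℤ → ℝ} {j : ℕ}
    {X S : Finset (ℤ × ℤ)} (hS : ∀ x ∈ X, bx x (100 * rad j) ⊆ S) :
    ∑ x ∈ X, (∑ s ∈ Finset.range (j + 1), rad s * tau t s x) ^ 2 ≤
      4 * 201 ^ 4 * (rad j : ℝ) ^ 2 * ∑ z ∈ S, t z ^ 2 := by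
  have h0 : 0 ≤ ∑ z ∈ S, t z ^ 2 := Finset.sum_nonneg fun _ _ => sq_nonneg _
  have hj := rad_pos' j
  have h1 : ∀ x ∈ X, (∑ s ∈ Finset.range (j + 1), rad s * tau t s x) ^ 2 ≤
      2 * rad j * ∑ s ∈ Finset.range (j + 1), rad s * tau t s x ^ 2 := by
    intro x _
    have := Finset.sum_sq_le_sum_mul_sum_of_sq_le_mul (Finset.range (j + 1))
      (r := fun s => (rad s : ℝ) * tau t s x) (f := fun s => (rad s : ℝ))
      (g := fun s => (rad s : ℝ) * tau t s x ^ 2)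
      (fun s _ => (rad_pos' s).le) (fun s _ => mul_nonneg (rad_pos' s).le (sq_nonneg _))
      (fun s _ => le_of_eq (by ring))
    refine this.trans (mul_le_mul_of_nonneg_right (sum_rad_le j) ?_)
    exact Finset.sum_nonneg fun s _ => mul_nonneg (rad_pos' s).le (sq_nonneg _)
  calc _ ≤ ∑ x ∈ X, 2 * rad j * ∑ s ∈ Finset.range (j + 1), rad s * tau t s x ^ 2 :=
        Finset.sum_le_sum h1
    _ = 2 * rad j * ∑ s ∈ Finset.range (j + 1), rad s * ∑ x ∈ X, tau t s x ^ 2 := by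
        rw [← Finset.mul_sum, Finset.sum_comm]
        simp only [Finset.mul_sum]
    _ ≤ 2 * rad j * ∑ s ∈ Finset.range (j + 1), rad s * (201 ^ 4 * ∑ z ∈ S, t z ^ 2) := by
        gcongr with s hs
        · exact (rad_pos' s).le
        · refine sum_tau_sq_le fun x hx => (bx_subset ?_ ?_).trans (hS x hx) <;>
          · have := rad_mono (show s ≤ j by simpa [Nat.lt_succ_iff] using hs)
            simp only [sub_self, abs_zero]; omega
    _ = 2 * rad j * ((∑ s ∈ Finset.range (j + 1), (rad s : ℝ)) * (201 ^ 4 * ∑ z ∈ S, t z ^ 2)) := by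
        rw [Finset.sum_mul]
    _ ≤ 2 * rad j * (2 * rad j * (201 ^ 4 * ∑ z ∈ S, t z ^ 2)) := by
        gcongr; exact sum_rad_le j
    _ = _ := by ring

theorem korn_pointwise {X p h v : ℝ} (hX : X ≤ (p - h - v) ^ 2) :
    X + (-2) * (h * v) ≤ 4 * (h ^ 2 + v ^ 2 + p ^ 2) := by
  nlinarith [sq_nonneg (p + h), sq_nonneg (p + v), sq_nonneg (h - v), sq_nonneg (h + v), sq_nonneg p]

set_option maxHeartbeats 1000000 in
/-- A discrete Korn inequality for compactly supported displacements. -/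
theorem discrete_korn {w₁ w₂ : ℤ × ℤ → ℝ} {S : Finset (ℤ × ℤ)} (h₁ : ∀ z ∉ S, w₁ z = 0)
    {S' : Finset (ℤ × ℤ)}
    {H V P : ℤ × ℤ → ℝ} (hH : ∀ z, H z = w₁ (z + (1, 0)) - w₁ z)
    (hV : ∀ z, V z = w₂ (z + (0, 1)) - w₂ z)
    (hP : ∀ z, P z = (w₁ + w₂) (z + (1, 1)) - (w₁ + w₂) z)
    (hS' : ∀ z ∉ S', H z = 0 ∧ V z = 0 ∧ P z = 0) (X : Finset (ℤ × ℤ)) :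
    ∑ z ∈ X, (w₁ (z + (0, 1)) - w₁ z) ^ 2 ≤ 4 * ∑ z ∈ S', (H z ^ 2 + V z ^ 2 + P z ^ 2) := by
  have sm : ∀ (φ ψ : ℤ × ℤ → ℝ) (a b : ℤ × ℤ), (∀ z ∉ S, φ z = 0) →
      Summable fun z => φ (z + a) * ψ (z + b) := fun φ ψ a b h => by
    refine summable_of_hasFiniteSupport ((S.finite_toSet.image fun z => z - a).subset fun z hz => ?_)
    refine ⟨z + a, ?_, by simp⟩
    by_contra hc
    exact hz (by simp [h _ hc])
  have sh : ∀ (φ : ℤ × ℤ → ℝ) (a : ℤ × ℤ), ∑' z, φ (z + a) = ∑' z, φ z := fun φ a =>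
    (Equiv.addRight a).tsum_eq φ
  have fs : ∀ φ : ℤ × ℤ → ℝ, (∀ z ∉ S', φ z = 0) → Summable fun z => φ z ^ 2 := fun φ h =>
    summable_of_ne_finset_zero (s := S') fun z hz => by rw [h z hz]; norm_num
  have sH := fs H fun z hz => (hS' z hz).1
  have sV := fs V fun z hz => (hS' z hz).2.1
  have sP := fs P fun z hz => (hS' z hz).2.2
  have sH' : Summable fun z => H (z + (0, 1)) ^ 2 := (Equiv.addRight ((0, 1) : ℤ × ℤ)).summable_iff.2 sH
  have sV' : Summable fun z => V (z + (1, 0)) ^ 2 := (Equiv.addRight ((1, 0) : ℤ × ℤ)).summable_iff.2 sV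
  set X' : ℤ × ℤ → ℝ := fun z => w₁ (z + (0, 1)) - w₁ z
  set Y' : ℤ × ℤ → ℝ := fun z => w₂ (z + (1, 0)) - w₂ z
  have key : ∑' z, X' z * Y' z = ∑' z, H (z + (0, 1)) * V (z + (1, 0)) := by
    have e1 : (fun z => X' z * Y' z) = fun z =>
        ((w₁ (z + (0, 1)) * w₂ (z + (1, 0)) + w₁ (z + 0) * w₂ (z + 0)) -
          w₁ (z + (0, 1)) * w₂ (z + 0)) - w₁ (z + 0) * w₂ (z + (1, 0)) := by
      funext z; simp only [X', Y', add_zero]; ring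
    have e2 : (fun z => H (z + (0, 1)) * V (z + (1, 0))) = fun z =>
        ((w₁ (z + (1, 1)) * w₂ (z + (1, 1)) + w₁ (z + (0, 1)) * w₂ (z + (1, 0))) -
          w₁ (z + (1, 1)) * w₂ (z + (1, 0))) - w₁ (z + (0, 1)) * w₂ (z + (1, 1)) := by
      funext z; simp only [hH, hV, add_assoc, Prod.mk_add_mk, zero_add, add_zero]; ring
    have s1 := sm w₁ w₂ (0, 1) (1, 0) h₁
    have s2 := sm w₁ w₂ 0 0 h₁
    have s3 := sm w₁ w₂ (0, 1) 0 h₁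
    have s4 := sm w₁ w₂ 0 (1, 0) h₁
    have s5 := sm w₁ w₂ (1, 1) (1, 1) h₁
    have s6 := sm w₁ w₂ (1, 1) (1, 0) h₁
    have s7 := sm w₁ w₂ (0, 1) (1, 1) h₁
    rw [e1, e2, ((s1.add s2).sub s3).tsum_sub s4, (s1.add s2).tsum_sub s3, s1.tsum_add s2,
      ((s5.add s1).sub s6).tsum_sub s7, (s5.add s1).tsum_sub s6, s5.tsum_add s1]
    have t1 := sh (fun z => w₁ (z + 0) * w₂ (z + 0)) (1, 1)
    have t2 := sh (fun z => w₁ (z + (0, 1)) * w₂ (z + 0)) (1, 0)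
    have t3 := sh (fun z => w₁ (z + 0) * w₂ (z + (1, 0))) (0, 1)
    simp only [add_assoc, Prod.mk_add_mk, zero_add, add_zero] at t1 t2 t3 ⊢
    rw [← t1, ← t2, ← t3]; ring
  have sX : Summable fun z => X' z ^ 2 := by
    have a1 := sm w₁ w₁ (0, 1) (0, 1) h₁
    have a2 := sm w₁ w₁ (0, 1) 0 h₁
    have a3 := sm w₁ w₁ 0 0 h₁
    refine (((a1.sub (a2.mul_left 2)).add a3)).congr fun z => ?_
    simp only [X', add_zero]; ring
  have sXY : Summable fun z => X' z * Y' z := by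
    have a1 := sm w₁ w₂ (0, 1) (1, 0) h₁
    have a2 := sm w₁ w₂ 0 0 h₁
    have a3 := sm w₁ w₂ (0, 1) 0 h₁
    have a4 := sm w₁ w₂ 0 (1, 0) h₁
    refine (((a1.add a2).sub a3).sub a4).congr fun z => ?_
    simp only [X', Y', add_zero]; ring
  have sHV : Summable fun z => H (z + (0, 1)) * V (z + (1, 0)) := by
    refine Summable.of_norm_bounded (sH'.add sV') fun z => ?_
    rw [Real.norm_eq_abs, abs_le]
    constructor <;> nlinarith [sq_nonneg (H (z + (0, 1)) - V (z + (1, 0))),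
      sq_nonneg (H (z + (0, 1)) + V (z + (1, 0))), sq_nonneg (H (z + (0, 1))), sq_nonneg (V (z + (1, 0)))]
  have pt : ∀ z, X' z ^ 2 + 2 * (X' z * Y' z) + (-2) * (H (z + (0, 1)) * V (z + (1, 0))) ≤
      4 * (H (z + (0, 1)) ^ 2 + V (z + (1, 0)) ^ 2 + P z ^ 2) := fun z => by
    have e : X' z + Y' z = P z - H (z + (0, 1)) - V (z + (1, 0)) := by
      simp only [X', Y', hP, hH, hV, add_assoc, Prod.mk_add_mk, zero_add, add_zero, Pi.add_apply]
      ring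
    have e2 : X' z ^ 2 + 2 * (X' z * Y' z) ≤ (P z - H (z + (0, 1)) - V (z + (1, 0))) ^ 2 := by
      rw [← e]; nlinarith [sq_nonneg (Y' z)]
    exact korn_pointwise e2
  have fin : ∑' z, X' z ^ 2 ≤ 4 * ∑' z, (H z ^ 2 + V z ^ 2 + P z ^ 2) := by
    have l1 := Summable.tsum_le_tsum pt ((sX.add (sXY.mul_left 2)).add (sHV.mul_left (-2)))
      (((sH'.add sV').add sP).mul_left 4)
    rw [(sX.add (sXY.mul_left 2)).tsum_add (sHV.mul_left (-2)), sX.tsum_add (sXY.mul_left 2),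
      tsum_mul_left, tsum_mul_left, tsum_mul_left, key, (sH'.add sV').tsum_add sP,
      sH'.tsum_add sV', sh (fun z => H z ^ 2), sh (fun z => V z ^ 2)] at l1
    rw [(sH.add sV).tsum_add sP, sH.tsum_add sV]
    linarith
  refine (sX.sum_le_tsum X fun z _ => sq_nonneg _).trans (fin.trans (le_of_eq ?_))
  congr 1
  refine tsum_eq_sum fun z hz => ?_
  obtain ⟨a, b, c⟩ := hS' z hz
  rw [a, b, c]; norm_num

/-- First component of the rigid motion `p`. -/
def rfst (p : ℝ × ℝ × ℝ) (z : ℤ × ℤ) : ℝ := p.2.2 - p.1 * z.2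

/-- Second component of the rigid motion `p`. -/
def rsnd (p : ℝ × ℝ × ℝ) (z : ℤ × ℤ) : ℝ := p.2.1 + p.1 * z.1

/-- A cutoff function around `x0` at scale `r`. -/
def cutf (r : ℝ) (x0 x : ℤ × ℤ) : ℝ := max 0 (min 1 (2 - dst x x0 / (2 * r)))

theorem cutf_nonneg (r : ℝ) (x0 x : ℤ × ℤ) : 0 ≤ cutf r x0 x := le_max_left _ _

theorem cutf_le_one (r : ℝ) (x0 x : ℤ × ℤ) : cutf r x0 x ≤ 1 :=
  max_le zero_le_one (min_le_left _ _)

theorem cutf_eq_one {r : ℝ} (hr : 0 < r) {x0 x : ℤ × ℤ} (h : (dst x x0 : ℝ) ≤ 2 * r) :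
    cutf r x0 x = 1 := by
  have : (dst x x0 : ℝ) / (2 * r) ≤ 1 := (div_le_one (by positivity)).2 h
  rw [cutf, min_eq_left (by linarith), max_eq_right zero_le_one]

theorem cutf_eq_zero {r : ℝ} (hr : 0 < r) {x0 x : ℤ × ℤ} (h : 4 * r ≤ (dst x x0 : ℝ)) :
    cutf r x0 x = 0 := by
  have : 2 ≤ (dst x x0 : ℝ) / (2 * r) := (le_div_iff₀ (by positivity)).2 (by linarith)
  rw [cutf, max_eq_left]
  exact (min_le_right _ _).trans (by linarith)

theorem cutf_lip {r : ℝ} (hr : 0 < r) {x0 x y : ℤ × ℤ} (h : dst x y ≤ 1) :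
    |cutf r x0 x - cutf r x0 y| ≤ 1 / r := by
  rw [cutf, cutf]
  refine (abs_max_sub_max_le_max _ _ _ _).trans ?_
  rw [sub_self, abs_zero, max_eq_right (abs_nonneg _)]
  refine (abs_min_sub_min_le_max _ _ _ _).trans ?_
  rw [sub_self, abs_zero, max_eq_right (abs_nonneg _)]
  have h1 := dst_triangle x y x0
  have h2 := dst_triangle y x x0
  rw [dst_comm y x] at h2
  have h3 : |(dst x x0 : ℝ) - dst y x0| ≤ 1 := by
    have : |dst x x0 - dst y x0| ≤ 1 := by rw [abs_le]; omega
    exact_mod_cast this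
  have e : 2 - (dst x x0 : ℝ) / (2 * r) - (2 - dst y x0 / (2 * r)) =
      -((dst x x0 - dst y x0) / (2 * r)) := by ring
  rw [e, abs_neg, abs_div, abs_of_pos (by positivity : 0 < 2 * r), div_le_div_iff₀ (by positivity) hr]
  nlinarith [abs_nonneg ((dst x x0 : ℝ) - dst y x0)]

/-- The strain of a cut off rigid field. -/
theorem abs_cut_strain_le {r : ℝ} (hr : 0 < r) {x0 x b : ℤ × ℤ} (hb : dst (x + b) x ≤ 1)
    (L : ℝ × ℝ × ℝ → ℤ × ℤ → ℝ) (hL : ∀ p q z, L (p - q) z = L p z - L q z)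
    (hLb : ∀ p, L p (x + b) = L p x) (hLn : ∀ p, |L p x| ≤ 2 * nrm x 1 p) (w w' : ℝ × ℝ × ℝ) :
    |cutf r x0 (x + b) * L w' (x + b) - cutf r x0 x * L w x| ≤
      2 * nrm x 1 (w' - w) + 2 / r * nrm x 1 w := by
  have e : cutf r x0 (x + b) * L w' (x + b) - cutf r x0 x * L w x =
      cutf r x0 (x + b) * L (w' - w) x + (cutf r x0 (x + b) - cutf r x0 x) * L w x := by
    rw [hLb, hL]; ring
  rw [e]
  refine (abs_add_le _ _).trans ?_
  rw [abs_mul, abs_mul, abs_of_nonneg (cutf_nonneg _ _ _)]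
  have h1 := hLn (w' - w)
  have h2 := hLn w
  have h3 := cutf_lip hr (x0 := x0) hb
  have h4 := cutf_le_one r x0 (x + b)
  refine add_le_add ((mul_le_of_le_one_left (abs_nonneg _) h4).trans h1) ?_
  calc _ ≤ 1 / r * (2 * nrm x 1 w) := mul_le_mul h3 h2 (abs_nonneg _) (by positivity)
    _ = _ := by ring

theorem abs_rfst_le (p : ℝ × ℝ × ℝ) (z : ℤ × ℤ) : |rfst p z| ≤ nrm z 1 p := by
  unfold nrm rfst
  have := abs_nonneg p.1; have := abs_nonneg (p.2.1 + p.1 * z.1); linarith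

theorem abs_rsnd_le (p : ℝ × ℝ × ℝ) (z : ℤ × ℤ) : |rsnd p z| ≤ nrm z 1 p := by
  unfold nrm rsnd
  have := abs_nonneg p.1; have := abs_nonneg (p.2.2 - p.1 * z.2); linarith

theorem rfst_sub (p q : ℝ × ℝ × ℝ) (z : ℤ × ℤ) : rfst (p - q) z = rfst p z - rfst q z := by
  simp only [rfst, Prod.fst_sub, Prod.snd_sub]; ring

theorem rsnd_sub (p q : ℝ × ℝ × ℝ) (z : ℤ × ℤ) : rsnd (p - q) z = rsnd p z - rsnd q z := by
  simp only [rsnd, Prod.fst_sub, Prod.snd_sub]; ring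

/-- Korn's inequality for the multi-scale field near a point of small depth. -/
theorem sum_fld_sq_le {f g t : ℤ × ℤ → ℝ} {Br : Finset (ℤ × ℤ)} (hC : Compat f g t Br) {θ : ℕ → ℝ}
    (hθ : ∀ s, θ s ≤ 1 / 2 ^ 20) {j : ℕ} {x0 : ℤ × ℤ}
    (h0 : ∀ x, dst x x0 ≤ 7 * rad j → 2 * (rho Br θ j x : ℤ) ≤ 2 ^ 24 * rad j)
    {X : Finset (ℤ × ℤ)} (hX : ∀ x ∈ X, dst x x0 < 2 * rad j) :
    ∑ x ∈ X, (rfst (fld (fitp f g t Br) (rho Br θ j) j (x + (0, 1))) (x + (0, 1)) -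
      rfst (fld (fitp f g t Br) (rho Br θ j) j x) x + (fitp f g t Br j x0).1) ^ 2 ≤
      10 ^ 45 * ∑ z ∈ bx x0 (200 * rad j), t z ^ 2 := by
  set v := fld (fitp f g t Br) (rho Br θ j) j with hv
  set a := fitp f g t Br j x0 with ha
  have hr := rad_pos j
  have hr' := rad_pos' j
  set r : ℝ := (rad j : ℝ) with hrr
  set w₁ : ℤ × ℤ → ℝ := fun x => cutf r x0 x * rfst (v x - a) x with hw₁
  set w₂ : ℤ × ℤ → ℝ := fun x => cutf r x0 x * rsnd (v x - a) x with hw₂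
  have hz : ∀ z, 4 * rad j ≤ dst z x0 → cutf r x0 z = 0 := fun z h =>
    cutf_eq_zero hr' (by rw [hrr]; exact_mod_cast h)
  have hS : ∀ z ∉ bx x0 (4 * rad j), cutf r x0 z = 0 := fun z h => by
    rw [mem_bx_iff_dst, dst_comm] at h; exact hz z (by omega)
  set E : ℤ × ℤ → ℝ := fun x => 6 * 10 ^ 15 * ∑ s ∈ act j (rho Br θ j x), tau t s x +
    2 / r * (2 * 10 ^ 15 * ∑ s ∈ Finset.range (j + 1), rad s * tau t s x) with hE
  have bond : ∀ (b : ℤ × ℤ), (b = (1, 0) ∨ b = (0, 1) ∨ b = (1, 1)) → ∀ x ∈ bx x0 (5 * rad j),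
      ∀ L : ℝ × ℝ × ℝ → ℤ × ℤ → ℝ, (∀ p q z, L (p - q) z = L p z - L q z) →
      (∀ p, L p (x + b) = L p x) → (∀ p, |L p x| ≤ 2 * nrm x 1 p) →
      |cutf r x0 (x + b) * L (v (x + b) - a) (x + b) - cutf r x0 x * L (v x - a) x| ≤ E x := by
    intro b hb x hx L h1 h2 h3
    rw [mem_bx_iff_dst, dst_comm] at hx
    refine (abs_cut_strain_le hr' (by rw [dst_comm]; exact dst_bond x hb) L h1 h2 h3 _ _).trans ?_
    have l1 := nrm_fld_bond hC hθ (h0 x (by omega)) hb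
    have l2 := nrm_fld_sub hC hθ (h0 x (by omega)) (x0 := x0) (by omega)
    rw [sub_sub_sub_cancel_right, hE]
    dsimp only
    refine add_le_add (by linarith) (mul_le_mul_of_nonneg_left l2 (by positivity))
  have bond' : ∀ (b : ℤ × ℤ), (b = (1, 0) ∨ b = (0, 1) ∨ b = (1, 1)) → ∀ x ∉ bx x0 (5 * rad j),
      cutf r x0 (x + b) = 0 ∧ cutf r x0 x = 0 := by
    intro b hb x hx
    rw [mem_bx_iff_dst, dst_comm] at hx
    have h1 := dst_bond x hb
    have h2 := dst_triangle x (x + b) x0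
    exact ⟨hz _ (by omega), hz _ (by omega)⟩
  have main := discrete_korn (w₁ := w₁) (w₂ := w₂) (S := bx x0 (4 * rad j))
    (fun z h => by simp only [hw₁, hS z h, zero_mul])
    (S' := bx x0 (5 * rad j)) (fun _ => rfl) (fun _ => rfl) (fun _ => rfl) (fun z h => by
      obtain ⟨p1, p2⟩ := bond' (1, 0) (by tauto) z h
      obtain ⟨p3, -⟩ := bond' (0, 1) (by tauto) z h
      obtain ⟨p4, -⟩ := bond' (1, 1) (by tauto) z h
      simp [hw₁, hw₂, p1, p2, p3, p4]) X
  have e : ∀ x ∈ X, w₁ (x + (0, 1)) - w₁ x =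
      rfst (v (x + (0, 1))) (x + (0, 1)) - rfst (v x) x + a.1 := by
    intro x hx
    have d1 := hX x hx
    have d2 := dst_bond x (b := (0, 1)) (by tauto)
    have d3 := dst_triangle (x + (0, 1)) x x0
    rw [dst_comm (x + (0, 1)) x] at d3
    have c1 : cutf r x0 x = 1 := cutf_eq_one hr' (by rw [hrr]; exact_mod_cast d1.le)
    have c2 : cutf r x0 (x + (0, 1)) = 1 := cutf_eq_one hr' (by
      have : dst (x + (0, 1)) x0 ≤ 2 * rad j := by omega
      rw [hrr]; exact_mod_cast this)
    simp only [hw₁, c1, c2, one_mul, rfst_sub]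
    simp only [rfst, Prod.snd_add]; push_cast; ring
  rw [← Finset.sum_congr rfl fun x hx => congrArg (· ^ 2) (e x hx)]
  refine main.trans ?_
  have pt : ∀ x ∈ bx x0 (5 * rad j), (w₁ (x + (1, 0)) - w₁ x) ^ 2 + (w₂ (x + (0, 1)) - w₂ x) ^ 2 +
      ((w₁ + w₂) (x + (1, 1)) - (w₁ + w₂) x) ^ 2 ≤ 3 * E x ^ 2 := by
    intro x hx
    have b1 := bond (1, 0) (by tauto) x hx rfst rfst_sub (fun p => by simp [rfst])
      (fun p => by linarith [abs_rfst_le p x, nrm_nonneg x zero_le_one p])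
    have b2 := bond (0, 1) (by tauto) x hx rsnd rsnd_sub (fun p => by simp [rsnd])
      (fun p => by linarith [abs_rsnd_le p x, nrm_nonneg x zero_le_one p])
    have b3 := bond (1, 1) (by tauto) x hx (fun p z => rfst p z + rsnd p z)
      (fun p q z => by rw [rfst_sub, rsnd_sub]; ring)
      (fun p => by simp only [rfst, rsnd, Prod.fst_add, Prod.snd_add]; push_cast; ring)
      (fun p => (abs_add_le _ _).trans (by linarith [abs_rfst_le p x, abs_rsnd_le p x]))
    have b4 : |(w₁ + w₂) (x + (1, 1)) - (w₁ + w₂) x| ≤ E x := by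
      convert b3 using 2
      simp only [hw₁, hw₂, Pi.add_apply]; ring
    have q1 := sq_le_sq' (abs_le.1 b1).1 (abs_le.1 b1).2
    have q2 := sq_le_sq' (abs_le.1 b2).1 (abs_le.1 b2).2
    have q3 := sq_le_sq' (abs_le.1 b4).1 (abs_le.1 b4).2
    linarith
  have hsub : ∀ x ∈ bx x0 (5 * rad j), bx x (100 * rad j) ⊆ bx x0 (200 * rad j) := fun x hx => by
    rw [mem_bx] at hx
    refine bx_subset ?_ ?_ <;>
    · rw [← le_sub_iff_add_le, abs_le]; omega
  have s1 := sum_act_sq_le (t := t) (Br := Br) (θ := θ) hsub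
  have s2 := sum_scales_sq_le (t := t) hsub
  set Y := ∑ z ∈ bx x0 (200 * rad j), t z ^ 2
  have hY : 0 ≤ Y := Finset.sum_nonneg fun _ _ => sq_nonneg _
  have pe : ∀ x, E x ^ 2 ≤ 72 * 10 ^ 30 * (∑ s ∈ act j (rho Br θ j x), tau t s x) ^ 2 +
      32 * 10 ^ 30 / r ^ 2 * (∑ s ∈ Finset.range (j + 1), rad s * tau t s x) ^ 2 := by
    intro x
    simp only [hE]
    refine (add_sq_le).trans (le_of_eq ?_)
    field_simp; ring
  calc _ ≤ 4 * ∑ x ∈ bx x0 (5 * rad j), 3 * E x ^ 2 := by gcongr with x hx; exact pt x hx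
    _ ≤ 4 * ∑ x ∈ bx x0 (5 * rad j), 3 * (72 * 10 ^ 30 * (∑ s ∈ act j (rho Br θ j x), tau t s x) ^ 2 +
      32 * 10 ^ 30 / r ^ 2 * (∑ s ∈ Finset.range (j + 1), rad s * tau t s x) ^ 2) := by
        gcongr with x hx; exact pe x
    _ = 12 * (72 * 10 ^ 30 * ∑ x ∈ bx x0 (5 * rad j), (∑ s ∈ act j (rho Br θ j x), tau t s x) ^ 2 +
      32 * 10 ^ 30 / r ^ 2 * ∑ x ∈ bx x0 (5 * rad j),
        (∑ s ∈ Finset.range (j + 1), rad s * tau t s x) ^ 2) := by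
        rw [← Finset.mul_sum, Finset.sum_add_distrib, ← Finset.mul_sum, ← Finset.mul_sum]; ring
    _ ≤ 12 * (72 * 10 ^ 30 * (9 * 201 ^ 4 * Y) + 32 * 10 ^ 30 / r ^ 2 * (4 * 201 ^ 4 * r ^ 2 * Y)) := by
        gcongr
    _ = 12 * (72 * 10 ^ 30 * (9 * 201 ^ 4) + 32 * 10 ^ 30 * (4 * 201 ^ 4)) * Y := by
        field_simp
    _ ≤ _ := by gcongr; norm_num

/-- Away from bad points the field reproduces the first displacement component. -/
theorem abs_sub_rfst_fld_le {f g t : ℤ × ℤ → ℝ} {Br : Finset (ℤ × ℤ)} (hC : Compat f g t Br)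
    {θ : ℕ → ℝ} (hθ : ∀ s, θ s ≤ 1 / 2 ^ 20) {j : ℕ} {x : ℤ × ℤ} (hx : rho Br θ j x ≤ 1) :
    |f x - rfst (fld (fitp f g t Br) (rho Br θ j) j x) x| ≤ 10 ^ 11 * tau t 0 x := by
  set F := fitp f g t Br
  have r0 : rad 0 = 1024 := by unfold rad; norm_num
  have hw : ∀ s, cumw j (s + 1) (rho Br θ j x) = 1 := fun s => by
    by_contra h
    have h1 := cumw_lt_imp h
    have h2 := one_le_rad s
    have h3 : (rho Br θ j x : ℝ) ≤ 1 := by exact_mod_cast hx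
    linarith
  have e : fld F (rho Br θ j) j x = avgp F 0 x := by
    rw [fld, Finset.sum_range_succ']
    have : cumw j 0 (rho Br θ j x) = 0 := by simp [cumw]
    rw [this, hw]
    simp [hw]
  have hg : ∀ z, dst x z ≤ 2 ^ 22 * 1024 → Good Br θ 0 z := fun z hz =>
    good_of_rho (Br := Br) (θ := θ) (j := j) (x := x) (s := 0) (s' := 0)
      (by rw [r0]; omega) le_rfl (Nat.zero_le _) (by rw [r0]; exact hz)
  have hfree : ∀ z, dst x z ≤ 2 ^ 22 * 1024 → Br ∩ bx z (64 * rad 0) = ∅ := fun z hz => by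
    have h1 := (hg z hz).card_le hθ
    rw [r0] at h1
    rw [← Finset.card_eq_zero, r0]; omega
  set T := ∑ z ∈ bx x (100 * rad 0), t z with hT
  have hpt : ∀ p ∈ Finset.Ico 0 (rad 0) ×ˢ Finset.Ico 0 (rad 0),
      |f x - rfst (F 0 (x + p)) x| ≤ 60000 * T := by
    intro p hp
    simp only [Finset.mem_product, Finset.mem_Ico] at hp
    have hd : dst x (x + p) ≤ 2 ^ 22 * 1024 := by
      rw [dst_le]; simp only [Prod.fst_add, Prod.snd_add]; omega
    have h1 := ((hg _ hd).isFit hC hθ).row x.2 (by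
      simp only [Prod.snd_add]; rw [sub_add_cancel_left, abs_neg, abs_of_nonneg hp.2.1]; omega)
      (fun z hz _ hb => by
        have : z ∈ Br ∩ bx (x + p) (64 * rad 0) := Finset.mem_inter.2 ⟨hb, hz⟩
        rw [hfree _ hd] at this; simp at this) x.1
      (by simp only [Prod.fst_add]; omega) (by simp only [Prod.fst_add]; omega)
    have hsub : bx (x + p) (64 * rad 0) ⊆ bx x (100 * rad 0) := by
      refine bx_subset ?_ ?_ <;>
      · simp only [Prod.fst_add, Prod.snd_add]
        rw [← le_sub_iff_add_le, abs_le]; omega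
    have h2 : ∑ z ∈ bx (x + p) (64 * rad 0), t z ≤ T :=
      Finset.sum_le_sum_of_subset_of_nonneg hsub fun z _ _ => hC.nonneg z
    have h3 : lineSum (bx (x + p) (64 * rad 0)) t Prod.snd x.2 ≤ T :=
      (Finset.sum_le_sum_of_subset_of_nonneg (Finset.filter_subset _ _)
        fun z _ _ => hC.nonneg z).trans h2
    have h4 : (∑ z ∈ bx (x + p) (64 * rad 0), t z) / ((64 * rad 0 : ℤ) : ℝ) ≤ T := by
      refine (div_le_self (Finset.sum_nonneg fun z _ => hC.nonneg z) ?_).trans h2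
      rw [r0]; norm_num
    refine h1.trans ?_
    linarith
  have hc := card_square (rad 0) (rad_pos 0).le
  have hr := rad_pos' 0
  have e2 : f x - rfst (avgp F 0 x) x = ((rad 0 : ℝ) ^ 2)⁻¹ *
      ∑ p ∈ Finset.Ico 0 (rad 0) ×ˢ Finset.Ico 0 (rad 0), (f x - rfst (F 0 (x + p)) x) := by
    rw [Finset.sum_sub_distrib, Finset.sum_const, nsmul_eq_mul, hc, mul_sub]
    congr 1
    · field_simp
    · simp only [rfst, avgp, Prod.smul_fst, Prod.smul_snd, Prod.fst_sum, Prod.snd_sum, smul_eq_mul,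
        Finset.sum_sub_distrib, ← Finset.sum_mul]
      ring
  rw [e, e2, abs_mul, abs_of_pos (by positivity)]
  have h5 : |∑ p ∈ Finset.Ico 0 (rad 0) ×ˢ Finset.Ico 0 (rad 0), (f x - rfst (F 0 (x + p)) x)| ≤
      (rad 0 : ℝ) ^ 2 * (60000 * T) := by
    refine (Finset.abs_sum_le_sum_abs _ _).trans ((Finset.sum_le_sum hpt).trans (le_of_eq ?_))
    rw [Finset.sum_const, nsmul_eq_mul, hc]
  have hT0 : 0 ≤ T := Finset.sum_nonneg fun z _ => hC.nonneg z
  calc _ ≤ ((rad 0 : ℝ) ^ 2)⁻¹ * ((rad 0 : ℝ) ^ 2 * (60000 * T)) := by gcongr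
    _ = 60000 * T := by field_simp
    _ ≤ 10 ^ 11 * (T / (rad 0 : ℝ) ^ 2) := by rw [r0]; norm_num; linarith
    _ = _ := rfl

/-- The lower corner of the dyadic square of scale `s` containing `x`. -/
def cor (s : ℕ) (x : ℤ × ℤ) : ℤ × ℤ := (rad s * (x.1 / rad s), rad s * (x.2 / rad s))

/-- The square of scale `s` with lower corner `c`. -/
def sqr (s : ℕ) (c : ℤ × ℤ) : Finset (ℤ × ℤ) :=
  Finset.Ico c.1 (c.1 + rad s) ×ˢ Finset.Ico c.2 (c.2 + rad s)

theorem cor_bounds (s : ℕ) (x : ℤ × ℤ) : ((cor s x).1 ≤ x.1 ∧ x.1 < (cor s x).1 + rad s) ∧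
    ((cor s x).2 ≤ x.2 ∧ x.2 < (cor s x).2 + rad s) := by
  have hr := rad_pos s
  have h1 := Int.emod_add_mul_ediv x.1 (rad s)
  have h2 := Int.emod_add_mul_ediv x.2 (rad s)
  have h3 := Int.emod_nonneg x.1 hr.ne'
  have h4 := Int.emod_nonneg x.2 hr.ne'
  have h5 := Int.emod_lt_of_pos x.1 hr
  have h6 := Int.emod_lt_of_pos x.2 hr
  simp only [cor]
  omega

theorem mem_sqr_cor (s : ℕ) (x : ℤ × ℤ) : x ∈ sqr s (cor s x) := by
  have := cor_bounds s x
  simp only [sqr, Finset.mem_product, Finset.mem_Ico]; exact this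

theorem cor_eq_of_mem {s : ℕ} {x y : ℤ × ℤ} (h : y ∈ sqr s (cor s x)) : cor s y = cor s x := by
  have hr := rad_pos s
  simp only [sqr, cor, Finset.mem_product, Finset.mem_Ico] at h
  obtain ⟨⟨h1, h2⟩, h3, h4⟩ := h
  have e1 : y.1 / rad s = x.1 / rad s := by
    rw [Int.ediv_eq_iff_of_pos hr]; constructor <;> linarith
  have e2 : y.2 / rad s = x.2 / rad s := by
    rw [Int.ediv_eq_iff_of_pos hr]; constructor <;> linarith
  simp only [cor, e1, e2]

theorem cor_cor (s : ℕ) (x : ℤ × ℤ) : cor s (cor s x) = cor s x := by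
  apply cor_eq_of_mem
  have := rad_pos s
  simp only [sqr, Finset.mem_product, Finset.mem_Ico]; omega

theorem mem_sqr_iff {s : ℕ} {c y : ℤ × ℤ} (hc : cor s c = c) : y ∈ sqr s c ↔ cor s y = c := by
  constructor
  · intro h; rw [← hc] at h; rw [cor_eq_of_mem h, hc]
  · rintro rfl; exact mem_sqr_cor s y

theorem card_sqr (s : ℕ) (c : ℤ × ℤ) : ((sqr s c).card : ℝ) = (rad s : ℝ) ^ 2 := by
  rw [← card_square (rad s) (rad_pos s).le, sqr, Finset.card_product, Finset.card_product]
  simp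

theorem dst_cor_lt (s : ℕ) (x : ℤ × ℤ) : dst x (cor s x) < rad s := by
  have := cor_bounds s x
  have h : dst x (cor s x) ≤ rad s - 1 := by rw [dst_le]; omega
  omega

/-- Averaging a quantity attached to dyadic squares over their points. -/
theorem sum_corner_le {s : ℕ} {K : Finset (ℤ × ℤ)} (hK : ∀ c ∈ K, cor s c = c) {φ ψ : ℤ × ℤ → ℝ}
    {Y : Finset (ℤ × ℤ)} (hψ : ∀ y, 0 ≤ ψ y) (h : ∀ c ∈ K, ∀ y ∈ sqr s c, y ∈ Y ∧ φ c ≤ ψ y) :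
    (rad s : ℝ) ^ 2 * ∑ c ∈ K, φ c ≤ ∑ y ∈ Y, ψ y := by
  classical
  have hd : (K : Set (ℤ × ℤ)).PairwiseDisjoint (sqr s) := by
    intro a ha b hb hab
    rw [Function.onFun, Finset.disjoint_left]
    intro y h1 h2
    rw [mem_sqr_iff (hK a ha)] at h1
    rw [mem_sqr_iff (hK b hb)] at h2
    exact hab (h1.symm.trans h2)
  calc _ = ∑ c ∈ K, ∑ y ∈ sqr s c, φ c := by
        rw [Finset.mul_sum]
        refine Finset.sum_congr rfl fun c _ => ?_
        rw [Finset.sum_const, nsmul_eq_mul, card_sqr]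
    _ ≤ ∑ c ∈ K, ∑ y ∈ sqr s c, ψ y :=
        Finset.sum_le_sum fun c hc => Finset.sum_le_sum fun y hy => (h c hc y hy).2
    _ = ∑ y ∈ K.biUnion (sqr s), ψ y := (Finset.sum_biUnion hd).symm
    _ ≤ _ := Finset.sum_le_sum_of_subset_of_nonneg
        (fun y hy => by
          obtain ⟨c, hc, hy⟩ := Finset.mem_biUnion.1 hy
          exact (h c hc y hy).1) fun y _ _ => hψ y

/-- Bounded overlap of boxes centred at the corners of dyadic squares. -/
theorem sum_corner_bx_le {s : ℕ} {K S : Finset (ℤ × ℤ)} (hK : ∀ c ∈ K, cor s c = c)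
    {w : ℤ × ℤ → ℝ} (hw : ∀ z, 0 ≤ w z) {k : ℤ} (hk : 0 ≤ k)
    (hS : ∀ c ∈ K, bx c ((k + 2) * rad s) ⊆ S) :
    ∑ c ∈ K, ∑ z ∈ bx c (k * rad s), w z ≤ (2 * k + 3) ^ 2 * ∑ z ∈ S, w z := by
  classical
  have hr := rad_pos s
  have hr' := rad_pos' s
  have h0 : 0 ≤ ∑ z ∈ S, w z := Finset.sum_nonneg fun z _ => hw z
  have hin : ∀ c ∈ K, ∀ y ∈ sqr s c, (c.1 ≤ y.1 ∧ y.1 < c.1 + rad s) ∧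
      (c.2 ≤ y.2 ∧ y.2 < c.2 + rad s) := fun c _ y hy => by
    simpa only [sqr, Finset.mem_product, Finset.mem_Ico] using hy
  have h1 := sum_corner_le hK (φ := fun c => ∑ z ∈ bx c (k * rad s), w z)
    (ψ := fun y => ∑ z ∈ bx y ((k + 1) * rad s), w z) (Y := K.biUnion (sqr s))
    (fun y => Finset.sum_nonneg fun z _ => hw z) (fun c hc y hy => by
      refine ⟨Finset.mem_biUnion.2 ⟨c, hc, hy⟩,
        Finset.sum_le_sum_of_subset_of_nonneg ?_ fun z _ _ => hw z⟩
      have := hin c hc y hy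
      refine bx_subset ?_ ?_ <;>
      · rw [← le_sub_iff_add_le, abs_le]; constructor <;> linarith)
  have h2 : ∑ y ∈ K.biUnion (sqr s), ∑ z ∈ bx y ((k + 1) * rad s), w z ≤
      (2 * ((k + 1) * rad s : ℤ) + 1) ^ 2 * ∑ z ∈ S, w z := by
    refine sum_sum_bx_le hw (by positivity) fun y hy => ?_
    obtain ⟨c, hc, hy⟩ := Finset.mem_biUnion.1 hy
    refine subset_trans ?_ (hS c hc)
    have := hin c hc y hy
    refine bx_subset ?_ ?_ <;>
    · rw [← le_sub_iff_add_le, abs_le]; constructor <;> linarith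
  have h3 : (2 * (((k + 1) * rad s : ℤ) : ℝ) + 1) ^ 2 ≤ ((2 * k + 3) * rad s) ^ 2 := by
    have : (0 : ℝ) ≤ k := by exact_mod_cast hk
    have := one_le_rad s
    push_cast
    gcongr
    nlinarith
  have h4 : (rad s : ℝ) ^ 2 * ∑ c ∈ K, ∑ z ∈ bx c (k * rad s), w z ≤
      (rad s : ℝ) ^ 2 * ((2 * k + 3) ^ 2 * ∑ z ∈ S, w z) := by
    refine h1.trans (h2.trans ((mul_le_mul_of_nonneg_right h3 h0).trans (le_of_eq ?_)))
    ring
  exact le_of_mul_le_mul_left h4 (by positivity)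

/-- The slope of the fit attached to the dyadic square of scale `j` containing `x`. -/
def fslope (f g t : ℤ × ℤ → ℝ) (Br : Finset (ℤ × ℤ)) (j : ℕ) (x : ℤ × ℤ) : ℝ :=
  (fitp f g t Br j (cor j x)).1

theorem sum_local_sq_le {f g t : ℤ × ℤ → ℝ} {Br : Finset (ℤ × ℤ)} (hC : Compat f g t Br)
    {θ : ℕ → ℝ} (hθ : ∀ s, θ s ≤ 1 / 2 ^ 20) {j : ℕ} {x0 : ℤ × ℤ}
    {X : Finset (ℤ × ℤ)} (hX : ∀ x ∈ X, rho Br θ j x = 0 ∧ dst x x0 < rad j) :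
    ∑ x ∈ X, (f (x + (0, 1)) - f x + (fitp f g t Br j x0).1) ^ 2 ≤
      10 ^ 46 * ∑ z ∈ bx x0 (200 * rad j), t z ^ 2 := by
  set Y := ∑ z ∈ bx x0 (200 * rad j), t z ^ 2 with hYd
  have hY : 0 ≤ Y := Finset.sum_nonneg fun _ _ => sq_nonneg _
  rcases X.eq_empty_or_nonempty with rfl | ⟨y, hy⟩
  · simp; positivity
  have hr := rad_pos j
  have h0 : ∀ x, dst x x0 ≤ 7 * rad j → 2 * (rho Br θ j x : ℤ) ≤ 2 ^ 24 * rad j := fun x hx => by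
    have h1 := rho_lip (Br := Br) (θ := θ) (j := j) x y
    have h2 := dst_triangle x x0 y
    rw [dst_comm x0 y] at h2
    have := hX y hy
    omega
  have s1 := sum_fld_sq_le hC hθ h0 (X := X) (fun x hx => by have := hX x hx; omega)
  set v := fld (fitp f g t Br) (rho Br θ j) j with hv
  set a := (fitp f g t Br j x0).1 with ha
  have hle : ∀ x ∈ X, ∀ b : ℤ × ℤ, b = (0, 0) ∨ b = (0, 1) →
      |f (x + b) - rfst (v (x + b)) (x + b)| ≤ 10 ^ 11 * tau t 0 (x + b) := by
    intro x hx b hb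
    refine abs_sub_rfst_fld_le hC hθ ?_
    have h1 := rho_lip (Br := Br) (θ := θ) (j := j) (x + b) x
    have h2 : dst (x + b) x ≤ 1 := by
      rw [dst_le]; rcases hb with rfl | rfl <;> simp
    have := hX x hx
    omega
  have hsub : ∀ b : ℤ × ℤ, b = (0, 0) ∨ b = (0, 1) → ∀ x ∈ X.map (addRightEmbedding b),
      bx x (100 * rad 0) ⊆ bx x0 (200 * rad j) := by
    intro b hb x hx
    rw [Finset.mem_map] at hx
    obtain ⟨z, hz, rfl⟩ := hx
    have h1 := (hX z hz).2
    have h2 : dst z x0 ≤ rad j := h1.le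
    rw [dst_le] at h2
    have := rad_mono (Nat.zero_le j)
    have hr0 := rad_pos 0
    refine bx_subset ?_ ?_ <;>
    · rw [← le_sub_iff_add_le, abs_le]
      rcases hb with rfl | rfl <;> simp <;> omega
  have s2 := sum_tau_sq_le (t := t) (hsub (0, 0) (by tauto))
  have s3 := sum_tau_sq_le (t := t) (hsub (0, 1) (by tauto))
  rw [Finset.sum_map] at s2 s3
  simp only [addRightEmbedding_apply] at s2 s3
  have pt : ∀ x ∈ X, (f (x + (0, 1)) - f x + a) ^ 2 ≤
      3 * (rfst (v (x + (0, 1))) (x + (0, 1)) - rfst (v x) x + a) ^ 2 +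
      3 * 10 ^ 22 * tau t 0 (x + (0, 0)) ^ 2 + 3 * 10 ^ 22 * tau t 0 (x + (0, 1)) ^ 2 := by
    intro x hx
    have q1 := hle x hx (0, 0) (by tauto)
    have q2 := hle x hx (0, 1) (by tauto)
    have p1 := sq_le_sq' (abs_le.1 q1).1 (abs_le.1 q1).2
    have p2 := sq_le_sq' (abs_le.1 q2).1 (abs_le.1 q2).2
    have e0 : x + (0, 0) = x := by ext <;> simp
    rw [e0] at p1 ⊢
    set A := f (x + (0, 1)) - rfst (v (x + (0, 1))) (x + (0, 1))
    set B := f x - rfst (v x) x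
    set D := rfst (v (x + (0, 1))) (x + (0, 1)) - rfst (v x) x + a
    have e : f (x + (0, 1)) - f x + a = A - B + D := by simp only [A, B, D]; ring
    rw [e]
    nlinarith [sq_nonneg (A + B), sq_nonneg (A - D), sq_nonneg (B + D)]
  calc _ ≤ ∑ x ∈ X, (3 * (rfst (v (x + (0, 1))) (x + (0, 1)) - rfst (v x) x + a) ^ 2 +
      3 * 10 ^ 22 * tau t 0 (x + (0, 0)) ^ 2 + 3 * 10 ^ 22 * tau t 0 (x + (0, 1)) ^ 2) :=
        Finset.sum_le_sum pt
    _ = 3 * ∑ x ∈ X, (rfst (v (x + (0, 1))) (x + (0, 1)) - rfst (v x) x + a) ^ 2 +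
      3 * 10 ^ 22 * ∑ x ∈ X, tau t 0 (x + (0, 0)) ^ 2 +
      3 * 10 ^ 22 * ∑ x ∈ X, tau t 0 (x + (0, 1)) ^ 2 := by
        rw [Finset.sum_add_distrib, Finset.sum_add_distrib, Finset.mul_sum, Finset.mul_sum,
          Finset.mul_sum]
    _ ≤ 3 * (10 ^ 45 * Y) + 3 * 10 ^ 22 * (201 ^ 4 * Y) + 3 * 10 ^ 22 * (201 ^ 4 * Y) := by gcongr
    _ ≤ _ := by nlinarith

/-- The vertical derivative of the first component is close to minus the slope in `L²`, on the
set where all scales up to `j` are good. -/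
theorem sum_slope_sq_le {f g t : ℤ × ℤ → ℝ} {Br : Finset (ℤ × ℤ)} (hC : Compat f g t Br)
    {θ : ℕ → ℝ} (hθ : ∀ s, θ s ≤ 1 / 2 ^ 20) {j : ℕ}
    {X S : Finset (ℤ × ℤ)} (hX : ∀ x ∈ X, rho Br θ j x = 0)
    (hS : ∀ z ∉ S, t z = 0) :
    ∑ x ∈ X, (f (x + (0, 1)) - f x + fslope f g t Br j x) ^ 2 ≤ 10 ^ 52 * ∑ z ∈ S, t z ^ 2 := by
  classical
  have hK : ∀ c ∈ X.image (cor j), cor j c = c := fun c hc => by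
    obtain ⟨x, -, rfl⟩ := Finset.mem_image.1 hc; exact cor_cor j x
  set S' := (X.image (cor j)).biUnion fun c => bx c ((200 + 2) * rad j) with hS'
  have h1 := sum_corner_bx_le hK (w := fun z => t z ^ 2) (fun z => sq_nonneg _) (k := 200)
    (by norm_num) (S := S') (fun c hc => Finset.subset_biUnion_of_mem
      (fun c => bx c ((200 + 2) * rad j)) hc)
  have h2 : ∑ z ∈ S', t z ^ 2 ≤ ∑ z ∈ S, t z ^ 2 := by
    rw [← Finset.sum_filter_of_ne (s := S') (p := fun z => z ∈ S) fun z _ hz => by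
      by_contra hc; exact hz (by rw [hS z hc]; norm_num)]
    exact Finset.sum_le_sum_of_subset_of_nonneg
      (fun z hz => (Finset.mem_filter.1 hz).2) fun _ _ _ => sq_nonneg _
  calc _ = ∑ c ∈ X.image (cor j), ∑ x ∈ X with cor j x = c,
        (f (x + (0, 1)) - f x + fslope f g t Br j x) ^ 2 :=
        (Finset.sum_fiberwise_of_maps_to (fun x hx => Finset.mem_image_of_mem _ hx) _).symm
    _ ≤ ∑ c ∈ X.image (cor j), 10 ^ 46 * ∑ z ∈ bx c (200 * rad j), t z ^ 2 := by
        refine Finset.sum_le_sum fun c hc => ?_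
        have := sum_local_sq_le hC hθ (x0 := c) (X := X.filter fun x => cor j x = c) (j := j)
          fun x hx => by
            obtain ⟨h3, rfl⟩ := Finset.mem_filter.1 hx
            exact ⟨hX x h3, dst_cor_lt j x⟩
        refine le_trans (le_of_eq (Finset.sum_congr rfl fun x hx => ?_)) this
        rw [fslope, (Finset.mem_filter.1 hx).2]
    _ ≤ 10 ^ 46 * ((2 * (200 : ℤ) + 3) ^ 2 * ∑ z ∈ S', t z ^ 2) := by
        rw [← Finset.mul_sum]; gcongr
    _ ≤ 10 ^ 46 * ((2 * (200 : ℤ) + 3) ^ 2 * ∑ z ∈ S, t z ^ 2) := by gcongr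
    _ ≤ _ := by
        have : 0 ≤ ∑ z ∈ S, t z ^ 2 := Finset.sum_nonneg fun _ _ => sq_nonneg _
        push_cast; nlinarith

section Thresholds

/-- The admissible density of broken cells at scale `s`. -/
def thr (J s : ℕ) : ℝ := 1 / 2 ^ 20 / 2 ^ (J - s)

theorem thr_pos (J s : ℕ) : 0 < thr J s := by unfold thr; positivity

theorem thr_le (J s : ℕ) : thr J s ≤ 1 / 2 ^ 20 :=
  div_le_self (by positivity) (one_le_pow₀ (by norm_num))

/-- The slope threshold at scale `s`. -/
def lam (Λ : ℝ) (J s : ℕ) : ℝ := Λ * 2 ^ (8 * (J - s))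

/-- A strained configuration on `[0, N)²`, together with a coarsest scale and a slope. -/
structure Setup (f g t : ℤ × ℤ → ℝ) (Br : Finset (ℤ × ℤ)) (N J : ℕ) (Λ T : ℝ) : Prop where
  compat : Compat f g t Br
  supp : ∀ z, t z ≠ 0 → (0 ≤ z.1 ∧ z.1 < N) ∧ (0 ≤ z.2 ∧ z.2 < N)
  sq : ∀ S : Finset (ℤ × ℤ), ∑ z ∈ S, t z ^ 2 ≤ T ^ 2
  T_nonneg : 0 ≤ T
  N_pos : 1 ≤ N
  N_le : N ≤ Br.card
  rad_le : (Br.card : ℝ) * rad J ≤ N ^ 2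
  Λ_pos : 0 < Λ
  one_le : 1 ≤ Λ * rad J
  T_le : T ≤ Λ * N

theorem rad_eq_div {J s : ℕ} (h : s ≤ J) : (rad s : ℝ) = rad J / 1024 ^ (J - s) := by
  obtain ⟨m, rfl⟩ := Nat.exists_eq_add_of_le h
  unfold rad
  push_cast
  rw [Nat.add_sub_cancel_left, eq_div_iff (by positivity), ← pow_add]
  congr 1; omega

theorem card_near_bad_mul_le {Br Z : Finset (ℤ × ℤ)} {θ : ℕ → ℝ} {s : ℕ} {k : ℤ} (hk : 0 ≤ k)
    (hZ : ∀ z ∈ Z, ∃ w, ¬ Good Br θ s w ∧ dst z w ≤ k * rad s) :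
    (Z.card : ℝ) * (θ s * rad s) ≤ Br.card * ((2 * k + 129) * rad s) ^ 2 := by
  classical
  have hr := rad_pos s
  set n := (64 + k) * rad s
  have hn : 0 ≤ n := by positivity
  have h1 : ∀ z ∈ Z, θ s * rad s ≤ ∑ y ∈ bx z n, if y ∈ Br then (1 : ℝ) else 0 := by
    intro z hz
    obtain ⟨w, hw, hd⟩ := hZ z hz
    rw [Good, not_le] at hw
    rw [← Finset.sum_filter, Finset.sum_const, nsmul_eq_mul, mul_one]
    refine hw.le.trans ?_
    norm_cast
    refine Finset.card_le_card fun y hy => ?_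
    rw [Finset.mem_inter, mem_bx_iff_dst] at hy
    rw [Finset.mem_filter, mem_bx_iff_dst]
    have := dst_triangle z w y
    exact ⟨by simp only [n]; linarith, hy.1⟩
  have h2 := sum_sum_bx_le (w := fun y => if y ∈ Br then (1 : ℝ) else 0) (X := Z)
    (fun y => by split_ifs <;> norm_num) hn (S := Z.biUnion fun z => bx z n)
    (fun z hz => Finset.subset_biUnion_of_mem (fun z => bx z n) hz)
  have h3 : (∑ y ∈ Z.biUnion fun z => bx z n, if y ∈ Br then (1 : ℝ) else 0) ≤ Br.card := by
    rw [← Finset.sum_filter, Finset.sum_const, nsmul_eq_mul, mul_one]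
    norm_cast
    exact Finset.card_le_card fun y hy => (Finset.mem_filter.1 hy).2
  have h4 : (2 * (n : ℝ) + 1) ^ 2 ≤ ((2 * k + 129) * rad s) ^ 2 := by
    have := one_le_rad s
    have : (0 : ℝ) ≤ n := by exact_mod_cast hn
    have e : (n : ℝ) = (64 + k) * rad s := by simp only [n]; push_cast; ring
    refine pow_le_pow_left₀ (by positivity) ?_ 2
    rw [e]; nlinarith
  calc _ = ∑ z ∈ Z, θ s * rad s := by rw [Finset.sum_const, nsmul_eq_mul]
    _ ≤ _ := Finset.sum_le_sum h1
    _ ≤ _ := h2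
    _ ≤ ((2 * k + 129) * rad s) ^ 2 * Br.card :=
        mul_le_mul h4 h3 (Finset.sum_nonneg fun y _ => by split_ifs <;> norm_num) (sq_nonneg _)
    _ = _ := mul_comm _ _

variable {f g t : ℤ × ℤ → ℝ} {Br : Finset (ℤ × ℤ)} {N J : ℕ} {Λ T : ℝ}

theorem Setup.card_near_bad (h : Setup f g t Br N J Λ T) {s : ℕ} (hs : s ≤ J) {k : ℤ} (hk : 0 ≤ k)
    {Z : Finset (ℤ × ℤ)} (hZ : ∀ z ∈ Z, ∃ w, ¬ Good Br (thr J) s w ∧ dst z w ≤ k * rad s) :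
    (Z.card : ℝ) ≤ (2 * k + 129) ^ 2 * 2 ^ 20 * N ^ 2 / 512 ^ (J - s) := by
  have h1 := card_near_bad_mul_le hk hZ
  have hr := rad_pos' s
  have h2 := h.rad_le
  have e := rad_eq_div hs
  have hrJ := rad_pos' J
  rw [le_div_iff₀ (by positivity)]
  have h3 : (Z.card : ℝ) * thr J s ≤ (2 * k + 129) ^ 2 * (Br.card * rad s) := by
    have : (Z.card : ℝ) * thr J s * rad s ≤ (2 * k + 129) ^ 2 * (Br.card * rad s) * rad s := by
      linarith
    exact le_of_mul_le_mul_right this hr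
  have h4 : (Br.card : ℝ) * rad s * 1024 ^ (J - s) ≤ N ^ 2 := by
    rw [e, mul_assoc, div_mul_cancel₀ _ (by positivity)]; exact h2
  have e5 : (512 : ℝ) ^ (J - s) * 2 ^ (J - s) = 1024 ^ (J - s) := by
    rw [← mul_pow]; norm_num
  have e6 : thr J s * (2 ^ 20 * 2 ^ (J - s)) = 1 := by
    unfold thr; field_simp
  calc (Z.card : ℝ) * 512 ^ (J - s)
      = (Z.card : ℝ) * thr J s * (2 ^ 20 * (512 ^ (J - s) * 2 ^ (J - s))) := by
        linear_combination (-(Z.card : ℝ) * 512 ^ (J - s)) * e6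
    _ ≤ (2 * k + 129) ^ 2 * (Br.card * rad s) * (2 ^ 20 * (512 ^ (J - s) * 2 ^ (J - s))) := by
        gcongr
    _ = (2 * k + 129) ^ 2 * 2 ^ 20 * (Br.card * rad s * 1024 ^ (J - s)) := by rw [e5]; ring
    _ ≤ _ := by gcongr

theorem sum_inv_pow_le {J j : ℕ} (hj : j ≤ J) :
    ∑ s ∈ Finset.range (j + 1), (1 : ℝ) / 512 ^ (J - s) ≤ 2 / 512 ^ (J - j) := by
  induction j with
  | zero =>
    rw [Finset.sum_range_one]
    gcongr
    norm_num
  | succ j ih =>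
    rw [Finset.sum_range_succ]
    have := ih (by omega)
    have e : J - j = (J - (j + 1)) + 1 := by omega
    rw [e, pow_succ] at this
    have : (2 : ℝ) / (512 ^ (J - (j + 1)) * 512) = (2 / 512) * (1 / 512 ^ (J - (j + 1))) := by
      field_simp
    have : (2 : ℝ) / 512 ^ (J - (j + 1)) = 2 * (1 / 512 ^ (J - (j + 1))) := by
      field_simp
    have : (0 : ℝ) < 1 / 512 ^ (J - (j + 1)) := by positivity
    linarith

theorem Setup.card_rho_pos (h : Setup f g t Br N J Λ T) {j : ℕ} (hj : j ≤ J)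
    {Z : Finset (ℤ × ℤ)} (hZ : ∀ z ∈ Z, rho Br (thr J) j z ≠ 0) :
    (Z.card : ℝ) ≤ 2 ^ 72 * N ^ 2 / 512 ^ (J - j) := by
  classical
  have h1 : Z ⊆ (Finset.range (j + 1)).biUnion fun s =>
      Z.filter fun z => ∃ w, ¬ Good Br (thr J) s w ∧ dst z w ≤ 2 ^ 24 * rad s := by
    intro z hz
    rcases rho_cases (Br := Br) (θ := thr J) (j := j) z with h0 | ⟨s, hs, w, hw, hd⟩
    · exact absurd h0 (hZ z hz)
    · rw [Finset.mem_biUnion]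
      exact ⟨s, by simp; omega, Finset.mem_filter.2 ⟨hz, w, hw, by omega⟩⟩
  have h2 : (Z.card : ℝ) ≤ ∑ s ∈ Finset.range (j + 1), ((Z.filter fun z => ∃ w,
      ¬ Good Br (thr J) s w ∧ dst z w ≤ 2 ^ 24 * rad s).card : ℝ) := by
    exact_mod_cast (Finset.card_le_card h1).trans Finset.card_biUnion_le
  calc _ ≤ _ := h2
    _ ≤ ∑ s ∈ Finset.range (j + 1), 2 ^ 71 * (N : ℝ) ^ 2 * (1 / 512 ^ (J - s)) := by
        refine Finset.sum_le_sum fun s hs => ?_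
        have := h.card_near_bad (s := s) (by rw [Finset.mem_range] at hs; omega) (k := 2 ^ 24)
          (by norm_num) (Z := Z.filter fun z => ∃ w,
            ¬ Good Br (thr J) s w ∧ dst z w ≤ 2 ^ 24 * rad s)
          (fun z hz => (Finset.mem_filter.1 hz).2)
        refine this.trans ?_
        rw [mul_one_div]
        gcongr
        push_cast; norm_num
    _ ≤ 2 ^ 71 * (N : ℝ) ^ 2 * (2 / 512 ^ (J - j)) := by
        rw [← Finset.mul_sum]
        gcongr
        exact sum_inv_pow_le hj
    _ = _ := by ring

/-- Points near which the slopes of scales `j` and `j + 1` disagree. -/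
def Disagree (f g t : ℤ × ℤ → ℝ) (Br : Finset (ℤ × ℤ)) (J : ℕ) (Λ : ℝ) (j : ℕ)
    (x : ℤ × ℤ) : Prop :=
  Good Br (thr J) j (cor j x) ∧ Good Br (thr J) (j + 1) (cor (j + 1) x) ∧
    lam Λ J j / 4 < |fslope f g t Br (j + 1) x - fslope f g t Br j x|

theorem cor_succ (s : ℕ) {x y : ℤ × ℤ} (h : cor s x = cor s y) : cor (s + 1) x = cor (s + 1) y := by
  have hr := rad_pos s
  have h1 := cor_bounds s x
  have h2 := cor_bounds (s + 1) x
  symm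
  apply cor_eq_of_mem
  have e1 := (Prod.ext_iff.1 h).1
  have e2 := (Prod.ext_iff.1 h).2
  simp only [cor] at e1 e2
  have e1 := mul_left_cancel₀ hr.ne' e1
  have e2 := mul_left_cancel₀ hr.ne' e2
  have f1 : y.1 / rad (s + 1) = x.1 / rad (s + 1) := by
    rw [rad_succ, mul_comm, ← Int.ediv_ediv_of_nonneg hr.le, ← Int.ediv_ediv_of_nonneg hr.le, e1]
  have f2 : y.2 / rad (s + 1) = x.2 / rad (s + 1) := by
    rw [rad_succ, mul_comm, ← Int.ediv_ediv_of_nonneg hr.le, ← Int.ediv_ediv_of_nonneg hr.le, e2]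
  have : cor (s + 1) x = cor (s + 1) y := by simp only [cor, f1, f2]
  rw [this]
  exact mem_sqr_cor _ _

theorem Disagree.congr {j : ℕ} {x y : ℤ × ℤ} (h : Disagree f g t Br J Λ j x)
    (hxy : cor j x = cor j y) : Disagree f g t Br J Λ j y := by
  have h2 := cor_succ j hxy
  unfold Disagree fslope at h ⊢
  rwa [← hxy, ← h2]

theorem Setup.card_disagree (h : Setup f g t Br N J Λ T) {j : ℕ} {Z : Finset (ℤ × ℤ)}
    (hZ : ∀ z ∈ Z, Disagree f g t Br J Λ j z) :
    (Z.card : ℝ) ≤ 10 ^ 41 * N ^ 2 / 512 ^ (J - j) := by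
  classical
  have h1 : ∀ z ∈ Z, lam Λ J j ^ 2 ≤ 16 * 10 ^ 30 * tau t (j + 1) z ^ 2 := by
    intro z hz
    obtain ⟨g1, g2, g3⟩ := hZ z hz
    have hr := rad_pos' (j + 1)
    have hd1 := dst_cor_lt j z
    have hd2 := dst_cor_lt (j + 1) z
    have hd3 := dst_triangle (cor j z) z (cor (j + 1) z)
    rw [dst_comm (cor j z) z] at hd3
    have hrr := rad_mono (Nat.le_succ j)
    have := rad_pos j
    have h2 := nrm_fitp_sub h.compat (thr_le J) (Or.inr rfl) g1 g2 (y := z)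
      (by rw [mem_bx_iff_dst]; simp only [Nat.succ_eq_add_one] at hrr; linarith)
      (by rw [mem_bx_iff_dst, dst_comm]; simp only [Nat.succ_eq_add_one] at hrr; linarith)
    have h3 : |(fitp f g t Br j (cor j z) - fitp f g t Br (j + 1) (cor (j + 1) z)).1| *
        rad (j + 1) ≤ nrm z (rad (j + 1)) (fitp f g t Br j (cor j z) -
          fitp f g t Br (j + 1) (cor (j + 1) z)) := by
      unfold nrm
      have := abs_nonneg ((fitp f g t Br j (cor j z) - fitp f g t Br (j + 1) (cor (j + 1) z)).2.1 +
        (fitp f g t Br j (cor j z) - fitp f g t Br (j + 1) (cor (j + 1) z)).1 * z.1)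
      have := abs_nonneg ((fitp f g t Br j (cor j z) - fitp f g t Br (j + 1) (cor (j + 1) z)).2.2 -
        (fitp f g t Br j (cor j z) - fitp f g t Br (j + 1) (cor (j + 1) z)).1 * z.2)
      linarith
    have h4 : |fslope f g t Br (j + 1) z - fslope f g t Br j z| ≤ 10 ^ 15 * tau t (j + 1) z := by
      rw [abs_sub_comm]
      have := h3.trans h2
      refine le_of_mul_le_mul_right ?_ hr
      rw [Prod.fst_sub] at this
      simp only [fslope]
      linarith
    have hl : 0 ≤ lam Λ J j := mul_nonneg h.Λ_pos.le (by positivity)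
    have h5 : lam Λ J j ≤ 4 * 10 ^ 15 * tau t (j + 1) z := by linarith
    calc _ ≤ (4 * 10 ^ 15 * tau t (j + 1) z) ^ 2 := pow_le_pow_left₀ hl h5 2
      _ = _ := by ring
  have h2 : (Z.card : ℝ) * lam Λ J j ^ 2 ≤ 10 ^ 41 * (Λ * N) ^ 2 := by
    calc _ = ∑ z ∈ Z, lam Λ J j ^ 2 := by rw [Finset.sum_const, nsmul_eq_mul]
      _ ≤ ∑ z ∈ Z, 16 * 10 ^ 30 * tau t (j + 1) z ^ 2 := Finset.sum_le_sum h1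
      _ ≤ 16 * 10 ^ 30 * (201 ^ 4 * ∑ z ∈ Z.biUnion fun x => bx x (100 * rad (j + 1)), t z ^ 2) := by
          rw [← Finset.mul_sum]
          gcongr
          exact sum_tau_sq_le fun x hx =>
            Finset.subset_biUnion_of_mem (fun x => bx x (100 * rad (j + 1))) hx
      _ ≤ 16 * 10 ^ 30 * (201 ^ 4 * T ^ 2) := by gcongr; exact h.sq _
      _ ≤ 10 ^ 41 * T ^ 2 := by nlinarith [sq_nonneg T]
      _ ≤ _ := by
          have := h.T_nonneg
          gcongr
          exact h.T_le
  have hΛ := h.Λ_pos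
  have e : lam Λ J j ^ 2 = Λ ^ 2 * 65536 ^ (J - j) := by
    rw [lam, mul_pow, ← pow_mul, mul_comm (8 * (J - j)) 2, ← mul_assoc, pow_mul]; norm_num
  rw [e, mul_pow] at h2
  have h3 : (Z.card : ℝ) * 65536 ^ (J - j) ≤ 10 ^ 41 * N ^ 2 := by
    refine le_of_mul_le_mul_left (a := Λ ^ 2) ?_ (by positivity)
    linarith
  rw [le_div_iff₀ (by positivity)]
  refine le_trans ?_ h3
  gcongr
  norm_num

end Thresholds

/-- The truncation of a real number to `[-1, 1]`. -/
def trunc (a : ℝ) : ℝ := max (-1) (min 1 a)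

theorem abs_trunc_le (a : ℝ) : |trunc a| ≤ 1 := by
  unfold trunc
  rw [abs_le]
  exact ⟨le_max_left _ _, max_le (by norm_num) (min_le_left _ _)⟩

theorem abs_trunc_sub_le (a b : ℝ) : |trunc a - trunc b| ≤ |a - b| := by
  unfold trunc
  refine (abs_max_sub_max_le_max _ _ _ _).trans (max_le (by simp) ?_)
  exact (abs_min_sub_min_le_max _ _ _ _).trans (max_le (by simp) le_rfl)

theorem trunc_of_abs_le {a : ℝ} (h : |a| ≤ 1) : trunc a = a := by
  rw [abs_le] at h
  unfold trunc
  rw [min_eq_right h.2, max_eq_right h.1]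

theorem trunc_mono {a b : ℝ} (h : a ≤ b) : trunc a ≤ trunc b := by
  unfold trunc
  exact max_le_max le_rfl (min_le_min le_rfl h)

theorem trunc_of_ge {a : ℝ} (h : 1 ≤ a) : trunc a = 1 := by
  unfold trunc
  rw [min_eq_left h, max_eq_right (by norm_num)]

theorem trunc_of_le {a : ℝ} (h : a ≤ -1) : trunc a = -1 := by
  unfold trunc
  exact max_eq_left ((min_le_right _ _).trans h)

/-- The value closest to `p` in `[-1, 1]` allowed by the control `q`: it is unconstrained for
`|q| ≤ 1 / 2` and equal to `q` if `|q| = 1`. -/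
def steer (p q : ℝ) : ℝ := max (max (-1) (4 * q - 3)) (min (min 1 (4 * q + 3)) p)

theorem abs_steer_le {q : ℝ} (hq : |q| ≤ 1) (p : ℝ) : |steer p q| ≤ 1 := by
  rw [abs_le] at hq ⊢
  unfold steer
  refine ⟨(le_max_left _ _).trans (le_max_left _ _), max_le (max_le (by norm_num) (by linarith)) ?_⟩
  exact (min_le_left _ _).trans (min_le_left _ _)

theorem abs_steer_sub_le (p q p' q' : ℝ) :
    |steer p q - steer p' q'| ≤ |p - p'| + 4 * |q - q'| := by
  have h0 := abs_nonneg (p - p')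
  have h1 := abs_nonneg (q - q')
  have h2 : |(4 * q - 3) - (4 * q' - 3)| ≤ |p - p'| + 4 * |q - q'| := by
    rw [show (4 * q - 3) - (4 * q' - 3) = 4 * (q - q') by ring, abs_mul]; norm_num
  have h3 : |(4 * q + 3) - (4 * q' + 3)| ≤ |p - p'| + 4 * |q - q'| := by
    rw [show (4 * q + 3) - (4 * q' + 3) = 4 * (q - q') by ring, abs_mul]; norm_num
  unfold steer
  refine (abs_max_sub_max_le_max _ _ _ _).trans (max_le ?_ ?_)
  · exact (abs_max_sub_max_le_max _ _ _ _).trans (max_le (by simp; linarith) h2)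
  · refine (abs_min_sub_min_le_max _ _ _ _).trans (max_le ?_ (by linarith))
    exact (abs_min_sub_min_le_max _ _ _ _).trans (max_le (by simp; linarith) h3)

theorem steer_one (p : ℝ) : steer p 1 = 1 := by
  unfold steer
  rw [max_eq_right (by norm_num : (-1 : ℝ) ≤ 4 * 1 - 3)]
  refine (max_eq_left ?_).trans (by norm_num)
  exact (min_le_left _ _).trans ((min_le_left _ _).trans (by norm_num))

theorem steer_neg_one (p : ℝ) : steer p (-1) = -1 := by
  unfold steer
  rw [min_eq_right (by norm_num : (4 * (-1) + 3 : ℝ) ≤ 1), max_eq_left (by norm_num : (4 * (-1) - 3 : ℝ) ≤ -1)]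
  exact max_eq_left ((min_le_left _ _).trans (by norm_num))

theorem steer_eq_self {p q : ℝ} (h1 : -1 ≤ p) (h2 : p ≤ 1) (h3 : 4 * q - 3 ≤ p)
    (h4 : p ≤ 4 * q + 3) : steer p q = p := by
  unfold steer
  rw [min_eq_right (le_min h2 h4), max_eq_right (max_le h1 h3)]

/-- A control at a coarser scale makes a compatible control at the finer scale redundant. -/
theorem steer_steer_of_close {p a a' l l' : ℝ} (hl : 0 < l) (hl' : 8 * l ≤ l')
    (h : |a - a'| ≤ l' / 4) :
    steer (steer p (trunc (a / l))) (trunc (a' / l')) = steer p (trunc (a / l)) := by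
  have h0 : 0 < l' := by linarith
  have hb := abs_le.1 (abs_steer_le (abs_trunc_le (a / l)) p)
  rw [abs_le] at h
  have hb' := abs_le.1 (abs_trunc_le (a' / l'))
  refine steer_eq_self hb.1 hb.2 ?_ ?_
  · by_cases h1 : trunc (a' / l') ≤ 1 / 2
    · linarith
    · have h2 : 1 / 2 < a' / l' := by
        by_contra h3
        rw [not_lt] at h3
        exact h1 ((trunc_mono h3).trans (le_of_eq (trunc_of_abs_le (by norm_num [abs_of_pos]))))
      rw [lt_div_iff₀ h0] at h2
      rw [trunc_of_ge (by rw [le_div_iff₀ hl]; linarith : 1 ≤ a / l), steer_one]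
      linarith
  · by_cases h1 : -(1 / 2) ≤ trunc (a' / l')
    · linarith
    · have h2 : a' / l' < -(1 / 2) := by
        by_contra h3
        rw [not_lt] at h3
        refine h1 (le_trans (le_of_eq (trunc_of_abs_le ?_).symm) (trunc_mono h3))
        rw [abs_le]; norm_num
      rw [div_lt_iff₀ h0] at h2
      rw [trunc_of_le (by rw [div_le_iff₀ hl]; linarith : a / l ≤ -1), steer_neg_one]
      linarith

/-- Steering by a slope makes the truncated increment monotone up to the deviation. -/
theorem abs_add_steer_mul_le {x y a l : ℝ} (hl : 0 < l) (p : ℝ) :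
    |trunc y - trunc x| + steer p (trunc (a / l)) * (trunc y - trunc x) ≤
      2 * |y - x + a| + 2 * l := by
  set D := trunc y - trunc x with hD
  have hs := abs_le.1 (abs_steer_le (abs_trunc_le (a / l)) p)
  have hD1 : |D| ≤ |y - x| := abs_trunc_sub_le y x
  have hpos : x ≤ y → 0 ≤ D := fun h => by have := trunc_mono h; linarith
  have hneg : y ≤ x → D ≤ 0 := fun h => by have := trunc_mono h; linarith
  rcases lt_or_ge |a| l with h | h
  · have h1 : steer p (trunc (a / l)) * D ≤ |D| := by
      refine (le_abs_self _).trans ?_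
      rw [abs_mul]
      exact mul_le_of_le_one_left (abs_nonneg _) (abs_le.2 hs)
    have h2 : |y - x| ≤ |y - x + a| + |a| := by
      have := abs_sub (y - x + a) a
      rwa [add_sub_cancel_right] at this
    linarith
  · rcases le_total 0 a with ha | ha
    · rw [abs_of_nonneg ha] at h
      rw [trunc_of_ge (by rw [le_div_iff₀ hl]; linarith : 1 ≤ a / l), steer_one]
      rcases le_total x y with hxy | hxy
      · have := hpos hxy
        rw [abs_of_nonneg this] at hD1 ⊢
        rw [abs_of_nonneg (by linarith)] at hD1
        have := le_abs_self (y - x + a)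
        linarith
      · have := hneg hxy
        rw [abs_of_nonpos this]
        have := abs_nonneg (y - x + a)
        linarith
    · rw [abs_of_nonpos ha] at h
      rw [trunc_of_le (by rw [div_le_iff₀ hl]; linarith : a / l ≤ -1), steer_neg_one]
      rcases le_total x y with hxy | hxy
      · have := hpos hxy
        rw [abs_of_nonneg this]
        have := abs_nonneg (y - x + a)
        linarith
      · have := hneg hxy
        rw [abs_of_nonpos this] at hD1 ⊢
        rw [abs_of_nonpos (by linarith)] at hD1
        have := neg_abs_le (y - x + a)
        linarith

/-- Iterated steering. -/
def steers (q : ℕ → ℝ) : ℕ → ℝ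
  | 0 => steer 0 (q 0)
  | m + 1 => steer (steers q m) (q (m + 1))

theorem steers_eq (q : ℕ → ℝ) (m : ℕ) : ∃ p, steers q m = steer p (q m) := by
  cases m with
  | zero => exact ⟨_, rfl⟩
  | succ m => exact ⟨_, rfl⟩

theorem abs_steers_le {q : ℕ → ℝ} (hq : ∀ m, |q m| ≤ 1) (m : ℕ) : |steers q m| ≤ 1 := by
  obtain ⟨p, hp⟩ := steers_eq q m
  rw [hp]; exact abs_steer_le (hq m) p

theorem abs_steers_sub_le {q q' : ℕ → ℝ} {E : ℕ → Prop} [DecidablePred E] (h0 : E 0)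
    (hE : ∀ m, ¬ E (m + 1) → steers q (m + 1) = steers q m ∧ steers q' (m + 1) = steers q' m)
    (n : ℕ) : |steers q n - steers q' n| ≤
      ∑ m ∈ Finset.range (n + 1), if E m then 4 * |q m - q' m| else 0 := by
  induction n with
  | zero =>
    simp only [Finset.sum_range_one, h0, if_true, zero_add]
    have := abs_steer_sub_le 0 (q 0) 0 (q' 0)
    simpa [steers] using this
  | succ n ih =>
    rw [Finset.sum_range_succ]
    by_cases h : E (n + 1)
    · rw [if_pos h]
      have := abs_steer_sub_le (steers q n) (q (n + 1)) (steers q' n) (q' (n + 1))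
      simp only [steers]
      linarith
    · rw [if_neg h, (hE n h).1, (hE n h).2]
      linarith

/-- Extension of a function from a set of good rows along the whole column: an unbroken jump only
occurs when a good row is reached from the previous good row without meeting a broken one. -/
theorem exists_column_extension (good brk : ℤ → Prop) (a : ℤ → ℝ) (ha : ∀ y, |a y| ≤ 1)
    (hd : ∀ y, ∃ w ≤ y, good w) (hu : ∀ y, ∃ w, y ≤ w ∧ good w) :
    ∃ ψ : ℤ → ℝ, (∀ y, |ψ y| ≤ 1) ∧ (∀ y, good y → ψ y = a y) ∧
      ∀ y, ¬ brk y → ψ (y + 1) ≠ ψ y → good (y + 1) ∧ ∃ w ≤ y, good w ∧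
        (∀ v, w < v → v ≤ y → ¬ good v) ∧ (∀ v, w ≤ v → v ≤ y → ¬ brk v) ∧
        ψ (y + 1) - ψ y = a (y + 1) - a w := by
  classical
  have h1 : ∀ y, ∃ w, (w ≤ y ∧ good w) ∧ ∀ z, (z ≤ y ∧ good z) → z ≤ w := fun y => by
    obtain ⟨w, hw, hm⟩ := Int.exists_greatest_of_bdd (P := fun z => z ≤ y ∧ good z)
      ⟨y, fun z hz => hz.1⟩ (hd y)
    exact ⟨w, hw, hm⟩
  have h2 : ∀ y, ∃ w, (y ≤ w ∧ good w) ∧ ∀ z, (y ≤ z ∧ good z) → w ≤ z := fun y => by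
    obtain ⟨w, hw, hm⟩ := Int.exists_least_of_bdd (P := fun z => y ≤ z ∧ good z)
      ⟨y, fun z hz => hz.1⟩ (hu y)
    exact ⟨w, hw, hm⟩
  choose dn hdn hdnm using h1
  choose up hup hupm using h2
  have dself : ∀ y, good y → dn y = y := fun y hy =>
    le_antisymm (hdn y).1 (hdnm y y ⟨le_rfl, hy⟩)
  have uself : ∀ y, good y → up y = y := fun y hy =>
    le_antisymm (hupm y y ⟨le_rfl, hy⟩) (hup y).1
  have dstep : ∀ y, ¬ good (y + 1) → dn (y + 1) = dn y := fun y hy => by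
    have e : dn (y + 1) ≤ y := by
      have := (hdn (y + 1)).1
      have : dn (y + 1) ≠ y + 1 := fun h => hy (h ▸ (hdn (y + 1)).2)
      omega
    refine le_antisymm (hdnm y _ ⟨e, (hdn (y + 1)).2⟩) (hdnm (y + 1) _ ⟨?_, (hdn y).2⟩)
    have := (hdn y).1; omega
  have ustep : ∀ y, ¬ good y → up (y + 1) = up y := fun y hy => by
    have e : y + 1 ≤ up y := by
      have := (hup y).1
      have : up y ≠ y := fun h => hy (h ▸ (hup y).2)
      omega
    refine le_antisymm (hupm (y + 1) _ ⟨e, (hup y).2⟩) (hupm y _ ⟨?_, (hup (y + 1)).2⟩)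
    have := (hup (y + 1)).1; omega
  set ψ : ℤ → ℝ := fun y => if ∃ v, dn y ≤ v ∧ v < y ∧ brk v then a (up y) else a (dn y) with hψ
  have hgood : ∀ y, good y → ψ y = a y := fun y hy => by
    simp only [hψ, dself y hy, uself y hy, ite_self]
  refine ⟨ψ, fun y => ?_, hgood, fun y hb hj => ?_⟩
  · simp only [hψ]; split_ifs <;> exact ha _
  have hg : good (y + 1) := by
    by_contra hg
    apply hj
    by_cases hy : good y
    · rw [hgood y hy]
      simp only [hψ, dstep y hg, dself y hy]
      rw [if_neg]
      rintro ⟨v, h3, h4, h5⟩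
      have : v = y := by omega
      exact hb (this ▸ h5)
    · simp only [hψ, dstep y hg, ustep y hy]
      refine if_congr ⟨?_, ?_⟩ rfl rfl
      · rintro ⟨v, h3, h4, h5⟩
        have : v ≠ y := fun h => hb (h ▸ h5)
        exact ⟨v, h3, by omega, h5⟩
      · rintro ⟨v, h3, h4, h5⟩
        exact ⟨v, h3, by omega, h5⟩
  refine ⟨hg, dn y, (hdn y).1, (hdn y).2, fun v hv hvy hgv => ?_, ?_⟩
  · have := hdnm y v ⟨hvy, hgv⟩; omega
  rw [hgood _ hg] at hj ⊢
  by_cases hx : ∃ v, dn y ≤ v ∧ v < y ∧ brk v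
  · exfalso
    have hy : ¬ good y := fun hy => by
      obtain ⟨v, h3, h4, h5⟩ := hx
      rw [dself y hy] at h3; omega
    apply hj
    simp only [hψ, if_pos hx]
    rw [← ustep y hy, uself _ hg]
  · refine ⟨fun v h3 h4 h5 => ?_, by simp only [hψ, if_neg hx]⟩
    rcases eq_or_lt_of_le h4 with rfl | h4
    · exact hb h5
    · exact hx ⟨v, h3, h4, h5⟩

/-- Summation by parts for the variation of a truncated function. -/
theorem sum_abs_sub_le_of_steer {N : ℕ} {h φ : ℤ → ℝ} (hh : ∀ y, |h y| ≤ 1) (hφ : ∀ y, |φ y| ≤ 1) :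
    ∑ y ∈ Finset.Ico (0 : ℤ) N, |h (y + 1) - h y| ≤
      2 + ∑ y ∈ Finset.Ico (0 : ℤ) N, |φ (y + 1) - φ y| +
      ∑ y ∈ Finset.Ico (0 : ℤ) N, (|h (y + 1) - h y| + φ y * (h (y + 1) - h y)) := by
  have h1 := sum_Ico_shift (N : ℤ) (by positivity) (fun y => φ y * h y)
  have hb : ∀ y, |φ y * h y| ≤ 1 := fun y => by
    rw [abs_mul]; exact mul_le_one₀ (hφ y) (abs_nonneg _) (hh y)
  have h2 : ∀ y, -(φ y * (h (y + 1) - h y)) ≤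
      |φ (y + 1) - φ y| - (φ (y + 1) * h (y + 1) - φ y * h y) := fun y => by
    have h3 : (φ (y + 1) - φ y) * h (y + 1) ≤ |φ (y + 1) - φ y| := by
      refine (le_abs_self _).trans ?_
      rw [abs_mul]
      exact mul_le_of_le_one_right (abs_nonneg _) (hh _)
    linarith
  have h4 := Finset.sum_le_sum (s := Finset.Ico (0 : ℤ) N) fun y _ => h2 y
  rw [Finset.sum_sub_distrib] at h1
  rw [Finset.sum_sub_distrib, Finset.sum_sub_distrib, Finset.sum_neg_distrib] at h4
  rw [Finset.sum_add_distrib]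
  have h5 := abs_le.1 (hb N)
  have h6 := abs_le.1 (hb 0)
  linarith

/-- An affine function on `ℤ` that is small on many integers has a small slope. -/
theorem affine_slope_le {F : Finset ℤ} {α D : ℝ} {e : ℤ → ℝ} (hF : 4 ≤ F.card)
    (h : ∀ i ∈ F, |α + D * i| ≤ e i) : |D| * (F.card : ℝ) ^ 2 ≤ 16 * ∑ i ∈ F, e i := by
  classical
  set m := F.card with hm
  set s := ∑ i ∈ F, e i with hs
  have hmR : (4 : ℝ) ≤ m := by exact_mod_cast hF
  have he : ∀ i ∈ F, 0 ≤ e i := fun i hi => (abs_nonneg _).trans (h i hi)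
  have hs0 : 0 ≤ s := Finset.sum_nonneg he
  set G := F.filter fun i => m * e i ≤ 4 * s with hG
  have hFG : ((F.filter fun i => ¬ m * e i ≤ 4 * s).card : ℝ) * 4 ≤ m := by
    rcases hs0.eq_or_lt with h0 | h0
    · have : F.filter (fun i => ¬ m * e i ≤ 4 * s) = ∅ := by
        refine Finset.filter_eq_empty_iff.2 fun i hi => ?_
        have := Finset.single_le_sum he hi
        have : e i ≤ 0 := by rw [h0]; exact this
        rw [not_not, ← h0]
        nlinarith
      rw [this]; simp
    · have h1 : ∑ i ∈ F.filter (fun i => ¬ m * e i ≤ 4 * s), 4 * s ≤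
          ∑ i ∈ F.filter (fun i => ¬ m * e i ≤ 4 * s), m * e i :=
        Finset.sum_le_sum fun i hi => (not_le.1 (Finset.mem_filter.1 hi).2).le
      have h2 : ∑ i ∈ F.filter (fun i => ¬ m * e i ≤ 4 * s), (m : ℝ) * e i ≤ m * s := by
        rw [← Finset.mul_sum]
        gcongr
        exact Finset.sum_le_sum_of_subset_of_nonneg (Finset.filter_subset _ _)
          fun i hi _ => he i hi
      rw [Finset.sum_const, nsmul_eq_mul] at h1
      refine le_of_mul_le_mul_right ?_ h0
      linarith
  have hcard : (G.card : ℝ) + (F.filter fun i => ¬ m * e i ≤ 4 * s).card = m := by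
    exact_mod_cast Finset.card_filter_add_card_filter_not (s := F) fun i => m * e i ≤ 4 * s
  have hGm : 3 / 4 * (m : ℝ) ≤ G.card := by linarith
  have hne : G.Nonempty := by
    rw [← Finset.card_pos]
    have : (0 : ℝ) < G.card := by linarith
    exact_mod_cast this
  have h1 := Finset.mem_filter.1 (G.min'_mem hne)
  have h2 := Finset.mem_filter.1 (G.max'_mem hne)
  set i := G.min' hne
  set k := G.max' hne
  have hsub : G ⊆ Finset.Icc i k := fun x hx =>
    Finset.mem_Icc.2 ⟨G.min'_le x hx, G.le_max' x hx⟩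
  have hc := Finset.card_le_card hsub
  rw [Int.card_Icc] at hc
  have hik : i ≤ k := G.min'_le_max' hne
  have hc' : (G.card : ℤ) ≤ k + 1 - i := by omega
  have hc2 : (G.card : ℝ) ≤ k + 1 - i := by exact_mod_cast hc'
  have h3 : |D| * (k - i) ≤ e i + e k := by
    have : (0 : ℝ) ≤ k - i := by linarith
    rw [← abs_of_nonneg this, ← abs_mul]
    have e1 : D * (k - i) = (α + D * k) - (α + D * i) := by ring
    rw [e1]
    have := abs_sub (α + D * k) (α + D * i)
    linarith [h i h1.1, h k h2.1]
  have h4 : m * (|D| * (m / 2)) ≤ m * (e i + e k) := by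
    gcongr
    refine le_trans ?_ h3
    gcongr
    linarith
  nlinarith [h1.2, h2.2]

/-- The cells between the top row of the square at `q` and the bottom of the square at `c`. -/
def gap (j : ℕ) (c q : ℤ × ℤ) : Finset (ℤ × ℤ) :=
  Finset.Ico c.1 (c.1 + rad j) ×ˢ Finset.Ico (q.2 + rad j - 1) c.2

theorem mem_gap {j : ℕ} {c q z : ℤ × ℤ} : z ∈ gap j c q ↔
    (c.1 ≤ z.1 ∧ z.1 < c.1 + rad j) ∧ (q.2 + rad j - 1 ≤ z.2 ∧ z.2 < c.2) := by
  simp [gap]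

/-- The total strain entering the comparison of the squares at `c` and `q`. -/
def gapSum (t : ℤ × ℤ → ℝ) (j : ℕ) (c q : ℤ × ℤ) : ℝ :=
  ∑ z ∈ bx c (64 * rad j), t z + ∑ z ∈ bx q (64 * rad j), t z + ∑ z ∈ gap j c q, t z

theorem sum_lineSum_le {D : Finset (ℤ × ℤ)} {t : ℤ × ℤ → ℝ} (ht : ∀ z, 0 ≤ t z)
    (l : ℤ × ℤ → ℤ) (F : Finset ℤ) : ∑ i ∈ F, lineSum D t l i ≤ ∑ z ∈ D, t z := by
  unfold lineSum
  exact Finset.sum_fiberwise_le_sum_of_sum_fiber_nonneg fun i _ =>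
    Finset.sum_nonneg fun z _ => ht z

theorem fslope_sub_mul_le {f g t : ℤ × ℤ → ℝ} {Br : Finset (ℤ × ℤ)} (hC : Compat f g t Br)
    {θ : ℕ → ℝ} (hθ : ∀ s, θ s ≤ 1 / 2 ^ 20) {j : ℕ} {c q : ℤ × ℤ} (hc : Good Br θ j c)
    (hq : Good Br θ j q) (h1 : q.1 = c.1) (h2 : q.2 + rad j ≤ c.2) {F : Finset ℤ}
    (hF : 4 ≤ F.card) (hr : ∀ i ∈ F, c.1 ≤ i ∧ i < c.1 + rad j)
    (fc : ∀ i ∈ F, LineFree (bx c (64 * rad j)) Br Prod.fst i)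
    (fq : ∀ i ∈ F, LineFree (bx q (64 * rad j)) Br Prod.fst i)
    (fg : ∀ i ∈ F, LineFree (gap j c q) Br Prod.fst i) :
    |(fitp f g t Br j c).1 - (fitp f g t Br j q).1| * (F.card : ℝ) ^ 2 ≤ 10 ^ 6 * gapSum t j c q := by
  have hr0 := rad_pos j
  have hr1 := rad_pos' j
  set P := fitp f g t Br j c
  set P' := fitp f g t Br j q
  set s1 := ∑ z ∈ bx c (64 * rad j), t z with hs1
  set s2 := ∑ z ∈ bx q (64 * rad j), t z with hs2
  have hs1' : 0 ≤ s1 := Finset.sum_nonneg fun z _ => hC.nonneg z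
  have hs2' : 0 ≤ s2 := Finset.sum_nonneg fun z _ => hC.nonneg z
  have hs3' : 0 ≤ ∑ z ∈ gap j c q, t z := Finset.sum_nonneg fun z _ => hC.nonneg z
  set e : ℤ → ℝ := fun i => 30000 * (lineSum (bx c (64 * rad j)) t Prod.fst i + s1 / rad j) +
    30000 * (lineSum (bx q (64 * rad j)) t Prod.fst i + s2 / rad j) +
    lineSum (gap j c q) t Prod.fst i with he
  have key : ∀ i ∈ F, |(P.2.1 - P'.2.1) + (P.1 - P'.1) * i| ≤ e i := by
    intro i hi
    obtain ⟨hi1, hi2⟩ := hr i hi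
    have a1 := (hc.isFit hC hθ).col i (by rw [abs_of_nonneg (by omega)]; omega) (fc i hi) c.2
      (by omega) (by omega)
    have a2 := (hq.isFit hC hθ).col i (by rw [abs_of_nonneg (by omega)]; omega) (fq i hi)
      (q.2 + rad j - 1) (by omega) (by omega)
    have a3 := abs_sub_le_lineSum (D := gap j c q) (Br := Br) (t := t) (h := g) (l := Prod.fst)
      (v := (0, 1)) (by simp) hC.nonneg hC.vert (by simp) (fg i hi) (i, q.2 + rad j - 1) rfl
      (c.2 - (q.2 + rad j - 1)).toNat (fun m hm => by
        rw [mem_gap]; simp; omega)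
    have e1 : ((i, q.2 + rad j - 1) : ℤ × ℤ) + (c.2 - (q.2 + rad j - 1)).toNat • ((0, 1) : ℤ × ℤ) =
        (i, c.2) := by
      ext <;> simp
      omega
    rw [e1] at a3
    have b1 : s1 / ((64 * rad j : ℤ) : ℝ) ≤ s1 / rad j := by
      push_cast; gcongr; linarith
    have b2 : s2 / ((64 * rad j : ℤ) : ℝ) ≤ s2 / rad j := by
      push_cast; gcongr; linarith
    simp only [he]
    rw [abs_le] at a1 a2 a3 ⊢
    constructor <;> linarith [a1.1, a1.2, a2.1, a2.2, a3.1, a3.2]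
  have h3 := affine_slope_le hF key
  have hcard : (F.card : ℝ) ≤ rad j := by
    have : F ⊆ Finset.Ico c.1 (c.1 + rad j) := fun i hi => Finset.mem_Ico.2 (hr i hi)
    have := Finset.card_le_card this
    rw [Int.card_Ico] at this
    have : (F.card : ℤ) ≤ rad j := by omega
    exact_mod_cast this
  have h4 : ∀ s : ℝ, 0 ≤ s → (F.card : ℝ) * (s / rad j) ≤ s := fun s hs => by
    rw [mul_div_assoc', div_le_iff₀ hr1, mul_comm]
    gcongr
  have h5 : ∑ i ∈ F, e i ≤ 30000 * (s1 + s1) + 30000 * (s2 + s2) + ∑ z ∈ gap j c q, t z := by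
    simp only [he, Finset.sum_add_distrib, ← Finset.mul_sum, Finset.sum_const, nsmul_eq_mul]
    gcongr
    · exact sum_lineSum_le hC.nonneg _ _
    · exact h4 _ hs1'
    · exact sum_lineSum_le hC.nonneg _ _
    · exact h4 _ hs2'
    · exact sum_lineSum_le hC.nonneg _ _
  unfold gapSum
  linarith

theorem card_not_lineFree_le {Br D : Finset (ℤ × ℤ)} (F : Finset ℤ) [DecidablePred fun i => ¬ LineFree D Br Prod.fst i] :
    (F.filter fun i => ¬ LineFree D Br Prod.fst i).card ≤ (Br ∩ D).card := by
  classical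
  refine (Finset.card_le_card (t := (Br ∩ D).image Prod.fst) fun i hi => ?_).trans
    Finset.card_image_le
  have := (Finset.mem_filter.1 hi).2
  unfold LineFree at this
  push Not at this
  obtain ⟨z, hz, rfl, hb⟩ := this
  exact Finset.mem_image_of_mem _ (Finset.mem_inter.2 ⟨hb, hz⟩)

/-- The columns of the strip over `c` without broken cells in the gap. -/
def freeCols (Br : Finset (ℤ × ℤ)) (j : ℕ) (c q : ℤ × ℤ) : Finset ℤ := by
  classical
  exact (Finset.Ico c.1 (c.1 + rad j)).filter fun i => LineFree (gap j c q) Br Prod.fst i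

theorem card_freeCols_mul_le {f g t : ℤ × ℤ → ℝ} {Br : Finset (ℤ × ℤ)} (hC : Compat f g t Br)
    {θ : ℕ → ℝ} (hθ : ∀ s, θ s ≤ 1 / 2 ^ 20) {j : ℕ} (h0 : 0 < θ j) {c q : ℤ × ℤ}
    (hc : Good Br θ j c)
    (hq : Good Br θ j q) (h1 : q.1 = c.1) (h2 : q.2 + rad j ≤ c.2) {l : ℝ} (hl : 0 < l) :
    ((freeCols Br j c q).card : ℝ) * |trunc ((fitp f g t Br j c).1 / l) -
      trunc ((fitp f g t Br j q).1 / l)| ≤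
      (64 * θ j + 64 / rad j) * (Br ∩ gap j c q).card +
        10 ^ 6 * gapSum t j c q / (θ j * rad j * l) := by
  classical
  have hr := rad_pos' j
  have hr3 : (1024 : ℝ) ≤ rad j := by
    have := rad_mono (Nat.zero_le j)
    have : (rad 0 : ℤ) = 1024 := by simp [rad]
    have : (1024 : ℤ) ≤ rad j := by omega
    exact_mod_cast this
  set K := freeCols Br j c q with hK
  set P := fitp f g t Br j c
  set P' := fitp f g t Br j q
  have hS : 0 ≤ gapSum t j c q :=
    add_nonneg (add_nonneg (Finset.sum_nonneg fun z _ => hC.nonneg z)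
      (Finset.sum_nonneg fun z _ => hC.nonneg z)) (Finset.sum_nonneg fun z _ => hC.nonneg z)
  have hKm : ∀ i, i ∈ K ↔ (c.1 ≤ i ∧ i < c.1 + rad j) ∧ LineFree (gap j c q) Br Prod.fst i := by
    intro i; simp [hK, freeCols]
  by_cases hcase : (K.card : ℝ) < 16 * (θ j * rad j) + 16
  · have hd : |trunc (P.1 / l) - trunc (P'.1 / l)| ≤ 2 := by
      have := abs_sub (trunc (P.1 / l)) (trunc (P'.1 / l))
      linarith [abs_trunc_le (P.1 / l), abs_trunc_le (P'.1 / l)]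
    have hsplit : (K.card : ℝ) + ((Finset.Ico c.1 (c.1 + rad j)).filter fun i =>
        ¬ LineFree (gap j c q) Br Prod.fst i).card = rad j := by
      have h := Finset.card_filter_add_card_filter_not (s := Finset.Ico c.1 (c.1 + rad j))
        fun i => LineFree (gap j c q) Br Prod.fst i
      rw [Int.card_Ico] at h
      have e : ((c.1 + rad j - c.1).toNat : ℤ) = rad j := by have := rad_pos j; omega
      have e2 : K = (Finset.Ico c.1 (c.1 + rad j)).filter
        fun i => LineFree (gap j c q) Br Prod.fst i := by ext i; simp [hKm]
      rw [e2]
      have h' : ((((Finset.Ico c.1 (c.1 + rad j)).filter fun i =>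
        LineFree (gap j c q) Br Prod.fst i).card + ((Finset.Ico c.1 (c.1 + rad j)).filter fun i =>
        ¬ LineFree (gap j c q) Br Prod.fst i).card : ℕ) : ℤ) = rad j := by rw [h, e]
      exact_mod_cast h'
    have hb : (((Finset.Ico c.1 (c.1 + rad j)).filter fun i =>
        ¬ LineFree (gap j c q) Br Prod.fst i).card : ℝ) ≤ (Br ∩ gap j c q).card := by
      exact_mod_cast card_not_lineFree_le _
    have hθj := hθ j
    have h5 : (rad j : ℝ) / 2 ≤ (Br ∩ gap j c q).card := by nlinarith
    have h6 : 0 ≤ 10 ^ 6 * gapSum t j c q / (θ j * rad j * l) := by positivity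
    have h7 : (64 * θ j + 64 / rad j) * ((rad j : ℝ) / 2) = 32 * (θ j * rad j) + 32 := by
      field_simp; ring
    have h8 : (64 * θ j + 64 / rad j) * ((rad j : ℝ) / 2) ≤
      (64 * θ j + 64 / rad j) * (Br ∩ gap j c q).card := by gcongr
    have h9 : (K.card : ℝ) * |trunc (P.1 / l) - trunc (P'.1 / l)| ≤ K.card * 2 := by gcongr
    linarith
  · rw [not_lt] at hcase
    set F := K.filter fun i => LineFree (bx c (64 * rad j)) Br Prod.fst i ∧
      LineFree (bx q (64 * rad j)) Br Prod.fst i with hF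
    have hFc : (K.card : ℝ) ≤ F.card + 2 * (θ j * rad j) := by
      have a : K ⊆ F ∪ ((K.filter fun i => ¬ LineFree (bx c (64 * rad j)) Br Prod.fst i) ∪
          (K.filter fun i => ¬ LineFree (bx q (64 * rad j)) Br Prod.fst i)) := by
        intro i hi
        simp only [hF, Finset.mem_union, Finset.mem_filter]
        tauto
      have b := (Finset.card_le_card a).trans ((Finset.card_union_le _ _).trans
        (Nat.add_le_add_left (Finset.card_union_le _ _) _))
      have b1 := card_not_lineFree_le (Br := Br) (D := bx c (64 * rad j)) K
      have b2 := card_not_lineFree_le (Br := Br) (D := bx q (64 * rad j)) K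
      have b3 : (K.card : ℝ) ≤ F.card + ((Br ∩ bx c (64 * rad j)).card +
        (Br ∩ bx q (64 * rad j)).card) := by exact_mod_cast (by omega)
      unfold Good at hc hq
      linarith
    have hθr : 0 < θ j * rad j := by positivity
    have hF4 : (4 : ℝ) ≤ F.card := by linarith
    have hmain := fslope_sub_mul_le hC hθ hc hq h1 h2 (F := F) (by exact_mod_cast hF4)
      (fun i hi => ((hKm i).1 (Finset.mem_filter.1 hi).1).1)
      (fun i hi => (Finset.mem_filter.1 hi).2.1) (fun i hi => (Finset.mem_filter.1 hi).2.2)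
      (fun i hi => ((hKm i).1 (Finset.mem_filter.1 hi).1).2)
    have hd : |trunc (P.1 / l) - trunc (P'.1 / l)| ≤ |P.1 - P'.1| / l := by
      refine (abs_trunc_sub_le _ _).trans ?_
      rw [← sub_div, abs_div, abs_of_pos hl]
    have h3 : 0 ≤ (64 * θ j + 64 / rad j) * ((Br ∩ gap j c q).card : ℝ) := by positivity
    refine le_trans ?_ (le_add_of_nonneg_left h3)
    rw [le_div_iff₀ (by positivity)]
    have hd2 : |trunc (P.1 / l) - trunc (P'.1 / l)| * l ≤ |P.1 - P'.1| := by
      rwa [le_div_iff₀ hl] at hd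
    have hKF : (K.card : ℝ) * (θ j * rad j) ≤ (F.card : ℝ) ^ 2 := by
      have : (K.card : ℝ) ≤ 2 * F.card := by linarith
      have : 2 * (θ j * rad j) ≤ F.card := by linarith
      have : (0 : ℝ) ≤ F.card := by positivity
      nlinarith
    calc _ = (K.card : ℝ) * (θ j * rad j) * (|trunc (P.1 / l) - trunc (P'.1 / l)| * l) := by ring
      _ ≤ (F.card : ℝ) ^ 2 * |P.1 - P'.1| := by gcongr
      _ ≤ _ := by linarith

section Links

/-- `q` is the next good square below the good square `c` in its strip. -/
structure Lnk (Br : Finset (ℤ × ℤ)) (θ : ℕ → ℝ) (j : ℕ) (c q : ℤ × ℤ) : Prop where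
  cor_c : cor j c = c
  cor_q : cor j q = q
  good_c : Good Br θ j c
  good_q : Good Br θ j q
  fst_eq : q.1 = c.1
  snd_le : q.2 + rad j ≤ c.2
  bad : ∀ v, q.2 + rad j ≤ v → v < c.2 → ¬ Good Br θ j (cor j (c.1, v))

section
variable {Br : Finset (ℤ × ℤ)} {θ : ℕ → ℝ} {j : ℕ} {c q c' q' : ℤ × ℤ}

theorem cor_add_le {a b : ℤ × ℤ} (ha : cor j a = a) (hb : cor j b = b) (h1 : a.1 = b.1)
    (h : a.2 < b.2) : a.2 + rad j ≤ b.2 := by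
  by_contra hlt
  rw [not_le] at hlt
  have hr := rad_pos j
  have hm : b ∈ sqr j (cor j a) := by
    rw [ha]
    simp only [sqr, Finset.mem_product, Finset.mem_Ico]; omega
  have := cor_eq_of_mem hm
  rw [ha, hb] at this
  rw [this] at h
  exact lt_irrefl _ h

theorem cor_fst_lt {a b : ℤ × ℤ} (ha : cor j a = a) (hb : cor j b = b) {i : ℤ}
    (h1 : a.1 ≤ i ∧ i < a.1 + rad j) (h2 : b.1 ≤ i ∧ i < b.1 + rad j) : a.1 = b.1 := by
  have e1 := (Prod.ext_iff.1 (cor_eq_of_mem (s := j) (x := a) (y := (i, a.2)) (by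
    rw [ha]; have := rad_pos j; simp only [sqr, Finset.mem_product, Finset.mem_Ico]; omega))).1
  have e2 := (Prod.ext_iff.1 (cor_eq_of_mem (s := j) (x := b) (y := (i, b.2)) (by
    rw [hb]; have := rad_pos j; simp only [sqr, Finset.mem_product, Finset.mem_Ico]; omega))).1
  rw [ha] at e1
  rw [hb] at e2
  rw [← e1, ← e2]; rfl

theorem Lnk.snd_le_of_lt (h : Lnk Br θ j c q) (h' : Lnk Br θ j c' q') (e : c.1 = c'.1)
    (hlt : c.2 < c'.2) : c.2 ≤ q'.2 := by
  by_contra hcon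
  rw [not_le] at hcon
  have h1 := cor_add_le h'.cor_q h.cor_c (h'.fst_eq.trans e.symm) hcon
  refine h'.bad c.2 h1 hlt ?_
  rw [← e, h.cor_c]; exact h.good_c

theorem Lnk.unique (h : Lnk Br θ j c q) (h' : Lnk Br θ j c q') : q = q' := by
  have hr := rad_pos j
  have key : ∀ {a b}, Lnk Br θ j c a → Lnk Br θ j c b → ¬ a.2 < b.2 := by
    intro a b ha hb hlt
    have h1 := cor_add_le ha.cor_q hb.cor_q (ha.fst_eq.trans hb.fst_eq.symm) hlt
    have h2 := hb.snd_le
    refine ha.bad b.2 h1 (by omega) ?_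
    rw [← hb.fst_eq, hb.cor_q]; exact hb.good_q
  have h1 := key h h'
  have h2 := key h' h
  ext
  · rw [h.fst_eq, h'.fst_eq]
  · omega

theorem Lnk.gap_disjoint (h : Lnk Br θ j c q) (h' : Lnk Br θ j c' q') {z : ℤ × ℤ}
    (hz : z ∈ gap j c q) (hz' : z ∈ gap j c' q') : c = c' ∧ q = q' := by
  have hr := rad_pos j
  rw [mem_gap] at hz hz'
  have e := cor_fst_lt h.cor_c h'.cor_c hz.1 hz'.1
  have n1 : ¬ c.2 < c'.2 := fun hlt => by have := h.snd_le_of_lt h' e hlt; omega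
  have n2 : ¬ c'.2 < c.2 := fun hlt => by have := h'.snd_le_of_lt h e.symm hlt; omega
  have hc : c = c' := Prod.ext e (by omega)
  subst hc
  exact ⟨rfl, h.unique h'⟩

theorem Lnk.unique_up (h : Lnk Br θ j c q) (h' : Lnk Br θ j c' q) : c = c' := by
  have hr := rad_pos j
  have e : c.1 = c'.1 := h.fst_eq.symm.trans h'.fst_eq
  have := h.snd_le
  have := h'.snd_le
  have n1 : ¬ c.2 < c'.2 := fun hlt => by have := h.snd_le_of_lt h' e hlt; omega
  have n2 : ¬ c'.2 < c.2 := fun hlt => by have := h'.snd_le_of_lt h e.symm hlt; omega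
  exact Prod.ext e (by omega)

theorem Lnk.of_column {i y w : ℤ} (hg : Good Br θ j (cor j (i, y + 1))) (hw : w ≤ y)
    (hgw : Good Br θ j (cor j (i, w))) (hbad : ∀ v, w < v → v ≤ y → ¬ Good Br θ j (cor j (i, v)))
    (hne : cor j (i, y + 1) ≠ cor j (i, w)) :
    Lnk Br θ j (cor j (i, y + 1)) (cor j (i, w)) ∧ (cor j (i, y + 1)).2 = y + 1 ∧
      (cor j (i, w)).2 + rad j = w + 1 := by
  have hr := rad_pos j
  have hf : ∀ v v', (cor j (i, v)).1 = (cor j (i, v')).1 := fun v v' => rfl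
  have b1 := cor_bounds j (i, y + 1)
  have b2 := cor_bounds j (i, w)
  simp only at b1 b2
  have hy : cor j (i, y) ≠ cor j (i, y + 1) := by
    intro h
    rcases hw.eq_or_lt with rfl | hlt
    · exact hne h.symm
    · exact hbad y hlt le_rfl (h ▸ hg)
  have hw1 : cor j (i, w + 1) ≠ cor j (i, w) := by
    intro h
    rcases hw.eq_or_lt with rfl | hlt
    · exact hne h
    · exact hbad (w + 1) (by omega) (by omega) (h ▸ hgw)
  have e1 : (cor j (i, y + 1)).2 = y + 1 := by
    by_contra h
    refine hy (cor_eq_of_mem ?_)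
    simp only [sqr, Finset.mem_product, Finset.mem_Ico]; omega
  have e2 : (cor j (i, w)).2 + rad j = w + 1 := by
    by_contra h
    refine hw1 (cor_eq_of_mem ?_)
    simp only [sqr, Finset.mem_product, Finset.mem_Ico]; omega
  refine ⟨⟨cor_cor _ _, cor_cor _ _, hg, hgw, rfl, by omega, fun v h1 h2 => ?_⟩, e1, e2⟩
  have : cor j ((cor j (i, y + 1)).1, v) = cor j (i, v) := by
    have := (Prod.ext_iff.1 (cor_cor j (i, y + 1))).1
    simp only [cor] at this ⊢
    rw [this]
  rw [this]
  exact hbad v (by omega) (by omega)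

end

variable {f g t : ℤ × ℤ → ℝ} {Br : Finset (ℤ × ℤ)} {N J : ℕ} {Λ T : ℝ}

theorem sum_gapSum_le {L : Finset ((ℤ × ℤ) × (ℤ × ℤ))} {θ : ℕ → ℝ} {j : ℕ} (ht : ∀ z, 0 ≤ t z)
    (hL : ∀ p ∈ L, Lnk Br θ j p.1 p.2) {S : Finset (ℤ × ℤ)}
    (hS : ∀ p ∈ L, bx p.1 (66 * rad j) ⊆ S ∧ bx p.2 (66 * rad j) ⊆ S ∧ gap j p.1 p.2 ⊆ S) :
    ∑ p ∈ L, gapSum t j p.1 p.2 ≤ 35000 * ∑ z ∈ S, t z := by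
  classical
  have h0 : 0 ≤ ∑ z ∈ S, t z := Finset.sum_nonneg fun z _ => ht z
  have i1 : Set.InjOn (fun p : (ℤ × ℤ) × (ℤ × ℤ) => p.1) L := by
    rintro ⟨c, q⟩ hp ⟨c', q'⟩ hp' (rfl : c = c')
    exact Prod.ext rfl ((hL (c, q) hp).unique (hL (c, q') hp'))
  have i2 : Set.InjOn (fun p : (ℤ × ℤ) × (ℤ × ℤ) => p.2) L := by
    rintro ⟨c, q⟩ hp ⟨c', q'⟩ hp' (rfl : q = q')
    exact Prod.ext ((hL (c, q) hp).unique_up (hL (c', q) hp')) rfl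
  have h1 := sum_corner_bx_le (s := j) (K := L.image fun p => p.1) (S := S) (w := t) (k := 64)
    (by simp only [Finset.mem_image]; rintro _ ⟨p, hp, rfl⟩; exact (hL p hp).cor_c) ht (by norm_num)
    (by simp only [Finset.mem_image]; rintro _ ⟨p, hp, rfl⟩; exact (hS p hp).1)
  have h2 := sum_corner_bx_le (s := j) (K := L.image fun p => p.2) (S := S) (w := t) (k := 64)
    (by simp only [Finset.mem_image]; rintro _ ⟨p, hp, rfl⟩; exact (hL p hp).cor_q) ht (by norm_num)
    (by simp only [Finset.mem_image]; rintro _ ⟨p, hp, rfl⟩; exact (hS p hp).2.1)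
  rw [Finset.sum_image i1] at h1
  rw [Finset.sum_image i2] at h2
  have h3 : ∑ p ∈ L, ∑ z ∈ gap j p.1 p.2, t z ≤ ∑ z ∈ S, t z := by
    rw [← Finset.sum_biUnion]
    · refine Finset.sum_le_sum_of_subset_of_nonneg ?_ fun z _ _ => ht z
      rw [Finset.biUnion_subset]
      exact fun p hp => (hS p hp).2.2
    · intro p hp p' hp' hne
      rw [Function.onFun, Finset.disjoint_left]
      intro z hz hz'
      obtain ⟨a, b⟩ := (hL p hp).gap_disjoint (hL p' hp') hz hz'
      exact hne (Prod.ext a b)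
  simp only [gapSum, Finset.sum_add_distrib]
  push_cast at h1 h2
  linarith

theorem sum_card_gap_le {L : Finset ((ℤ × ℤ) × (ℤ × ℤ))} {θ : ℕ → ℝ} {j : ℕ}
    (hL : ∀ p ∈ L, Lnk Br θ j p.1 p.2) :
    ∑ p ∈ L, ((Br ∩ gap j p.1 p.2).card : ℝ) ≤ Br.card := by
  classical
  norm_cast
  rw [← Finset.card_biUnion]
  · refine Finset.card_le_card ?_
    rw [Finset.biUnion_subset]
    exact fun p hp => Finset.inter_subset_left
  · intro p hp p' hp' hne
    rw [Function.onFun, Finset.disjoint_left]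
    intro z hz hz'
    obtain ⟨a, b⟩ := (hL p hp).gap_disjoint (hL p' hp') (Finset.mem_inter.1 hz).2
      (Finset.mem_inter.1 hz').2
    exact hne (Prod.ext a b)

/-- Points close to a bad or inconsistent square of scale `j` or to a bad one of scale `j + 1`. -/
def Rough (f g t : ℤ × ℤ → ℝ) (Br : Finset (ℤ × ℤ)) (J : ℕ) (Λ : ℝ) (j : ℕ) (z : ℤ × ℤ) : Prop :=
  (∃ w, ¬ Good Br (thr J) j w ∧ dst z w ≤ (67 : ℤ) * rad j) ∨
  (∃ w, ¬ Good Br (thr J) (j + 1) w ∧ dst z w ≤ (2 : ℤ) * rad (j + 1)) ∨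
  (∃ w, cor j w = w ∧ Disagree f g t Br J Λ j w ∧ dst z w ≤ 67 * rad j)

theorem Setup.card_rough (h : Setup f g t Br N J Λ T) {j : ℕ} (hj : j < J) {Z : Finset (ℤ × ℤ)}
    (hZ : ∀ z ∈ Z, Rough f g t Br J Λ j z) : (Z.card : ℝ) ≤ 10 ^ 46 * N ^ 2 / 512 ^ (J - j) := by
  classical
  have hr := rad_pos j
  have hr' := one_le_rad j
  have h1 := h.card_near_bad hj.le (k := 67) (by norm_num) (Z := Z.filter fun z =>
    ∃ w, ¬ Good Br (thr J) j w ∧ dst z w ≤ (67 : ℤ) * rad j) (fun z hz => (Finset.mem_filter.1 hz).2)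
  have h2 := h.card_near_bad (s := j + 1) hj (k := 2) (by norm_num) (Z := Z.filter fun z =>
    ∃ w, ¬ Good Br (thr J) (j + 1) w ∧ dst z w ≤ (2 : ℤ) * rad (j + 1))
    (fun z hz => (Finset.mem_filter.1 hz).2)
  set Z3 := Z.filter fun z => ∃ w, cor j w = w ∧ Disagree f g t Br J Λ j w ∧ dst z w ≤ 67 * rad j
    with hZ3
  have hw : ∀ z ∈ Z3, ∃ w, cor j w = w ∧ Disagree f g t Br J Λ j w ∧ dst z w ≤ 67 * rad j :=
    fun z hz => (Finset.mem_filter.1 hz).2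
  choose! w hw1 hw2 hw3 using hw
  set K := Z3.image w with hK
  have hKc : ∀ c ∈ K, cor j c = c := by
    simp only [hK, Finset.mem_image]; rintro _ ⟨z, hz, rfl⟩; exact hw1 z hz
  have hKD : ∀ c ∈ K, Disagree f g t Br J Λ j c := by
    simp only [hK, Finset.mem_image]; rintro _ ⟨z, hz, rfl⟩; exact hw2 z hz
  have h3 := sum_corner_le (s := j) hKc (φ := fun _ => 1) (ψ := fun _ => 1) (Y := K.biUnion (sqr j))
    (fun _ => zero_le_one) (fun c hc y hy => ⟨Finset.mem_biUnion.2 ⟨c, hc, hy⟩, le_rfl⟩)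
  simp only [Finset.sum_const, nsmul_eq_mul, mul_one] at h3
  have h4 := h.card_disagree (j := j) (Z := K.biUnion (sqr j)) (by
    intro z hz
    obtain ⟨c, hc, hz⟩ := Finset.mem_biUnion.1 hz
    rw [mem_sqr_iff (hKc c hc)] at hz
    exact (hKD c hc).congr (by rw [hz, hKc c hc]))
  have h5 : (Z3.card : ℝ) ≤ K.card * (135 * rad j) ^ 2 := by
    have a : Z3 ⊆ K.biUnion fun c => bx c (67 * rad j) := by
      intro z hz
      refine Finset.mem_biUnion.2 ⟨w z, Finset.mem_image_of_mem _ hz, ?_⟩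
      rw [mem_bx_iff_dst, dst_comm]
      exact hw3 z hz
    have b : (Z3.card : ℝ) ≤ ∑ c ∈ K, ((bx c (67 * rad j)).card : ℝ) := by
      exact_mod_cast (Finset.card_le_card a).trans Finset.card_biUnion_le
    refine b.trans ?_
    rw [← nsmul_eq_mul, ← Finset.sum_const]
    refine Finset.sum_le_sum fun c _ => ?_
    rw [card_bx c (by positivity)]
    refine pow_le_pow_left₀ (by positivity) ?_ 2
    push_cast; linarith
  have h6 : Z ⊆ (Z.filter fun z => ∃ w, ¬ Good Br (thr J) j w ∧ dst z w ≤ (67 : ℤ) * rad j) ∪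
      ((Z.filter fun z => ∃ w, ¬ Good Br (thr J) (j + 1) w ∧ dst z w ≤ (2 : ℤ) * rad (j + 1)) ∪
        Z3) := by
    intro z hz
    rcases hZ z hz with h | h | h
    · exact Finset.mem_union_left _ (Finset.mem_filter.2 ⟨hz, h⟩)
    · exact Finset.mem_union_right _ (Finset.mem_union_left _ (Finset.mem_filter.2 ⟨hz, h⟩))
    · exact Finset.mem_union_right _ (Finset.mem_union_right _ (Finset.mem_filter.2 ⟨hz, h⟩))
  have h7 := (Finset.card_le_card h6).trans ((Finset.card_union_le _ _).trans
    (Nat.add_le_add_left (Finset.card_union_le _ _) _))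
  have h8 : (Z.card : ℝ) ≤ (Z.filter fun z => ∃ w, ¬ Good Br (thr J) j w ∧
      dst z w ≤ (67 : ℤ) * rad j).card + ((Z.filter fun z => ∃ w, ¬ Good Br (thr J) (j + 1) w ∧
      dst z w ≤ (2 : ℤ) * rad (j + 1)).card + Z3.card) := by exact_mod_cast h7
  have e : (512 : ℝ) ^ (J - j) = 512 * 512 ^ (J - (j + 1)) := by
    rw [← pow_succ']; congr 1; omega
  have e' : (2 * ((2 : ℤ) : ℝ) + 129) ^ 2 * 2 ^ 20 * N ^ 2 / 512 ^ (J - (j + 1)) =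
      512 * ((2 * ((2 : ℤ) : ℝ) + 129) ^ 2 * 2 ^ 20) * (N ^ 2 / 512 ^ (J - j)) := by
    rw [e]; field_simp
  rw [e'] at h2
  rw [mul_div_assoc] at h1 h4 ⊢
  have h0 : (0 : ℝ) ≤ N ^ 2 / 512 ^ (J - j) := by positivity
  push_cast at h1 h2
  have h9 : (Z3.card : ℝ) ≤ 135 ^ 2 * (10 ^ 41 * (N ^ 2 / 512 ^ (J - j))) := by
    refine h5.trans ?_
    rw [mul_pow]; nlinarith
  nlinarith

end Links

section Slopes

variable {f g t : ℤ × ℤ → ℝ} {Br : Finset (ℤ × ℤ)} {N J : ℕ} {Λ T : ℝ}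

/-- The truncated slope on the square of scale `j` containing `x`. -/
def tslope (f g t : ℤ × ℤ → ℝ) (Br : Finset (ℤ × ℤ)) (J : ℕ) (Λ : ℝ) (j : ℕ) (x : ℤ × ℤ) : ℝ :=
  trunc (fslope f g t Br j x / lam Λ J j)

theorem tslope_congr {j : ℕ} {x y : ℤ × ℤ} (h : cor j x = cor j y) :
    tslope f g t Br J Λ j x = tslope f g t Br J Λ j y := by
  simp only [tslope, fslope, h]

/-- Points at which passing from scale `j + 1` to scale `j` may change the steering field. -/
def Touch (f g t : ℤ × ℤ → ℝ) (Br : Finset (ℤ × ℤ)) (J : ℕ) (Λ : ℝ) (j : ℕ) (z : ℤ × ℤ) : Prop :=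
  ¬ Good Br (thr J) j (cor j z) ∨ ¬ Good Br (thr J) (j + 1) (cor (j + 1) z) ∨
    Disagree f g t Br J Λ j z

/-- The column data of a jump of the extended slope at `x`, coming from the row `w`. -/
structure Jump (f g t : ℤ × ℤ → ℝ) (Br : Finset (ℤ × ℤ)) (J : ℕ) (Λ : ℝ) (j : ℕ)
    (x : ℤ × ℤ) (w : ℤ) : Prop where
  good_up : Good Br (thr J) j (cor j (x.1, x.2 + 1))
  le : w ≤ x.2
  good_dn : Good Br (thr J) j (cor j (x.1, w))
  bad : ∀ v, w < v → v ≤ x.2 → ¬ Good Br (thr J) j (cor j (x.1, v))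
  free : ∀ v, w ≤ v → v ≤ x.2 → (x.1, v) ∉ Br
  ne : tslope f g t Br J Λ j (x.1, x.2 + 1) ≠ tslope f g t Br J Λ j (x.1, w)

theorem Jump.lnk {j : ℕ} {x : ℤ × ℤ} {w : ℤ} (h : Jump f g t Br J Λ j x w) :
    Lnk Br (thr J) j (cor j (x.1, x.2 + 1)) (cor j (x.1, w)) ∧
      (cor j (x.1, x.2 + 1)).2 = x.2 + 1 ∧ (cor j (x.1, w)).2 + rad j = w + 1 :=
  Lnk.of_column h.good_up h.le h.good_dn h.bad fun e => h.ne (tslope_congr e)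

theorem Jump.rough {j : ℕ} {x : ℤ × ℤ} {w : ℤ} (h : Jump f g t Br J Λ j x w)
    (ht : Touch f g t Br J Λ j x ∨ Touch f g t Br J Λ j (x.1, x.2 + 1)) {z : ℤ × ℤ}
    (hz : z ∈ bx (cor j (x.1, x.2 + 1)) (66 * rad j) ∨ z ∈ bx (cor j (x.1, w)) (66 * rad j) ∨
      z ∈ gap j (cor j (x.1, x.2 + 1)) (cor j (x.1, w))) : Rough f g t Br J Λ j z := by
  obtain ⟨hl, e1, e2⟩ := h.lnk
  have hr := rad_pos j
  have hrs := rad_succ j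
  set c := cor j (x.1, x.2 + 1) with hc
  set q := cor j (x.1, w) with hq
  have b1 : c.1 ≤ x.1 ∧ x.1 < c.1 + rad j := (cor_bounds j (x.1, x.2 + 1)).1
  have hfst := hl.fst_eq
  rw [mem_bx_iff_dst, mem_bx_iff_dst, mem_gap] at hz
  have corx : ∀ v, cor j (c.1, v) = cor j (x.1, v) := by
    intro v
    have := (Prod.ext_iff.1 (cor_cor j (x.1, x.2 + 1))).1
    simp only [cor, hc] at this ⊢
    rw [this]
  rcases h.le.eq_or_lt with hw | hw
  · have hzc : dst z c ≤ 67 * rad j ∧ dst z q ≤ 67 * rad j := by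
      rw [dst_le, dst_le]
      rw [dst_le, dst_le] at hz
      rcases hz with hz | hz | hz <;> constructor <;> constructor <;> constructor <;> omega
    have tri : ∀ y, dst y c < rad j ∨ dst y q < rad j →
        dst z (cor (j + 1) y) ≤ 2 * rad (j + 1) := by
      intro y hy
      have h1 := dst_cor_lt (j + 1) y
      have h2 := dst_triangle z y (cor (j + 1) y)
      have h3 := dst_triangle z c y
      have h4 := dst_triangle z q y
      rw [dst_comm c y] at h3
      rw [dst_comm q y] at h4
      rcases hy with hy | hy <;> linarith [hzc.1, hzc.2]
    rcases ht with (ht | ht | ht) | (ht | ht | ht)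
    · exact absurd h.good_dn (by rw [hw]; exact ht)
    · refine Or.inr (Or.inl ⟨_, ht, tri x (Or.inr ?_)⟩)
      have := dst_cor_lt j x
      rw [hq, hw]; exact this
    · refine Or.inr (Or.inr ⟨q, hl.cor_q, ht.congr ?_, hzc.2⟩)
      rw [hl.cor_q, hq, hw]
    · exact absurd h.good_up ht
    · refine Or.inr (Or.inl ⟨_, ht, tri (x.1, x.2 + 1) (Or.inl (dst_cor_lt j _))⟩)
    · exact Or.inr (Or.inr ⟨c, hl.cor_c, ht.congr (by rw [hl.cor_c]), hzc.1⟩)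
  · refine Or.inl ?_
    rcases hz with hz | hz | hz
    · refine ⟨_, h.bad x.2 hw le_rfl, ?_⟩
      have h1 : dst (x.1, x.2) (cor j (x.1, x.2)) < rad j := dst_cor_lt j _
      have h2 := dst_triangle z c (cor j (x.1, x.2))
      have h3 : dst c (cor j (x.1, x.2)) ≤ rad j := by
        have b := (cor_bounds j (x.1, x.2)).2
        have b' : (cor j (x.1, x.2)).1 = c.1 := rfl
        simp only at b
        rw [dst_le]; omega
      rw [dst_comm] at hz
      linarith
    · refine ⟨_, h.bad (w + 1) (by omega) (by omega), ?_⟩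
      have h2 := dst_triangle z q (cor j (x.1, w + 1))
      have h3 : dst q (cor j (x.1, w + 1)) ≤ rad j := by
        have b := (cor_bounds j (x.1, w + 1)).2
        have b' : (cor j (x.1, w + 1)).1 = c.1 := rfl
        simp only at b
        rw [dst_le]; omega
      rw [dst_comm] at hz
      linarith
    · rcases le_or_gt (q.2 + rad j) z.2 with hz2 | hz2
      · refine ⟨_, h.bad z.2 (by omega) (by omega), ?_⟩
        have b := (cor_bounds j (x.1, z.2)).2
        have b' : (cor j (x.1, z.2)).1 = c.1 := rfl
        simp only at b
        rw [dst_le]; omega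
      · refine ⟨_, h.bad (w + 1) (by omega) (by omega), ?_⟩
        have b := (cor_bounds j (x.1, w + 1)).2
        have b' : (cor j (x.1, w + 1)).1 = c.1 := rfl
        simp only at b
        rw [dst_le]; omega

theorem Setup.sum_le_of_card (h : Setup f g t Br N J Λ T) (S : Finset (ℤ × ℤ)) {B : ℝ}
    (hB : 0 ≤ B) (hS : ∀ S' ⊆ S, (∀ z ∈ S', t z ≠ 0) → (S'.card : ℝ) ≤ B ^ 2) :
    ∑ z ∈ S, t z ≤ B * T := by
  classical
  have e : ∑ z ∈ S, t z = ∑ z ∈ S.filter fun z => t z ≠ 0, t z := (Finset.sum_filter_ne_zero S).symm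
  rw [e]
  have hT := h.T_nonneg
  refine abs_le_of_sq_le_sq' ?_ (by positivity) |>.2
  have h1 := sq_sum_le_card_mul_sum_sq (s := S.filter fun z => t z ≠ 0) (f := t)
  have h2 := hS _ (Finset.filter_subset _ _) (fun z hz => (Finset.mem_filter.1 hz).2)
  calc _ ≤ _ := h1
    _ ≤ B ^ 2 * T ^ 2 := mul_le_mul h2 (h.sq _) (Finset.sum_nonneg fun z _ => sq_nonneg _) (sq_nonneg _)
    _ = _ := by ring

theorem card_le_of_mem_box {S : Finset (ℤ × ℤ)}
    (hS : ∀ z ∈ S, (0 ≤ z.1 ∧ z.1 < N) ∧ (0 ≤ z.2 ∧ z.2 < N)) : (S.card : ℝ) ≤ (N : ℝ) ^ 2 := by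
  have a : S ⊆ Finset.Ico (0 : ℤ) N ×ˢ Finset.Ico (0 : ℤ) N := by
    intro z hz
    simpa only [Finset.mem_product, Finset.mem_Ico] using hS z hz
  have := Finset.card_le_card a
  rw [Finset.card_product, Int.card_Ico] at this
  simp only [sub_zero, Int.toNat_natCast] at this
  rw [pow_two]; exact_mod_cast this

theorem Setup.thr_mul_lam (h : Setup f g t Br N J Λ T) {j : ℕ} (hj : j ≤ J) :
    1 / (2 ^ 20 * 8 ^ (J - j)) ≤ thr J j * rad j * lam Λ J j := by
  have h1 := h.one_le
  rw [rad_eq_div hj, thr, lam, pow_mul]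
  have e : (1 : ℝ) / 2 ^ 20 / 2 ^ (J - j) * (rad J / 1024 ^ (J - j)) * (Λ * (2 ^ 8) ^ (J - j)) =
      (1 / (2 ^ 20 * 8 ^ (J - j))) * (Λ * rad J) := by
    have e1 : (2 : ℝ) ^ (J - j) * 1024 ^ (J - j) = (2 ^ 8) ^ (J - j) * 8 ^ (J - j) := by
      rw [← mul_pow, ← mul_pow]; norm_num
    field_simp
    linear_combination (-Λ * rad J) * e1
  rw [e]
  exact le_mul_of_one_le_right (by positivity) h1

theorem Setup.sum_jump_le (h : Setup f g t Br N J Λ T) {j : ℕ} (hj : j ≤ J) {X : Finset (ℤ × ℤ)}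
    {w : ℤ × ℤ → ℤ} (hX : ∀ x ∈ X, Jump f g t Br J Λ j x (w x))
    (ht : j < J → ∀ x ∈ X, Touch f g t Br J Λ j x ∨ Touch f g t Br J Λ j (x.1, x.2 + 1)) :
    ∑ x ∈ X, |tslope f g t Br J Λ j (x.1, x.2 + 1) - tslope f g t Br J Λ j (x.1, w x)| ≤
      (64 * thr J j + 64 / rad j) * Br.card + 10 ^ 42 * (N * T) / 2 ^ (J - j) := by
  classical
  have hlam : 0 < lam Λ J j := mul_pos h.Λ_pos (by positivity)
  have hT := h.T_nonneg
  set ln : ℤ × ℤ → (ℤ × ℤ) × (ℤ × ℤ) := fun x => (cor j (x.1, x.2 + 1), cor j (x.1, w x)) with hln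
  set L := X.image ln with hLdef
  have hL : ∀ p ∈ L, Lnk Br (thr J) j p.1 p.2 := by
    simp only [hLdef, Finset.mem_image]
    rintro _ ⟨x, hx, rfl⟩
    exact (hX x hx).lnk.1
  have step1 : ∑ x ∈ X, |tslope f g t Br J Λ j (x.1, x.2 + 1) - tslope f g t Br J Λ j (x.1, w x)| ≤
      ∑ p ∈ L, ((freeCols Br j p.1 p.2).card : ℝ) * |trunc ((fitp f g t Br j p.1).1 / lam Λ J j) -
        trunc ((fitp f g t Br j p.2).1 / lam Λ J j)| := by
    rw [← Finset.sum_fiberwise_of_maps_to (t := L) (g := ln)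
      (fun x hx => Finset.mem_image_of_mem _ hx)]
    refine Finset.sum_le_sum fun p hp => ?_
    have e : ∀ x ∈ X.filter (fun x => ln x = p),
        |tslope f g t Br J Λ j (x.1, x.2 + 1) - tslope f g t Br J Λ j (x.1, w x)| =
        |trunc ((fitp f g t Br j p.1).1 / lam Λ J j) -
        trunc ((fitp f g t Br j p.2).1 / lam Λ J j)| := by
      intro x hx
      obtain ⟨_, rfl⟩ := Finset.mem_filter.1 hx
      rfl
    rw [Finset.sum_congr rfl e, Finset.sum_const, nsmul_eq_mul]
    gcongr
    refine Finset.card_le_card_of_injOn Prod.fst ?_ ?_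
    · intro x hx
      obtain ⟨hxX, rfl⟩ := Finset.mem_filter.1 hx
      obtain ⟨l, e1, e2⟩ := (hX x hxX).lnk
      have b1 := (cor_bounds j (x.1, x.2 + 1)).1
      simp only [freeCols, Finset.coe_filter, Finset.mem_Ico, Set.mem_ofPred_eq, hln]
      refine ⟨b1, ?_⟩
      rintro ⟨z1, z2⟩ hz rfl
      rw [mem_gap] at hz
      simp only at hz
      exact (hX x hxX).free z2 (by omega) (by omega)
    · intro x hx y hy hxy
      obtain ⟨hxX, hx⟩ := Finset.mem_filter.1 hx
      obtain ⟨hyX, hy⟩ := Finset.mem_filter.1 hy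
      obtain ⟨l, e1, e2⟩ := (hX x hxX).lnk
      obtain ⟨l', e1', e2'⟩ := (hX y hyX).lnk
      have : ln x = ln y := hx.trans hy.symm
      simp only [hln, Prod.mk.injEq] at this
      rw [this.1, e1'] at e1
      exact Prod.ext hxy (by omega)
  set S := L.biUnion fun p => bx p.1 (66 * rad j) ∪ (bx p.2 (66 * rad j) ∪ gap j p.1 p.2) with hS
  have hSm : ∀ p ∈ L, bx p.1 (66 * rad j) ⊆ S ∧ bx p.2 (66 * rad j) ⊆ S ∧ gap j p.1 p.2 ⊆ S := by
    intro p hp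
    have := Finset.subset_biUnion_of_mem
      (fun p => bx p.1 (66 * rad j) ∪ (bx p.2 (66 * rad j) ∪ gap j p.1 p.2)) hp
    exact ⟨Finset.subset_union_left.trans this,
      (Finset.subset_union_left.trans Finset.subset_union_right).trans this,
      (Finset.subset_union_right.trans Finset.subset_union_right).trans this⟩
  have hvol : ∑ z ∈ S, t z ≤ (10 ^ 23 * N / 16 ^ (J - j)) * T := by
    refine h.sum_le_of_card S (by positivity) fun S' hS' hne => ?_
    rcases hj.eq_or_lt with rfl | hlt
    · have := card_le_of_mem_box (S := S') fun z hz => h.supp z (hne z hz)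
      simp only [Nat.sub_self, pow_zero, div_one]
      refine this.trans ?_
      rw [mul_pow]
      exact le_mul_of_one_le_left (by positivity) (by norm_num)
    · have := h.card_rough hlt (Z := S') (fun z hz => by
        obtain ⟨p, hp, hzp⟩ := Finset.mem_biUnion.1 (hS' hz)
        obtain ⟨x, hx, rfl⟩ := Finset.mem_image.1 hp
        simp only [Finset.mem_union] at hzp
        exact (hX x hx).rough (ht hlt x hx) hzp)
      refine this.trans ?_
      have e : ((16 : ℝ) ^ (J - j)) ^ 2 = 256 ^ (J - j) := by
        rw [← pow_mul, mul_comm, pow_mul]; norm_num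
      rw [div_pow, mul_pow, e]
      refine div_le_div₀ (by positivity) (mul_le_mul_of_nonneg_right (by norm_num) (sq_nonneg _))
        (by positivity) (pow_le_pow_left₀ (by norm_num) (by norm_num) _)
  have hsum : ∑ p ∈ L, gapSum t j p.1 p.2 ≤ 35000 * ((10 ^ 23 * N / 16 ^ (J - j)) * T) :=
    (sum_gapSum_le h.compat.nonneg hL hSm).trans (by gcongr)
  have hκ := h.thr_mul_lam hj
  have h8 : (0 : ℝ) < 8 ^ (J - j) := by positivity
  refine step1.trans ?_
  calc _ ≤ ∑ p ∈ L, ((64 * thr J j + 64 / rad j) * ((Br ∩ gap j p.1 p.2).card : ℝ) +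
        10 ^ 6 * gapSum t j p.1 p.2 / (thr J j * rad j * lam Λ J j)) :=
        Finset.sum_le_sum fun p hp => card_freeCols_mul_le h.compat (thr_le J) (thr_pos J j)
          (hL p hp).good_c (hL p hp).good_q (hL p hp).fst_eq (hL p hp).snd_le hlam
    _ = (64 * thr J j + 64 / rad j) * ∑ p ∈ L, ((Br ∩ gap j p.1 p.2).card : ℝ) +
        10 ^ 6 * (∑ p ∈ L, gapSum t j p.1 p.2) / (thr J j * rad j * lam Λ J j) := by
        rw [Finset.sum_add_distrib, Finset.mul_sum, ← Finset.sum_div, Finset.mul_sum]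
    _ ≤ (64 * thr J j + 64 / rad j) * Br.card +
        10 ^ 6 * (35000 * ((10 ^ 23 * N / 16 ^ (J - j)) * T)) / (1 / (2 ^ 20 * 8 ^ (J - j))) := by
        have := rad_pos' j
        have := thr_pos J j
        gcongr
        exact sum_card_gap_le hL
    _ ≤ _ := by
        refine add_le_add le_rfl ?_
        have e : (16 : ℝ) ^ (J - j) = 2 ^ (J - j) * 8 ^ (J - j) := by rw [← mul_pow]; norm_num
        rw [e]
        have e2 : 10 ^ 6 * (35000 * ((10 ^ 23 * (N : ℝ) / (2 ^ (J - j) * 8 ^ (J - j))) * T)) /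
          (1 / (2 ^ 20 * 8 ^ (J - j))) = (10 ^ 6 * 35000 * 10 ^ 23 * 2 ^ 20) * (N * T) / 2 ^ (J - j) := by
          field_simp
        rw [e2]
        gcongr
        norm_num

end Slopes

section Summation

variable {f g t : ℤ × ℤ → ℝ} {Br : Finset (ℤ × ℤ)} {N J : ℕ} {Λ T : ℝ}

theorem good_of_far {θ : ℕ → ℝ} {j : ℕ} (h0 : 0 ≤ θ j) {x : ℤ × ℤ}
    (h : ∀ z ∈ Br, 64 * rad j < |z.2 - x.2|) : Good Br θ j x := by
  have : Br ∩ bx x (64 * rad j) = ∅ := by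
    rw [Finset.eq_empty_iff_forall_notMem]
    intro z hz
    rw [Finset.mem_inter, mem_bx] at hz
    have h1 := h z hz.1
    rw [lt_abs] at h1
    omega
  have hr := rad_pos' j
  rw [Good, this, Finset.card_empty, Nat.cast_zero]
  positivity

theorem exists_good_below_above {θ : ℕ → ℝ} {j : ℕ} (h0 : 0 ≤ θ j) (i y : ℤ) :
    (∃ w ≤ y, Good Br θ j (cor j (i, w))) ∧ ∃ w, y ≤ w ∧ Good Br θ j (cor j (i, w)) := by
  obtain ⟨B, hB⟩ : ∃ B : ℤ, ∀ z ∈ Br, |z.2| ≤ B := by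
    obtain ⟨B, hB⟩ := (Br.image fun z => |z.2|).bddAbove
    exact ⟨B, fun z hz => hB (Finset.mem_coe.2 (Finset.mem_image_of_mem _ hz))⟩
  have hr := rad_pos j
  constructor
  · refine ⟨min y (-B - 66 * rad j), min_le_left _ _, good_of_far h0 fun z hz => ?_⟩
    have b := (cor_bounds j (i, min y (-B - 66 * rad j))).2
    have := abs_le.1 (hB z hz)
    have := min_le_right y (-B - 66 * rad j)
    simp only at b
    rw [lt_abs]; omega
  · refine ⟨max y (B + 66 * rad j), le_max_left _ _, good_of_far h0 fun z hz => ?_⟩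
    have b := (cor_bounds j (i, max y (B + 66 * rad j))).2
    have := abs_le.1 (hB z hz)
    have := le_max_right y (B + 66 * rad j)
    simp only at b
    rw [lt_abs]; omega

/-- The truncated slopes of scale `j`, extended along columns. -/
theorem exists_extended_slope (f g t : ℤ × ℤ → ℝ) (Br : Finset (ℤ × ℤ)) (J : ℕ) (Λ : ℝ) (j : ℕ) :
    ∃ ψ : ℤ × ℤ → ℝ, (∀ z, |ψ z| ≤ 1) ∧
      (∀ z, Good Br (thr J) j (cor j z) → ψ z = tslope f g t Br J Λ j z) ∧
      ∀ z, z ∉ Br → ψ (z.1, z.2 + 1) ≠ ψ z → ∃ w, Jump f g t Br J Λ j z w ∧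
        ψ (z.1, z.2 + 1) - ψ z =
          tslope f g t Br J Λ j (z.1, z.2 + 1) - tslope f g t Br J Λ j (z.1, w) := by
  have h := fun i : ℤ => exists_column_extension (fun y => Good Br (thr J) j (cor j (i, y)))
    (fun y => (i, y) ∈ Br) (fun y => tslope f g t Br J Λ j (i, y)) (fun y => abs_trunc_le _)
    (fun y => (exists_good_below_above (thr_pos J j).le i y).1)
    (fun y => (exists_good_below_above (thr_pos J j).le i y).2)
  choose ψ h1 h2 h3 using h
  refine ⟨fun z => ψ z.1 z.2, fun z => h1 _ _, fun z hz => h2 _ _ hz, fun z hz hne => ?_⟩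
  obtain ⟨a, w, b, c, d, e, k⟩ := h3 z.1 z.2 hz hne
  refine ⟨w, ⟨a, b, c, d, e, fun heq => hne ?_⟩, k⟩
  rw [heq, sub_self, sub_eq_zero] at k
  exact k

theorem steers_succ_eq {q : ℕ → ℝ} {m : ℕ} (hm : m < J) {z : ℤ × ℤ} (hΛ : 0 < Λ)
    (h1 : q m = tslope f g t Br J Λ (J - m) z)
    (h2 : q (m + 1) = tslope f g t Br J Λ (J - (m + 1)) z)
    (h3 : |fslope f g t Br (J - m) z - fslope f g t Br (J - (m + 1)) z| ≤
      lam Λ J (J - (m + 1)) / 4) : steers q (m + 1) = steers q m := by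
  obtain ⟨p, hp⟩ := steers_eq q m
  simp only [steers, hp, h1, h2, tslope]
  refine steer_steer_of_close (mul_pos hΛ (by positivity)) ?_ h3
  have e1 : J - (J - m) = m := by omega
  have e2 : J - (J - (m + 1)) = m + 1 := by omega
  rw [lam, lam, e1, e2, mul_add, pow_add]
  have e3 : (2 : ℝ) ^ (8 * 1) = 256 := by norm_num
  have : 0 < Λ * 2 ^ (8 * m) := by positivity
  rw [e3]; linarith

theorem not_touch {j : ℕ} {z : ℤ × ℤ} (h : ¬ Touch f g t Br J Λ j z) :
    Good Br (thr J) j (cor j z) ∧ Good Br (thr J) (j + 1) (cor (j + 1) z) ∧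
      |fslope f g t Br (j + 1) z - fslope f g t Br j z| ≤ lam Λ J j / 4 := by
  unfold Touch at h
  push Not at h
  obtain ⟨a, b, c⟩ := h
  refine ⟨a, b, ?_⟩
  unfold Disagree at c
  push Not at c
  exact c a b

theorem sum_half_pow_le (n : ℕ) : ∑ m ∈ Finset.range n, (1 : ℝ) / 2 ^ m ≤ 2 := by
  have h : ∑ m ∈ Finset.range n, (1 : ℝ) / 2 ^ m = 2 - 2 / 2 ^ n := by
    induction n with
    | zero => norm_num
    | succ n ih => rw [Finset.sum_range_succ, ih, pow_succ]; field_simp; ring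
  rw [h]
  have : (0 : ℝ) < 2 / 2 ^ n := by positivity
  linarith

theorem inv_rad_le (s : ℕ) : 1 / (rad s : ℝ) ≤ 1 / 1024 * (1 / 2 ^ s) := by
  unfold rad
  push_cast
  rw [one_div_mul_one_div, pow_succ, mul_comm ((1024 : ℝ) ^ s)]
  refine one_div_le_one_div_of_le (by positivity) ?_
  gcongr
  norm_num

/-- The extended truncated slopes at all scales. -/
structure Slopes (f g t : ℤ × ℤ → ℝ) (Br : Finset (ℤ × ℤ)) (J : ℕ) (Λ : ℝ)
    (ψ : ℕ → ℤ × ℤ → ℝ) : Prop where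
  abs_le_one : ∀ j z, |ψ j z| ≤ 1
  eq_tslope : ∀ j z, Good Br (thr J) j (cor j z) → ψ j z = tslope f g t Br J Λ j z
  jump : ∀ j z, z ∉ Br → ψ j (z.1, z.2 + 1) ≠ ψ j z → ∃ w, Jump f g t Br J Λ j z w ∧
    ψ j (z.1, z.2 + 1) - ψ j z =
      tslope f g t Br J Λ j (z.1, z.2 + 1) - tslope f g t Br J Λ j (z.1, w)

theorem exists_slopes (f g t : ℤ × ℤ → ℝ) (Br : Finset (ℤ × ℤ)) (J : ℕ) (Λ : ℝ) :
    ∃ ψ, Slopes f g t Br J Λ ψ := by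
  choose ψ h1 h2 h3 using exists_extended_slope f g t Br J Λ
  exact ⟨ψ, h1, h2, h3⟩

variable {ψ : ℕ → ℤ × ℤ → ℝ}

theorem Slopes.sum_le (hψ : Slopes f g t Br J Λ ψ) (h : Setup f g t Br N J Λ T) {j : ℕ}
    (hj : j ≤ J) {Y : Finset (ℤ × ℤ)} (hY : ∀ z ∈ Y, z ∉ Br)
    (ht : j < J → ∀ x ∈ Y, Touch f g t Br J Λ j x ∨ Touch f g t Br J Λ j (x.1, x.2 + 1)) :
    ∑ z ∈ Y, |ψ j (z.1, z.2 + 1) - ψ j z| ≤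
      (64 * thr J j + 64 / rad j) * Br.card + 10 ^ 42 * (N * T) / 2 ^ (J - j) := by
  classical
  have h1 : ∀ z ∈ Y.filter (fun z => ψ j (z.1, z.2 + 1) ≠ ψ j z), ∃ w, Jump f g t Br J Λ j z w ∧
      ψ j (z.1, z.2 + 1) - ψ j z =
        tslope f g t Br J Λ j (z.1, z.2 + 1) - tslope f g t Br J Λ j (z.1, w) := fun z hz =>
    hψ.jump j z (hY z (Finset.mem_filter.1 hz).1) (Finset.mem_filter.1 hz).2
  choose! w hw using h1
  have h2 := h.sum_jump_le hj (fun x hx => (hw x hx).1)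
    (fun hjJ x hx => ht hjJ x (Finset.mem_filter.1 hx).1)
  refine le_trans (le_of_eq ?_) h2
  rw [← Finset.sum_filter_add_sum_filter_not Y (fun z => ψ j (z.1, z.2 + 1) ≠ ψ j z),
    Finset.sum_eq_zero (s := Y.filter fun z => ¬ ψ j (z.1, z.2 + 1) ≠ ψ j z), add_zero]
  · exact Finset.sum_congr rfl fun z hz => by rw [(hw z hz).2]
  · intro z hz
    have := not_not.1 (Finset.mem_filter.1 hz).2
    rw [this, sub_self, abs_zero]

/-- The steering field. -/
def field (ψ : ℕ → ℤ × ℤ → ℝ) (J : ℕ) (z : ℤ × ℤ) : ℝ := steers (fun m => ψ (J - m) z) J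

theorem Slopes.abs_field_le (hψ : Slopes f g t Br J Λ ψ) (z : ℤ × ℤ) : |field ψ J z| ≤ 1 :=
  abs_steers_le (fun _ => hψ.abs_le_one _ _) _

theorem Slopes.steers_succ_eq (hψ : Slopes f g t Br J Λ ψ) (hΛ : 0 < Λ) {m : ℕ} (hm : m < J)
    {z : ℤ × ℤ} (hz : ¬ Touch f g t Br J Λ (J - (m + 1)) z) :
    steers (fun m => ψ (J - m) z) (m + 1) = steers (fun m => ψ (J - m) z) m := by
  have e : J - m = J - (m + 1) + 1 := by omega
  obtain ⟨h1, h2, h3⟩ := not_touch hz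
  rw [← e] at h2 h3
  exact _root_.steers_succ_eq hm hΛ (hψ.eq_tslope _ _ h2) (hψ.eq_tslope _ _ h1) h3

/-- The step to index `m` may change the steering field across the cell `z`. -/
def Active (f g t : ℤ × ℤ → ℝ) (Br : Finset (ℤ × ℤ)) (J : ℕ) (Λ : ℝ) (m : ℕ) (z : ℤ × ℤ) : Prop :=
  m ≠ 0 → m ≤ J → Touch f g t Br J Λ (J - m) z ∨ Touch f g t Br J Λ (J - m) (z.1, z.2 + 1)

open Classical in
theorem Slopes.abs_field_sub_le (hψ : Slopes f g t Br J Λ ψ) (hΛ : 0 < Λ) (z : ℤ × ℤ) :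
    |field ψ J (z.1, z.2 + 1) - field ψ J z| ≤
      ∑ m ∈ Finset.range (J + 1), if Active f g t Br J Λ m z then
        4 * |ψ (J - m) (z.1, z.2 + 1) - ψ (J - m) z| else 0 := by
  refine abs_steers_sub_le (E := fun m => Active f g t Br J Λ m z) (fun h => absurd rfl h)
    (fun m hm => ?_) J
  simp only [Active, not_forall, not_or] at hm
  obtain ⟨-, hm, h1, h2⟩ := hm
  exact ⟨hψ.steers_succ_eq hΛ hm h2, hψ.steers_succ_eq hΛ hm h1⟩

theorem Slopes.sum_field_le (hψ : Slopes f g t Br J Λ ψ) (h : Setup f g t Br N J Λ T)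
    {Y : Finset (ℤ × ℤ)} (hY : ∀ z ∈ Y, z ∉ Br) :
    ∑ z ∈ Y, |field ψ J (z.1, z.2 + 1) - field ψ J z| ≤ Br.card + 10 ^ 43 * (N * T) := by
  classical
  have hT := h.T_nonneg
  have h1 : ∀ m ∈ Finset.range (J + 1), (∑ z ∈ Y, if Active f g t Br J Λ m z then
      4 * |ψ (J - m) (z.1, z.2 + 1) - ψ (J - m) z| else 0) ≤
      (1 / 4 * Br.card + 4 * 10 ^ 42 * (N * T)) * (1 / 2 ^ m) +
        1 / 4 * Br.card * (1 / 2 ^ (J + 1 - 1 - m)) := by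
    intro m hm
    have hm : m ≤ J := by rw [Finset.mem_range] at hm; omega
    rw [← Finset.sum_filter, ← Finset.mul_sum]
    have h2 := hψ.sum_le h (j := J - m) (by omega) (Y := Y.filter fun z => Active f g t Br J Λ m z)
      (fun z hz => hY z (Finset.mem_filter.1 hz).1)
      (fun hj x hx => (Finset.mem_filter.1 hx).2 (by omega) hm)
    have e : J - (J - m) = m := by omega
    have h3 := mul_le_mul_of_nonneg_right (inv_rad_le (J - m)) (Nat.cast_nonneg (α := ℝ) Br.card)
    have h4 : 0 ≤ (1 : ℝ) / 2 ^ m * Br.card := by positivity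
    rw [thr, e] at h2
    have e2 : (10 : ℝ) ^ 42 * (N * T) / 2 ^ m = 10 ^ 42 * (N * T) * (1 / 2 ^ m) := by ring
    have e3 : (1 : ℝ) / 2 ^ 20 / 2 ^ m = 1 / 2 ^ 20 * (1 / 2 ^ m) := by ring
    have e4 : (64 : ℝ) / rad (J - m) = 64 * (1 / rad (J - m)) := by ring
    rw [e2, e3, e4] at h2
    rw [Nat.add_sub_cancel]
    linarith
  calc _ ≤ ∑ z ∈ Y, ∑ m ∈ Finset.range (J + 1), (if Active f g t Br J Λ m z then
        4 * |ψ (J - m) (z.1, z.2 + 1) - ψ (J - m) z| else 0) :=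
        Finset.sum_le_sum fun z _ => hψ.abs_field_sub_le h.Λ_pos z
    _ ≤ ∑ m ∈ Finset.range (J + 1),
        ((1 / 4 * Br.card + 4 * 10 ^ 42 * (N * T)) * ((1 : ℝ) / 2 ^ m) +
        1 / 4 * Br.card * (1 / 2 ^ (J + 1 - 1 - m))) := by
        rw [Finset.sum_comm]; exact Finset.sum_le_sum h1
    _ ≤ (1 / 4 * Br.card + 4 * 10 ^ 42 * (N * T)) * 2 + 1 / 4 * Br.card * 2 := by
        rw [Finset.sum_add_distrib, ← Finset.mul_sum, ← Finset.mul_sum,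
          Finset.sum_range_reflect (fun m => (1 : ℝ) / 2 ^ m)]
        have := sum_half_pow_le (J + 1)
        gcongr
    _ ≤ _ := by
        have : 0 ≤ N * T := by positivity
        linarith

theorem exists_broken_of_rho_ne {θ : ℕ → ℝ} (hθ : 0 ≤ θ 0) {z : ℤ × ℤ} (h : rho Br θ 0 z ≠ 0) :
    ∃ y ∈ Br, dst z y ≤ 2 ^ 35 := by
  rcases rho_cases (Br := Br) (θ := θ) (j := 0) z with h0 | ⟨s, hs, w, hw, hd⟩
  · exact absurd h0 h
  · obtain rfl : s = 0 := by omega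
    have hr : rad 0 = 1024 := by unfold rad; norm_num
    rw [Good, not_le] at hw
    have h1 : 0 < (Br ∩ bx w (64 * rad 0)).card := by
      have h2 : 0 ≤ θ 0 * rad 0 := mul_nonneg hθ (rad_pos' 0).le
      exact_mod_cast h2.trans_lt hw
    obtain ⟨y, hy⟩ := Finset.card_pos.1 h1
    rw [Finset.mem_inter, mem_bx_iff_dst, hr] at hy
    rw [hr] at hd
    have := dst_triangle z w y
    exact ⟨y, hy.1, by omega⟩

theorem card_rho_zero_le {θ : ℕ → ℝ} (hθ : 0 ≤ θ 0) {Z : Finset (ℤ × ℤ)}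
    (hZ : ∀ z ∈ Z, rho Br θ 0 z ≠ 0) : (Z.card : ℝ) ≤ 10 ^ 22 * Br.card := by
  classical
  have h1 : Z ⊆ Br.biUnion fun y => bx y (2 ^ 35) := fun z hz => by
    obtain ⟨y, hy, hd⟩ := exists_broken_of_rho_ne hθ (hZ z hz)
    rw [Finset.mem_biUnion]
    exact ⟨y, hy, mem_bx_iff_dst.2 (by rwa [dst_comm])⟩
  have h2 : ∀ y ∈ Br, (bx y (2 ^ 35)).card ≤ 10 ^ 22 := fun y _ => by
    have h3 := card_bx y (n := 2 ^ 35) (by norm_num)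
    have h4 : ((bx y (2 ^ 35)).card : ℝ) ≤ 10 ^ 22 := by rw [h3]; norm_num
    exact_mod_cast h4
  have h3 := (Finset.card_le_card h1).trans (Finset.card_biUnion_le_card_mul _ _ _ h2)
  rw [mul_comm]
  exact_mod_cast h3

/-- The first scale at which `z` is influenced by a broken region or by a change of slope. -/
def Stop (f g t : ℤ × ℤ → ℝ) (Br : Finset (ℤ × ℤ)) (J : ℕ) (Λ : ℝ) (j : ℕ) (z : ℤ × ℤ) : Prop :=
  j = J ∨ rho Br (thr J) (j + 1) z ≠ 0 ∨ Disagree f g t Br J Λ j z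

theorem Setup.card_stop_le (h : Setup f g t Br N J Λ T) {j : ℕ} (hj : j ≤ J) {Z : Finset (ℤ × ℤ)}
    (hb : ∀ z ∈ Z, (0 ≤ z.1 ∧ z.1 < N) ∧ (0 ≤ z.2 ∧ z.2 < N))
    (hZ : ∀ z ∈ Z, Stop f g t Br J Λ j z) :
    (Z.card : ℝ) ≤ 10 ^ 42 * N ^ 2 / 512 ^ (J - j) := by
  classical
  rcases hj.eq_or_lt with rfl | hj'
  · have := card_le_of_mem_box hb
    rw [Nat.sub_self, pow_zero, div_one]
    have : (0 : ℝ) ≤ (N : ℝ) ^ 2 := by positivity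
    linarith
  · have h1 := h.card_rho_pos (j := j + 1) hj'
      (Z := Z.filter fun z => rho Br (thr J) (j + 1) z ≠ 0) fun z hz => (Finset.mem_filter.1 hz).2
    have h2 := h.card_disagree (j := j)
      (Z := Z.filter fun z => Disagree f g t Br J Λ j z) fun z hz => (Finset.mem_filter.1 hz).2
    have h3 : (Z.card : ℝ) ≤ (Z.filter fun z => rho Br (thr J) (j + 1) z ≠ 0).card +
        (Z.filter fun z => Disagree f g t Br J Λ j z).card := by
      norm_cast
      refine le_trans (Finset.card_le_card fun z hz => ?_) (Finset.card_union_le _ _)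
      rw [Finset.mem_union, Finset.mem_filter, Finset.mem_filter]
      rcases hZ z hz with e | e | e
      · omega
      · exact Or.inl ⟨hz, e⟩
      · exact Or.inr ⟨hz, e⟩
    have e : J - j = (J - (j + 1)) + 1 := by omega
    have e2 : (2 : ℝ) ^ 72 * N ^ 2 / 512 ^ (J - (j + 1)) = 2 ^ 81 * N ^ 2 / 512 ^ (J - j) := by
      rw [e, pow_succ]; field_simp; ring
    rw [e2] at h1
    have h4 : (0 : ℝ) ≤ N ^ 2 / 512 ^ (J - j) := by positivity
    rw [mul_div_assoc] at h1 h2 ⊢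
    linarith

theorem Slopes.steers_eq_of_not_stop (hψ : Slopes f g t Br J Λ ψ) (hΛ : 0 < Λ) {z : ℤ × ℤ}
    {j : ℕ} (hj : j ≤ J) (hz : ∀ i < j, ¬ Stop f g t Br J Λ i z) :
    field ψ J z = steers (fun m => ψ (J - m) z) (J - j) := by
  induction j with
  | zero => rfl
  | succ j ih =>
    rw [ih (by omega) fun i hi => hz i (by omega)]
    have e : J - j = J - (j + 1) + 1 := by omega
    have e' : J - (J - (j + 1) + 1) = j := by omega
    have h1 := hz j (by omega)
    simp only [Stop, not_or, not_not] at h1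
    have hd := dst_cor_lt j z
    have hd' := dst_cor_lt (j + 1) z
    have hr := rad_pos j
    have hr' := rad_pos (j + 1)
    have h0 : 2 * (rho Br (thr J) (j + 1) z : ℤ) ≤ 2 ^ 24 * rad 0 := by
      have := rad_pos 0
      rw [h1.2.1]; push_cast; omega
    rw [e]
    refine hψ.steers_succ_eq hΛ (by omega) ?_
    rw [e']
    rintro (h2 | h2 | h2)
    · exact h2 (good_of_rho h0 (by omega) (by omega) (by omega))
    · exact h2 (good_of_rho h0 (by omega) le_rfl (by omega))
    · exact h1.2.2 h2

theorem Slopes.cost_le (hψ : Slopes f g t Br J Λ ψ) (hΛ : 0 < Λ) {z : ℤ × ℤ}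
    {j : ℕ} (hj : j ≤ J) (h0 : rho Br (thr J) j z = 0) (hz : ∀ i < j, ¬ Stop f g t Br J Λ i z) :
    |trunc (f (z + (0, 1))) - trunc (f z)| +
        field ψ J z * (trunc (f (z + (0, 1))) - trunc (f z)) ≤
      2 * |f (z + (0, 1)) - f z + fslope f g t Br j z| + 2 * lam Λ J j := by
  obtain ⟨p, hp⟩ := steers_eq (fun m => ψ (J - m) z) (J - j)
  have e : J - (J - j) = j := by omega
  have hd := dst_cor_lt j z
  have hr := rad_pos j
  have hg : Good Br (thr J) j (cor j z) := by
    have := rad_pos 0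
    exact good_of_rho (s := 0) (by rw [h0]; push_cast; omega) (by omega) le_rfl
      (by omega)
  rw [hψ.steers_eq_of_not_stop hΛ hj hz, hp]
  simp only [e]
  rw [hψ.eq_tslope j z hg, tslope]
  exact abs_add_steer_mul_le (mul_pos hΛ (by positivity)) p

theorem Setup.sum_stop_le (h : Setup f g t Br N J Λ T) {j : ℕ} (hj : j ≤ J) {Z : Finset (ℤ × ℤ)}
    (hb : ∀ z ∈ Z, (0 ≤ z.1 ∧ z.1 < N) ∧ (0 ≤ z.2 ∧ z.2 < N))
    (hZ : ∀ z ∈ Z, Stop f g t Br J Λ j z) (hr : ∀ z ∈ Z, rho Br (thr J) j z = 0) :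
    ∑ z ∈ Z, (2 * |f (z + (0, 1)) - f z + fslope f g t Br j z| + 2 * lam Λ J j) ≤
      (2 * 10 ^ 47 * (N * T) + 2 * 10 ^ 42 * (Λ * N ^ 2)) * (1 / 2 ^ (J - j)) := by
  classical
  have hT := h.T_nonneg
  have hΛ := h.Λ_pos
  have hc := h.card_stop_le hj hb hZ
  set k := J - j
  set S := Finset.Ico (0 : ℤ) N ×ˢ Finset.Ico (0 : ℤ) N
  have h1 := sum_slope_sq_le h.compat (thr_le J) hr (S := S) fun z hz => by
    by_contra h0
    exact hz (by simpa only [S, Finset.mem_product, Finset.mem_Ico] using h.supp z h0)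
  have h2 : ∑ z ∈ Z, |f (z + (0, 1)) - f z + fslope f g t Br j z| ≤
      10 ^ 47 * (N * T) * (1 / 2 ^ k) := by
    have h0 : 0 ≤ 10 ^ 47 * (N * T) * ((1 : ℝ) / 2 ^ k) := by
      have : 0 ≤ N * T := by positivity
      exact mul_nonneg (mul_nonneg (by norm_num) this) (by norm_num)
    suffices H : (∑ z ∈ Z, |f (z + (0, 1)) - f z + fslope f g t Br j z|) ^ 2 ≤
        (10 ^ 47 * (N * T) * (1 / 2 ^ k)) ^ 2 from le_of_abs_le (abs_le_of_sq_le_sq H h0)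
    refine sq_sum_le_card_mul_sum_sq.trans ?_
    simp only [sq_abs]
    have h3 : (Z.card : ℝ) ≤ 10 ^ 42 * N ^ 2 / 4 ^ k := by
      refine hc.trans ?_
      gcongr
      norm_num
    calc _ ≤ (10 ^ 42 * N ^ 2 / 4 ^ k) * (10 ^ 52 * T ^ 2) :=
          mul_le_mul h3 (h1.trans (by have := h.sq S; gcongr))
            (Finset.sum_nonneg fun _ _ => sq_nonneg _) (by positivity)
      _ = _ := by
        have : (4 : ℝ) ^ k = (2 ^ k) ^ 2 := by rw [← pow_mul, mul_comm, pow_mul]; norm_num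
        rw [this]; field_simp
  have h4 : (Z.card : ℝ) * lam Λ J j ≤ 10 ^ 42 * (Λ * N ^ 2) * (1 / 2 ^ k) := by
    have e : (512 : ℝ) ^ k = 2 ^ (8 * k) * 2 ^ k := by rw [pow_mul, ← mul_pow]; norm_num
    calc _ ≤ (10 ^ 42 * N ^ 2 / 512 ^ k) * (Λ * 2 ^ (8 * k)) := by
          unfold lam; gcongr
      _ = _ := by rw [e]; field_simp
  rw [Finset.sum_add_distrib, ← Finset.mul_sum, Finset.sum_const, nsmul_eq_mul]
  linarith

theorem Slopes.sum_cost_le (hψ : Slopes f g t Br J Λ ψ) (h : Setup f g t Br N J Λ T)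
    {Z : Finset (ℤ × ℤ)} (hb : ∀ z ∈ Z, (0 ≤ z.1 ∧ z.1 < N) ∧ (0 ≤ z.2 ∧ z.2 < N)) :
    ∑ z ∈ Z, (|trunc (f (z + (0, 1))) - trunc (f z)| +
        field ψ J z * (trunc (f (z + (0, 1))) - trunc (f z))) ≤
      4 * 10 ^ 22 * Br.card + 10 ^ 48 * (N * T) + 10 ^ 43 * (Λ * N ^ 2) := by
  classical
  have hT := h.T_nonneg
  have hΛ := h.Λ_pos
  set c : ℤ × ℤ → ℝ := fun z => |trunc (f (z + (0, 1))) - trunc (f z)| +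
        field ψ J z * (trunc (f (z + (0, 1))) - trunc (f z)) with hc
  have hc4 : ∀ z, c z ≤ 4 := fun z => by
    have h1 := abs_le.1 (abs_trunc_le (f (z + (0, 1))))
    have h2 := abs_le.1 (abs_trunc_le (f z))
    have h3 : |trunc (f (z + (0, 1))) - trunc (f z)| ≤ 2 := abs_le.2 ⟨by linarith, by linarith⟩
    have h4 : |field ψ J z * (trunc (f (z + (0, 1))) - trunc (f z))| ≤ 1 * 2 := by
      rw [abs_mul]
      exact mul_le_mul (hψ.abs_field_le z) h3 (abs_nonneg _) zero_le_one
    have := le_abs_self (field ψ J z * (trunc (f (z + (0, 1))) - trunc (f z)))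
    simp only [hc]; linarith
  have hex : ∀ z, ∃ j ≤ J, Stop f g t Br J Λ j z ∧ ∀ i < j, ¬ Stop f g t Br J Λ i z := fun z => by
    have h0 : ∃ j, Stop f g t Br J Λ j z := ⟨J, Or.inl rfl⟩
    exact ⟨Nat.find h0, Nat.find_min' h0 (Or.inl rfl), Nat.find_spec h0, fun i hi =>
      Nat.find_min h0 hi⟩
  choose st h1 h2 h3 using hex
  rw [← Finset.sum_filter_add_sum_filter_not Z fun z => rho Br (thr J) 0 z ≠ 0]
  have hA : ∑ z ∈ Z.filter (fun z => rho Br (thr J) 0 z ≠ 0), c z ≤ 4 * 10 ^ 22 * Br.card := by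
    have := card_rho_zero_le (Br := Br) (thr_pos J 0).le
      (Z := Z.filter fun z => rho Br (thr J) 0 z ≠ 0) fun z hz => (Finset.mem_filter.1 hz).2
    calc _ ≤ ∑ z ∈ Z.filter (fun z => rho Br (thr J) 0 z ≠ 0), (4 : ℝ) :=
          Finset.sum_le_sum fun z _ => hc4 z
      _ ≤ _ := by rw [Finset.sum_const, nsmul_eq_mul]; linarith
  have hB : ∑ z ∈ Z.filter (fun z => ¬ rho Br (thr J) 0 z ≠ 0), c z ≤
      10 ^ 48 * (N * T) + 10 ^ 43 * (Λ * N ^ 2) := by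
    rw [← Finset.sum_fiberwise_of_maps_to (t := Finset.range (J + 1)) (g := st)
      fun z _ => Finset.mem_range.2 (by have := h1 z; omega)]
    calc _ ≤ ∑ j ∈ Finset.range (J + 1), (2 * 10 ^ 47 * (N * T) + 2 * 10 ^ 42 * (Λ * N ^ 2)) *
          ((1 : ℝ) / 2 ^ (J + 1 - 1 - j)) := ?_
      _ ≤ (2 * 10 ^ 47 * (N * T) + 2 * 10 ^ 42 * (Λ * N ^ 2)) * 2 := by
        rw [← Finset.mul_sum, Finset.sum_range_reflect (fun m => (1 : ℝ) / 2 ^ m)]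
        have := sum_half_pow_le (J + 1)
        gcongr
      _ ≤ _ := by
        have : 0 ≤ N * T := by positivity
        have : 0 ≤ Λ * N ^ 2 := by positivity
        linarith
    refine Finset.sum_le_sum fun j hj => ?_
    have hj : j ≤ J := by rw [Finset.mem_range] at hj; omega
    have key : ∀ z ∈ (Z.filter fun z => ¬ rho Br (thr J) 0 z ≠ 0).filter fun z => st z = j,
        z ∈ Z ∧ Stop f g t Br J Λ j z ∧ rho Br (thr J) j z = 0 ∧
          ∀ i < j, ¬ Stop f g t Br J Λ i z := by
      intro z hz
      rw [Finset.mem_filter, Finset.mem_filter, not_not] at hz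
      obtain ⟨⟨a, b⟩, rfl⟩ := hz
      refine ⟨a, h2 z, ?_, h3 z⟩
      rcases Nat.eq_zero_or_pos (st z) with e | e
      · rw [e, b]
      · have h4 := h3 z (st z - 1) (by omega)
        simp only [Stop, not_or, not_not] at h4
        rw [Nat.sub_add_cancel e] at h4
        exact h4.2.1
    rw [Nat.add_sub_cancel]
    refine le_trans (Finset.sum_le_sum fun z hz => ?_) (h.sum_stop_le hj
      (fun z hz => hb z (key z hz).1) (fun z hz => (key z hz).2.1) fun z hz => (key z hz).2.2.1)
    exact hψ.cost_le hΛ hj (key z hz).2.2.1 (key z hz).2.2.2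
  linarith

theorem Setup.sum_abs_trunc_sub_le (h : Setup f g t Br N J Λ T) :
    ∑ z ∈ Finset.Ico (0 : ℤ) N ×ˢ Finset.Ico (0 : ℤ) N,
        |trunc (f (z + (0, 1))) - trunc (f z)| ≤
      10 ^ 23 * Br.card + 10 ^ 49 * (N * T) + 10 ^ 43 * (Λ * N ^ 2) := by
  classical
  obtain ⟨ψ, hψ⟩ := exists_slopes f g t Br J Λ
  have hT := h.T_nonneg
  set S := Finset.Ico (0 : ℤ) N ×ˢ Finset.Ico (0 : ℤ) N with hS
  have h1 : ∑ z ∈ S, |trunc (f (z + (0, 1))) - trunc (f z)| ≤ 2 * N +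
      ∑ z ∈ S, |field ψ J (z.1, z.2 + 1) - field ψ J z| +
      ∑ z ∈ S, (|trunc (f (z + (0, 1))) - trunc (f z)| +
        field ψ J z * (trunc (f (z + (0, 1))) - trunc (f z))) := by
    rw [hS, Finset.sum_product, Finset.sum_product, Finset.sum_product]
    have h0 := fun i : ℤ => sum_abs_sub_le_of_steer (N := N) (h := fun y => trunc (f (i, y)))
      (φ := fun y => field ψ J (i, y)) (fun _ => abs_trunc_le _) (fun _ => hψ.abs_field_le _)
    refine (Finset.sum_le_sum fun i _ => by simpa using h0 i).trans (le_of_eq ?_)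
    rw [Finset.sum_add_distrib, Finset.sum_add_distrib, Finset.sum_const, Int.card_Ico,
      nsmul_eq_mul]
    simp [mul_comm]
  have h2 : ∑ z ∈ S, |field ψ J (z.1, z.2 + 1) - field ψ J z| ≤
      3 * Br.card + 10 ^ 43 * (N * T) := by
    rw [← Finset.sum_filter_add_sum_filter_not S fun z => z ∈ Br]
    have a := hψ.sum_field_le h (Y := S.filter fun z => z ∉ Br) fun z hz =>
      (Finset.mem_filter.1 hz).2
    have b : ∑ z ∈ S.filter (fun z => z ∈ Br), |field ψ J (z.1, z.2 + 1) - field ψ J z| ≤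
        2 * Br.card := by
      calc _ ≤ ∑ z ∈ S.filter (fun z => z ∈ Br), (2 : ℝ) := Finset.sum_le_sum fun z _ => by
            have c := abs_le.1 (hψ.abs_field_le (z.1, z.2 + 1))
            have d := abs_le.1 (hψ.abs_field_le z)
            exact abs_le.2 ⟨by linarith, by linarith⟩
        _ ≤ _ := by
          rw [Finset.sum_const, nsmul_eq_mul, mul_comm]
          gcongr
          exact fun z hz => (Finset.mem_filter.1 hz).2
    linarith
  have h3 := hψ.sum_cost_le h (Z := S) fun z hz => by
    simpa only [hS, Finset.mem_product, Finset.mem_Ico] using hz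
  have h4 : (N : ℝ) ≤ Br.card := by exact_mod_cast h.N_le
  have : 0 ≤ N * T := by positivity
  linarith

end Summation

section Rescaling

variable {f g t : ℤ × ℤ → ℝ} {Br : Finset (ℤ × ℤ)} {N : ℕ} {T : ℝ}

theorem Compat.mul_left (h : Compat f g t Br) {a : ℝ} (ha : 0 ≤ a) :
    Compat (fun z => a * f z) (fun z => a * g z) (fun z => a * t z) Br := by
  have key : ∀ x y s : ℝ, |x - y| ≤ s → |a * x - a * y| ≤ a * s := fun x y s hs => by
    rw [← mul_sub, abs_mul, abs_of_nonneg ha]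
    exact mul_le_mul_of_nonneg_left hs ha
  refine ⟨fun z => mul_nonneg ha (h.nonneg z), fun z hz => key _ _ _ (h.horiz z hz),
    fun z hz => key _ _ _ (h.vert z hz), fun z hz => ?_⟩
  have := key _ _ _ (h.diag z hz)
  simpa only [Pi.add_apply, mul_add] using this

theorem exists_scale {b N : ℕ} (hb : 0 < b) (h : b * 1024 ≤ N ^ 2) :
    ∃ J, (b : ℝ) * rad J ≤ N ^ 2 ∧ (N : ℝ) ^ 2 ≤ 1024 * (b * rad J) := by
  classical
  have e : ∀ j, rad j = ((1024 ^ (j + 1) : ℕ) : ℤ) := fun j => by unfold rad; push_cast; rfl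
  set P : ℕ → Prop := fun j => b * 1024 ^ (j + 1) ≤ N ^ 2
  have h0 : P 0 := by simpa [P] using h
  set J := Nat.findGreatest P (N ^ 2)
  have hJ : P J := Nat.findGreatest_spec (Nat.zero_le _) h0
  have hJ1 : ¬ P (J + 1) := fun h1 => by
    have h2 : J + 1 ≤ N ^ 2 := by
      have h3 : J + 1 + 1 < 1024 ^ (J + 1 + 1) := Nat.lt_pow_self (by norm_num)
      have h4 : 1 * 1024 ^ (J + 1 + 1) ≤ b * 1024 ^ (J + 1 + 1) := Nat.mul_le_mul_right _ hb
      have h5 : b * 1024 ^ (J + 1 + 1) ≤ N ^ 2 := h1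
      omega
    have := Nat.le_findGreatest h2 h1
    simp only [J] at *
    omega
  refine ⟨J, ?_, ?_⟩
  · rw [e]; exact_mod_cast hJ
  · rw [e]
    have h2 : N ^ 2 ≤ 1024 * (b * 1024 ^ (J + 1)) := by
      have h3 : N ^ 2 ≤ b * 1024 ^ (J + 1 + 1) := (not_le.1 hJ1).le
      rw [pow_succ _ (J + 1)] at h3
      linarith
    exact_mod_cast h2

theorem Compat.sum_abs_trunc_sub_le (hC : Compat f g t Br) (hN : 1 ≤ N) (hNb : N ≤ Br.card)
    (hs : ∀ z, t z ≠ 0 → (0 ≤ z.1 ∧ z.1 < N) ∧ (0 ≤ z.2 ∧ z.2 < N)) (hT : 0 ≤ T)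
    (ht : ∀ S : Finset (ℤ × ℤ), ∑ z ∈ S, t z ^ 2 ≤ T ^ 2) :
    ∑ z ∈ Finset.Ico (0 : ℤ) N ×ˢ Finset.Ico (0 : ℤ) N,
        |trunc (f (z + (0, 1))) - trunc (f z)| ≤ 10 ^ 50 * (Br.card + N * T) := by
  have hNT : 0 ≤ N * T := by positivity
  have hb0 : (0 : ℝ) ≤ Br.card := by positivity
  have hN' : (1 : ℝ) ≤ N := by exact_mod_cast hN
  rcases le_or_gt (Br.card * 1024) (N ^ 2) with hb | hb
  · obtain ⟨J, hJ1, hJ2⟩ := exists_scale (by omega) hb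
    have hr := rad_pos' J
    have h : Setup f g t Br N J (max (1 / rad J) (T / N)) T :=
      { compat := hC
        supp := hs
        sq := ht
        T_nonneg := hT
        N_pos := hN
        N_le := hNb
        rad_le := hJ1
        Λ_pos := lt_max_of_lt_left (by positivity)
        one_le := by
          have := mul_le_mul_of_nonneg_right (le_max_left (1 / (rad J : ℝ)) (T / N)) hr.le
          rwa [one_div_mul_cancel hr.ne'] at this
        T_le := by
          have := mul_le_mul_of_nonneg_right (le_max_right (1 / (rad J : ℝ)) (T / N))
            (zero_le_one.trans hN')
          rwa [div_mul_cancel₀ _ (by positivity)] at this }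
    have h1 := h.sum_abs_trunc_sub_le
    have h2 : max (1 / (rad J : ℝ)) (T / N) * N ^ 2 ≤ 1024 * Br.card + N * T := by
      have a : 1 / (rad J : ℝ) * N ^ 2 ≤ 1024 * Br.card := by
        rw [one_div_mul_eq_div, div_le_iff₀ hr]; linarith
      have b : T / N * N ^ 2 = N * T := by field_simp
      rcases max_choice (1 / (rad J : ℝ)) (T / N) with e | e <;> rw [e] <;> linarith
    linarith
  · have h1 : ∀ z, |trunc (f (z + (0, 1))) - trunc (f z)| ≤ 2 := fun z => by
      have h1 := abs_le.1 (abs_trunc_le (f (z + (0, 1))))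
      have h2 := abs_le.1 (abs_trunc_le (f z))
      exact abs_le.2 ⟨by linarith, by linarith⟩
    have h2 : (N : ℝ) ^ 2 ≤ Br.card * 1024 := by exact_mod_cast hb.le
    have h3 := card_le_of_mem_box (N := N) (S := Finset.Ico (0 : ℤ) N ×ˢ Finset.Ico (0 : ℤ) N)
      fun z hz => by simpa only [Finset.mem_product, Finset.mem_Ico] using hz
    calc _ ≤ ∑ z ∈ Finset.Ico (0 : ℤ) N ×ˢ Finset.Ico (0 : ℤ) N, (2 : ℝ) :=
          Finset.sum_le_sum fun z _ => h1 z
      _ ≤ _ := by rw [Finset.sum_const, nsmul_eq_mul]; linarith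

/-- The discrete gradient bound. -/
theorem Compat.sum_abs_sub_le (hC : Compat f g t Br) (hN : 1 ≤ N) (hNb : N ≤ Br.card)
    (hs : ∀ z, t z ≠ 0 → (0 ≤ z.1 ∧ z.1 < N) ∧ (0 ≤ z.2 ∧ z.2 < N)) (hT : 0 ≤ T)
    (ht : ∀ S : Finset (ℤ × ℤ), ∑ z ∈ S, t z ^ 2 ≤ T ^ 2) {M : ℝ} (hM : 0 < M)
    {S : Finset (ℤ × ℤ)} (hS : ∀ z ∈ S, ((0 ≤ z.1 ∧ z.1 < N) ∧ (0 ≤ z.2 ∧ z.2 < N)) ∧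
      |f z| ≤ M ∧ |f (z + (0, 1))| ≤ M) :
    ∑ z ∈ S, |f (z + (0, 1)) - f z| ≤ 10 ^ 50 * (M * Br.card + N * T) := by
  have h1 := (hC.mul_left (a := M⁻¹) (by positivity)).sum_abs_trunc_sub_le (T := M⁻¹ * T) hN hNb
    (fun z hz => hs z (right_ne_zero_of_mul hz)) (by positivity) fun S => by
      simp only [mul_pow]
      rw [← Finset.mul_sum]
      exact mul_le_mul_of_nonneg_left (ht S) (by positivity)
  have h2 : ∀ a : ℝ, |a| ≤ M → trunc (M⁻¹ * a) = M⁻¹ * a := fun a ha => by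
    apply trunc_of_abs_le
    rw [abs_mul, abs_of_pos (inv_pos.2 hM), inv_mul_le_iff₀ hM, mul_one]
    exact ha
  have h3 : ∑ z ∈ S, M⁻¹ * |f (z + (0, 1)) - f z| ≤
      ∑ z ∈ Finset.Ico (0 : ℤ) N ×ˢ Finset.Ico (0 : ℤ) N,
        |trunc (M⁻¹ * f (z + (0, 1))) - trunc (M⁻¹ * f z)| := by
    refine le_trans (Finset.sum_le_sum fun z hz => ?_) (Finset.sum_le_sum_of_subset_of_nonneg
      (fun z hz => ?_) fun _ _ _ => abs_nonneg _)
    · rw [h2 _ (hS z hz).2.1, h2 _ (hS z hz).2.2, ← mul_sub, abs_mul, abs_of_pos (inv_pos.2 hM)]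
    · simpa only [Finset.mem_product, Finset.mem_Ico] using (hS z hz).1
  rw [← Finset.mul_sum] at h3
  have h4 := h3.trans h1
  rw [inv_mul_le_iff₀ hM] at h4
  refine h4.trans (le_of_eq ?_)
  field_simp

end Rescaling

section Strain

variable {d : ℕ} {Ω : Set (Ed d)} {u : Ed d → Ed d}

/-- The strain of `u` along the direction `v`. -/
def strain (u : Ed d → Ed d) (v y : Ed d) : ℝ := inner ℝ v (fderiv ℝ u y v)

theorem measurable_strain (u : Ed d → Ed d) (v : Ed d) : Measurable (strain u v) :=
  (measurable_fderiv_apply_const ℝ u v).const_inner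

/-- Local Lipschitz continuity on an open set, at every point. -/
def LocLip (Ω : Set (Ed d)) (u : Ed d → Ed d) : Prop :=
  ∀ x ∈ Ω, ∃ t ∈ nhds x, ∃ L : ℝ≥0, LipschitzOnWith L u t

theorem LocLip.ae_differentiableAt (h : LocLip Ω u) :
    ∀ᵐ x, x ∈ Ω → DifferentiableAt ℝ u x := by
  rw [ae_iff]
  refine measure_null_of_locally_null _ fun x hx => ?_
  simp only [Classical.not_imp, Set.mem_ofPred_eq] at hx
  obtain ⟨t, ht, L, hL⟩ := h x hx.1
  refine ⟨_, Filter.inter_mem self_mem_nhdsWithin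
    (mem_nhdsWithin_of_mem_nhds (interior_mem_nhds.2 ht)), ?_⟩
  have h1 := (hL.mono interior_subset).ae_differentiableWithinAt_of_mem (μ := volume)
  rw [ae_iff] at h1
  refine measure_mono_null (fun y hy => ?_) h1
  simp only [Classical.not_imp, Set.mem_ofPred_eq, Set.mem_inter_iff] at hy ⊢
  exact ⟨hy.2, fun hc => hy.1.2 (hc.differentiableAt (isOpen_interior.mem_nhds hy.2))⟩

theorem LocLip.enorm_inner_sub_le (h : LocLip Ω u) {x v : Ed d} {ε : ℝ} (hε : 0 ≤ ε)
    (hx : ∀ s ∈ Icc 0 ε, x + s • v ∈ Ω)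
    (hd : ∀ᵐ s : ℝ, x + s • v ∈ Ω → DifferentiableAt ℝ u (x + s • v)) :
    ‖inner ℝ v (u (x + ε • v) - u x)‖ₑ ≤ ∫⁻ s in Icc 0 ε, ‖strain u v (x + s • v)‖ₑ := by
  set g : ℝ → ℝ := fun s => inner ℝ v (u (x + s • v)) with hg
  have hline : LipschitzWith ‖v‖₊ fun s : ℝ => x + s • v := by
    refine LipschitzWith.of_dist_le_mul fun a b => ?_
    rw [dist_add_left, dist_eq_norm, ← sub_smul, norm_smul, dist_eq_norm, mul_comm]
    rfl
  have hloc : LocallyLipschitzOn (Icc 0 ε) g := fun s hs => by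
    obtain ⟨t, ht, L, hL⟩ := h _ (hx s hs)
    refine ⟨‖v‖₊ * (L * ‖v‖₊), _, mem_nhdsWithin_of_mem_nhds
      (hline.continuous.continuousAt.preimage_mem_nhds ht), ?_⟩
    have h1 : LipschitzOnWith (L * ‖v‖₊) (fun s : ℝ => u (x + s • v))
      ((fun s : ℝ => x + s • v) ⁻¹' t) := hL.comp hline.lipschitzOnWith (fun _ hs => hs)
    refine LipschitzOnWith.of_dist_le_mul fun a ha b hb => ?_
    have h2 := h1.dist_le_mul a ha b hb
    simp only [hg]
    rw [dist_eq_norm, ← inner_sub_right, NNReal.coe_mul, mul_assoc]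
    refine (norm_inner_le_norm _ _).trans ?_
    rw [dist_eq_norm] at h2
    exact mul_le_mul_of_nonneg_left h2 (norm_nonneg _)
  obtain ⟨K, hK⟩ := hloc.exists_lipschitzOnWith_of_compact isCompact_Icc
  rw [← uIcc_of_le hε] at hK
  have h1 := hK.absolutelyContinuousOnInterval.integral_deriv_eq_sub
  have h2 : inner ℝ v (u (x + ε • v) - u x) = g ε - g 0 := by simp [hg, inner_sub_right]
  rw [h2, ← h1, intervalIntegral.integral_of_le hε]
  refine (enorm_integral_le_lintegral_enorm _).trans ?_
  refine le_trans (le_of_eq ?_) (lintegral_mono_set Ioc_subset_Icc_self)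
  refine lintegral_congr_ae ?_
  rw [Filter.EventuallyEq, ae_restrict_iff' measurableSet_Ioc]
  filter_upwards [hd] with s hs hs'
  have h3 := (hs (hx s ⟨hs'.1.le, hs'.2⟩)).hasFDerivAt
  have h4 : HasDerivAt (fun s : ℝ => x + s • v) v s := by
    simpa using ((hasDerivAt_id s).smul_const v).const_add x
  have h5 := h3.comp_hasDerivAt s h4
  have h6 : HasDerivAt g (inner ℝ v (fderiv ℝ u (x + s • v) v)) s := by
    simpa using (hasDerivAt_const s v).inner ℝ h5
  rw [h6.deriv]; rfl

theorem LocLip.ae_ae_differentiableAt (h : LocLip Ω u) (v : Ed d) :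
    ∀ᵐ x, ∀ᵐ s : ℝ, x + s • v ∈ Ω → DifferentiableAt ℝ u (x + s • v) := by
  have h1 : volume {x | x ∈ Ω ∧ ¬ DifferentiableAt ℝ u x} = 0 := by
    have := ae_iff.1 h.ae_differentiableAt
    simpa only [Classical.not_imp] using this
  obtain ⟨B, hB, hBm, hB0⟩ := exists_measurable_superset_of_null h1
  have h2 : ∀ᵐ x : Ed d, ∀ᵐ s : ℝ, x + s • v ∉ B := by
    rw [Measure.ae_ae_comm]
    · refine Filter.Eventually.of_forall fun s => ?_
      rw [ae_iff]
      simp only [not_not]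
      have := measure_preimage_add_right volume (s • v) B
      exact this.trans hB0
    · exact (hBm.preimage (by fun_prop : Measurable fun p : Ed d × ℝ => p.1 + p.2 • v)).compl
  filter_upwards [h2] with x hx
  filter_upwards [hx] with s hs hsΩ
  by_contra hc
  exact hs (hB ⟨hsΩ, hc⟩)

theorem sq_lintegral_le {α : Type*} [MeasurableSpace α] (μ : Measure α) {F : α → ℝ≥0∞}
    (hF : AEMeasurable F μ) : (∫⁻ s, F s ∂μ) ^ 2 ≤ μ univ * ∫⁻ s, F s ^ 2 ∂μ := by
  have := ENNReal.lintegral_mul_le_Lp_mul_Lq μ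
    (Real.HolderConjugate.two_two) (f := fun _ => 1) (g := F) aemeasurable_const hF
  simp only [Pi.mul_apply, one_mul, ENNReal.one_rpow, lintegral_const] at this
  refine (pow_le_pow_left' this 2).trans (le_of_eq ?_)
  simp only [mul_pow, ← ENNReal.rpow_natCast, ← ENNReal.rpow_mul]
  norm_num

theorem LocLip.lintegral_sq_le (h : LocLip Ω u) (hΩ : IsOpen Ω) {v : Ed d} {ε : ℝ} (hε : 0 ≤ ε)
    {G : Set (Ed d)} (hGm : MeasurableSet G) (hG : ∀ x ∈ G, ∀ s ∈ Icc 0 ε, x + s • v ∈ Ω) :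
    ∫⁻ x in G, ‖inner ℝ v (u (x + ε • v) - u x)‖ₑ ^ 2 ≤
      ENNReal.ofReal ε ^ 2 * ∫⁻ y in Ω, ‖strain u v y‖ₑ ^ 2 := by
  set F : Ed d → ℝ≥0∞ := Ω.indicator fun y => ‖strain u v y‖ₑ ^ 2 with hF
  have hFm : Measurable F := (((measurable_strain u v).enorm).pow_const 2).indicator hΩ.measurableSet
  calc _ ≤ ∫⁻ x in G, ENNReal.ofReal ε * ∫⁻ s in Icc 0 ε, F (x + s • v) := by
        refine lintegral_mono_ae ?_
        rw [ae_restrict_iff' hGm]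
        filter_upwards [h.ae_ae_differentiableAt v] with x hx hxG
        have h1 := h.enorm_inner_sub_le hε (hG x hxG) hx
        calc _ ≤ (∫⁻ s in Icc 0 ε, ‖strain u v (x + s • v)‖ₑ) ^ 2 := by gcongr
          _ ≤ _ := sq_lintegral_le _ ((measurable_strain u v).comp
            (by fun_prop : Measurable fun s : ℝ => x + s • v)).enorm.aemeasurable
          _ = _ := by
            rw [Measure.restrict_apply_univ, Real.volume_Icc, sub_zero]
            congr 1
            refine setLIntegral_congr_fun measurableSet_Icc fun s hs => ?_
            simp only [hF]
            rw [indicator_of_mem (hG x hxG s hs)]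
    _ ≤ ENNReal.ofReal ε * ∫⁻ x, ∫⁻ s in Icc 0 ε, F (x + s • v) := by
        rw [lintegral_const_mul' _ _ ENNReal.ofReal_ne_top]
        gcongr
        exact Measure.restrict_le_self
    _ = ENNReal.ofReal ε * ∫⁻ s in Icc 0 ε, ∫⁻ x, F (x + s • v) := by
        rw [lintegral_lintegral_swap]
        exact (hFm.comp (by fun_prop : Measurable fun p : Ed d × ℝ => p.1 + p.2 • v)).aemeasurable
    _ = _ := by
        simp only [lintegral_add_right_eq_self F]
        rw [setLIntegral_const, Real.volume_Icc, sub_zero, hF, lintegral_indicator hΩ.measurableSet]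
        ring

end Strain

section Cover

variable {d : ℕ}

/-- Points whose segment of length `ε` in direction `v` hits `S`. -/
def sweep (S : Set (Ed d)) (v : Ed d) (ε : ℝ) : Set (Ed d) := {x | ∃ s ∈ Icc 0 ε, x + s • v ∈ S}

theorem sweep_iUnion {ι : Type*} (S : ι → Set (Ed d)) (v : Ed d) (ε : ℝ) :
    sweep (⋃ n, S n) v ε = ⋃ n, sweep (S n) v ε := by
  ext x
  simp only [sweep, Set.mem_ofPred_eq, mem_iUnion]
  exact ⟨fun ⟨s, hs, n, hn⟩ => ⟨n, s, hs, hn⟩, fun ⟨n, s, hs, hn⟩ => ⟨s, hs, n, hn⟩⟩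

theorem sweep_mono {S T : Set (Ed d)} (h : S ⊆ T) (v : Ed d) (ε : ℝ) :
    sweep S v ε ⊆ sweep T v ε := fun _ ⟨s, hs, hx⟩ => ⟨s, hs, h hx⟩

theorem subset_sweep {S : Set (Ed d)} (v : Ed d) {ε : ℝ} (hε : 0 ≤ ε) : S ⊆ sweep S v ε :=
  fun x hx => ⟨0, ⟨le_rfl, hε⟩, by simpa using hx⟩

theorem isClosed_sweep {S : Set (Ed d)} (hS : IsClosed S) (v : Ed d) (ε : ℝ) :
    IsClosed (sweep S v ε) := by
  have hc : IsCompact ((fun s : ℝ => -(s • v)) '' Icc 0 ε) :=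
    isCompact_Icc.image (by fun_prop)
  convert hS.add_right_of_isCompact hc using 1
  ext x
  constructor
  · rintro ⟨s, hs, hx⟩
    exact ⟨x + s • v, hx, _, ⟨s, hs, rfl⟩, by simp⟩
  · rintro ⟨y, hy, _, ⟨s, hs, rfl⟩, rfl⟩
    exact ⟨s, hs, by simpa using hy⟩

theorem volume_sweep_closedBall_le (c : Ed d) {v : Ed d} (hv : ‖v‖ ≤ 2) {ε ρ : ℝ} (hε : 0 ≤ ε)
    (hρ : 0 < ρ) : volume (sweep (Metric.closedBall c ρ) v ε) ≤
      ENNReal.ofReal ((ε / ρ + 1) * (3 * ρ) ^ d) * volume (Metric.ball (0 : Ed d) 1) := by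
  have hsub : sweep (Metric.closedBall c ρ) v ε ⊆ ⋃ m ∈ Finset.range (⌊ε / ρ⌋₊ + 1),
      Metric.closedBall (c - ((m : ℝ) * ρ) • v) (3 * ρ) := by
    rintro x ⟨s, hs, hx⟩
    simp only [mem_iUnion, Finset.mem_range, Nat.lt_succ_iff]
    refine ⟨⌊s / ρ⌋₊, Nat.floor_mono (by have := hs.2; gcongr), ?_⟩
    rw [Metric.mem_closedBall, dist_eq_norm] at hx ⊢
    have h0 : 0 ≤ s / ρ := div_nonneg hs.1 hρ.le
    have h1 := Nat.floor_le h0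
    have h2 := (Nat.lt_floor_add_one (s / ρ)).le
    rw [le_div_iff₀ hρ] at h1
    rw [div_le_iff₀ hρ] at h2
    set m := ⌊s / ρ⌋₊
    have h3 : x - (c - ((m : ℝ) * ρ) • v) = (x + s • v - c) - (s - m * ρ) • v := by
      rw [sub_smul]; abel
    rw [h3]
    refine (norm_sub_le _ _).trans ?_
    rw [norm_smul, Real.norm_of_nonneg (by linarith)]
    have h4 : (s - m * ρ) * ‖v‖ ≤ ρ * 2 := by
      apply mul_le_mul _ hv (norm_nonneg _) hρ.le
      linarith
    linarith
  refine (measure_mono hsub).trans ((measure_biUnion_finset_le _ _).trans ?_)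
  have h3 : ∀ m : ℕ, volume (Metric.closedBall (c - ((m : ℝ) * ρ) • v) (3 * ρ)) =
      ENNReal.ofReal ((3 * ρ) ^ d) * volume (Metric.ball (0 : Ed d) 1) := fun m => by
    rw [Measure.addHaar_closedBall volume _ (by positivity), finrank_euclideanSpace_fin]
  simp only [h3, Finset.sum_const, Finset.card_range, nsmul_eq_mul]
  rw [ENNReal.ofReal_mul (by positivity), mul_assoc]
  gcongr
  rw [← ENNReal.ofReal_natCast]
  apply ENNReal.ofReal_le_ofReal
  push_cast
  have := Nat.floor_le (div_nonneg hε hρ.le)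
  linarith

theorem volume_sweep_le_of_ediam_le (hd : 2 ≤ d) {S : Set (Ed d)} (hS : S.Nonempty) {v : Ed d}
    (hv : ‖v‖ ≤ 2) {ε : ℝ} (hε : 0 ≤ ε) (hSε : Metric.ediam S ≤ ENNReal.ofReal ε) :
    volume (sweep S v ε) ≤ ENNReal.ofReal (2 * 3 ^ d * ε) * volume (Metric.ball (0 : Ed d) 1) *
      Metric.ediam S ^ ((d : ℝ) - 1) := by
  have hfin : Metric.ediam S ≠ ⊤ := ne_top_of_le_ne_top ENNReal.ofReal_ne_top hSε
  set δ := (Metric.ediam S).toReal with hδ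
  have hδ0 : 0 ≤ δ := ENNReal.toReal_nonneg
  have hδε : δ ≤ ε := ENNReal.toReal_le_of_le_ofReal hε hSε
  have he : Metric.ediam S = ENNReal.ofReal δ := (ENNReal.ofReal_toReal hfin).symm
  obtain ⟨c, hc⟩ := hS
  have h1 : ∀ ρ > δ, volume (sweep S v ε) ≤
      ENNReal.ofReal (3 ^ d * ((ε + ρ) * ρ ^ (d - 1))) * volume (Metric.ball (0 : Ed d) 1) := by
    intro ρ hρ
    have hρ0 : 0 < ρ := hδ0.trans_lt hρ
    have hsub : S ⊆ Metric.closedBall c ρ := fun x hx => by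
      rw [Metric.mem_closedBall, dist_edist]
      exact (ENNReal.toReal_mono hfin (Metric.edist_le_ediam_of_mem hx hc)).trans hρ.le
    refine (measure_mono (sweep_mono hsub v ε)).trans
      ((volume_sweep_closedBall_le c hv hε hρ0).trans (le_of_eq ?_))
    congr 2
    obtain ⟨k, rfl⟩ : ∃ k, d = k + 1 := ⟨d - 1, by omega⟩
    simp only [Nat.add_sub_cancel]
    field_simp
    ring
  have h2 : Filter.Tendsto (fun ρ : ℝ => ENNReal.ofReal (3 ^ d * ((ε + ρ) * ρ ^ (d - 1))) *
      volume (Metric.ball (0 : Ed d) 1)) (nhdsWithin δ (Ioi δ))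
      (nhds (ENNReal.ofReal (3 ^ d * ((ε + δ) * δ ^ (d - 1))) *
        volume (Metric.ball (0 : Ed d) 1))) := by
    refine ENNReal.Tendsto.mul_const ?_ (Or.inr measure_ball_lt_top.ne)
    refine ENNReal.tendsto_ofReal (Filter.Tendsto.mono_left ?_ nhdsWithin_le_nhds)
    exact (by fun_prop : Continuous fun ρ : ℝ => 3 ^ d * ((ε + ρ) * ρ ^ (d - 1))).tendsto δ
  refine (ge_of_tendsto h2 (by filter_upwards [self_mem_nhdsWithin] with ρ hρ using h1 ρ hρ)).trans ?_
  have h3 : Metric.ediam S ^ ((d : ℝ) - 1) = ENNReal.ofReal (δ ^ (d - 1)) := by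
    rw [he, ENNReal.ofReal_pow hδ0, ← ENNReal.rpow_natCast, Nat.cast_sub (by omega)]
    simp
  rw [h3, mul_right_comm, ← ENNReal.ofReal_mul (by positivity)]
  have h4 : 3 ^ d * ((ε + δ) * δ ^ (d - 1)) ≤ 2 * 3 ^ d * ε * δ ^ (d - 1) := calc
    _ ≤ 3 ^ d * ((ε + ε) * δ ^ (d - 1)) := by gcongr
    _ = _ := by ring
  have h5 := ENNReal.ofReal_le_ofReal h4
  gcongr

theorem volume_sweep_le (hd : 2 ≤ d) {S : Set (Ed d)} (hS : μH[(d : ℝ) - 1] S ≠ ⊤) {v : Ed d}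
    (hv : ‖v‖ ≤ 2) {ε : ℝ} (hε : 0 < ε) :
    volume (sweep S v ε) ≤ ENNReal.ofReal (2 * 3 ^ d * ε) * volume (Metric.ball (0 : Ed d) 1) *
      (μH[(d : ℝ) - 1] S + 1) := by
  have h1 : (⨅ (t : ℕ → Set (Ed d)) (_ : S ⊆ ⋃ n, t n) (_ : ∀ n, Metric.ediam (t n) ≤ ENNReal.ofReal ε),
      ∑' n, ⨆ _ : (t n).Nonempty, Metric.ediam (t n) ^ ((d : ℝ) - 1)) < μH[(d : ℝ) - 1] S + 1 := by
    refine lt_of_le_of_lt ?_ (ENNReal.lt_add_right hS one_ne_zero)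
    rw [Measure.hausdorffMeasure_apply]
    exact le_iSup₂_of_le (ENNReal.ofReal ε) (ENNReal.ofReal_pos.2 hε) le_rfl
  simp only [iInf_lt_iff] at h1
  obtain ⟨t, ht, hte, hts⟩ := h1
  calc volume (sweep S v ε) ≤ volume (⋃ n, sweep (t n) v ε) := by
        rw [← sweep_iUnion]; exact measure_mono (sweep_mono ht v ε)
    _ ≤ ∑' n, volume (sweep (t n) v ε) := measure_iUnion_le _
    _ ≤ ∑' n, ENNReal.ofReal (2 * 3 ^ d * ε) * volume (Metric.ball (0 : Ed d) 1) *
          ⨆ _ : (t n).Nonempty, Metric.ediam (t n) ^ ((d : ℝ) - 1) := by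
        refine ENNReal.tsum_le_tsum fun n => ?_
        rcases (t n).eq_empty_or_nonempty with h | h
        · have : sweep (t n) v ε = ∅ := by
            rw [h, Set.eq_empty_iff_forall_notMem]; rintro x ⟨s, -, hx⟩; exact hx
          rw [this, measure_empty]; exact zero_le
        · rw [iSup_pos h]
          exact volume_sweep_le_of_ediam_le hd h hv hε.le (hte n)
    _ ≤ _ := by
        rw [ENNReal.tsum_mul_left]
        gcongr

theorem volume_eq_zero_of_hausdorffMeasure_ne_top (hd : 2 ≤ d) {S : Set (Ed d)}
    (hS : μH[(d : ℝ) - 1] S ≠ ⊤) : volume S = 0 := by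
  have h2 : Filter.Tendsto (fun ε : ℝ => ENNReal.ofReal (2 * 3 ^ d * ε) *
      volume (Metric.ball (0 : Ed d) 1) * (μH[(d : ℝ) - 1] S + 1)) (nhdsWithin 0 (Ioi 0))
      (nhds (ENNReal.ofReal (2 * 3 ^ d * 0) * volume (Metric.ball (0 : Ed d) 1) *
        (μH[(d : ℝ) - 1] S + 1))) := by
    simp only [mul_assoc _ (volume (Metric.ball (0 : Ed d) 1))]
    refine ENNReal.Tendsto.mul_const ?_ (Or.inr (ENNReal.mul_ne_top measure_ball_lt_top.ne
      (ENNReal.add_ne_top.2 ⟨hS, ENNReal.one_ne_top⟩)))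
    refine ENNReal.tendsto_ofReal (Filter.Tendsto.mono_left ?_ nhdsWithin_le_nhds)
    exact (by fun_prop : Continuous fun ρ : ℝ => 2 * 3 ^ d * ρ).tendsto 0
  have h3 := ge_of_tendsto h2 (b := volume S) (by
    filter_upwards [self_mem_nhdsWithin] with ε hε
    exact (measure_mono (subset_sweep 0 (le_of_lt hε))).trans
      (volume_sweep_le hd hS (v := 0) (by simp) hε))
  simpa using h3

end Cover

section Tiling

variable {d : ℕ} {a : Ed d} {l ε : ℝ} {i j : Fin d} {N : ℕ}

/-- The `k`-th coordinate vector. -/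
abbrev dirVec (k : Fin d) : Ed d := EuclideanSpace.single k 1

/-- The lattice vector of index `z` in the coordinate plane of `i` and `j`. -/
def latticeVec (i j : Fin d) (ε : ℝ) (z : ℤ × ℤ) : Ed d :=
  (ε * z.1) • dirVec i + (ε * z.2) • dirVec j

theorem latticeVec_add (z w : ℤ × ℤ) :
    latticeVec i j ε (z + w) = latticeVec i j ε z + latticeVec i j ε w := by
  simp only [latticeVec, Prod.fst_add, Prod.snd_add, Int.cast_add, mul_add, add_smul]
  abel

theorem latticeVec_apply_fst (hij : i ≠ j) (z : ℤ × ℤ) : latticeVec i j ε z i = ε * z.1 := by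
  simp [latticeVec, hij]

theorem latticeVec_apply_snd (hij : i ≠ j) (z : ℤ × ℤ) : latticeVec i j ε z j = ε * z.2 := by
  simp [latticeVec, hij.symm]

theorem latticeVec_apply_of_ne {k : Fin d} (hi : k ≠ i) (hj : k ≠ j) (z : ℤ × ℤ) :
    latticeVec i j ε z k = 0 := by
  simp [latticeVec, hi, hj]

/-- The tile with cross-section of sidelength `ε` in the plane of `i` and `j`. -/
def tile (a : Ed d) (l ε : ℝ) (i j : Fin d) : Set (Ed d) :=
  {x | x i ∈ Ico (a i) (a i + ε) ∧ x j ∈ Ico (a j) (a j + ε) ∧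
    ∀ k, k ≠ i → k ≠ j → x k ∈ Ioo (a k) (a k + l)}

theorem measurableSet_tile : MeasurableSet (tile a l ε i j) := by
  have h : ∀ k : Fin d, Measurable fun x : Ed d => x k := fun k => by fun_prop
  refine (h i measurableSet_Ico).inter ((h j measurableSet_Ico).inter ?_)
  have : {x : Ed d | ∀ k, k ≠ i → k ≠ j → x k ∈ Ioo (a k) (a k + l)} =
      ⋂ k, ⋂ (_ : k ≠ i), ⋂ (_ : k ≠ j), (fun x : Ed d => x k) ⁻¹' Ioo (a k) (a k + l) := by
    ext x; simp
  change MeasurableSet {x : Ed d | ∀ k, k ≠ i → k ≠ j → x k ∈ Ioo (a k) (a k + l)}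
  rw [this]
  exact .iInter fun k => .iInter fun _ => .iInter fun _ => h k measurableSet_Ioo

theorem eq_floor_of_sub_mem_tile (hij : i ≠ j) (hε : 0 < ε) {x : Ed d} {z : ℤ × ℤ}
    (h : x - latticeVec i j ε z ∈ tile a l ε i j) :
    z = (⌊(x i - a i) / ε⌋, ⌊(x j - a j) / ε⌋) := by
  obtain ⟨h1, h2, -⟩ := h
  rw [PiLp.sub_apply, latticeVec_apply_fst hij] at h1
  rw [PiLp.sub_apply, latticeVec_apply_snd hij] at h2
  refine Prod.ext ?_ ?_ <;> symm <;> rw [Int.floor_eq_iff]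
  · exact ⟨(le_div_iff₀ hε).2 (by linarith [h1.1]), (div_lt_iff₀ hε).2 (by linarith [h1.2])⟩
  · exact ⟨(le_div_iff₀ hε).2 (by linarith [h2.1]), (div_lt_iff₀ hε).2 (by linarith [h2.2])⟩

/-- The index square of sidelength `N`. -/
abbrev indexBox (N : ℕ) : Finset (ℤ × ℤ) := Finset.Ico (0 : ℤ) N ×ˢ Finset.Ico (0 : ℤ) N

theorem exists_sub_mem_tile (hij : i ≠ j) (hε : 0 < ε) (hN : N * ε = l) {x : Ed d}
    (hx : x ∈ cube a l) : ∃ z ∈ indexBox N, x - latticeVec i j ε z ∈ tile a l ε i j := by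
  refine ⟨(⌊(x i - a i) / ε⌋, ⌊(x j - a j) / ε⌋), ?_, ?_, ?_, fun k hi hj => ?_⟩
  · simp only [Finset.mem_product, Finset.mem_Ico, Int.floor_nonneg, Int.floor_lt]
    refine ⟨⟨?_, ?_⟩, ?_, ?_⟩
    · exact div_nonneg (by linarith [(hx i).1]) hε.le
    · rw [div_lt_iff₀ hε]; push_cast; linarith [(hx i).2]
    · exact div_nonneg (by linarith [(hx j).1]) hε.le
    · rw [div_lt_iff₀ hε]; push_cast; linarith [(hx j).2]
  · rw [PiLp.sub_apply, latticeVec_apply_fst hij]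
    have h1 := Int.floor_le ((x i - a i) / ε)
    have h2 := Int.lt_floor_add_one ((x i - a i) / ε)
    rw [le_div_iff₀ hε] at h1
    rw [div_lt_iff₀ hε] at h2
    constructor <;> linarith
  · rw [PiLp.sub_apply, latticeVec_apply_snd hij]
    have h1 := Int.floor_le ((x j - a j) / ε)
    have h2 := Int.lt_floor_add_one ((x j - a j) / ε)
    rw [le_div_iff₀ hε] at h1
    rw [div_lt_iff₀ hε] at h2
    constructor <;> linarith
  · rw [PiLp.sub_apply, latticeVec_apply_of_ne hi hj, sub_zero]
    exact hx k

theorem sum_lintegral_tile_eq (S : Finset (ℤ × ℤ)) {F : Ed d → ℝ≥0∞} (hF : Measurable F) :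
    ∑ z ∈ S, ∫⁻ x in tile a l ε i j, F (x + latticeVec i j ε z) =
      ∫⁻ x, (∑ z ∈ S, (tile a l ε i j).indicator 1 (x - latticeVec i j ε z)) * F x := by
  have h1 : Measurable ((tile a l ε i j).indicator (1 : Ed d → ℝ≥0∞)) :=
    measurable_one.indicator measurableSet_tile
  simp only [Finset.sum_mul]
  rw [lintegral_finsetSum S fun z _ => show Measurable fun x =>
    (tile a l ε i j).indicator 1 (x - latticeVec i j ε z) * F x from
      (h1.comp (measurable_sub_const (latticeVec i j ε z))).mul hF]
  refine Finset.sum_congr rfl fun z _ => ?_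
  rw [← lintegral_indicator measurableSet_tile,
    ← lintegral_add_right_eq_self
      (fun x => (tile a l ε i j).indicator 1 (x - latticeVec i j ε z) * F x) (latticeVec i j ε z)]
  refine lintegral_congr fun x => ?_
  simp only [add_sub_cancel_right]
  by_cases hx : x ∈ tile a l ε i j <;> simp [hx]

theorem sum_lintegral_tile_le (hij : i ≠ j) (hε : 0 < ε) (S : Finset (ℤ × ℤ)) {F : Ed d → ℝ≥0∞}
    (hF : Measurable F) :
    ∑ z ∈ S, ∫⁻ x in tile a l ε i j, F (x + latticeVec i j ε z) ≤ ∫⁻ x, F x := by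
  rw [sum_lintegral_tile_eq S hF]
  refine lintegral_mono fun x => ?_
  refine mul_le_of_le_one_left' ?_
  calc ∑ z ∈ S, (tile a l ε i j).indicator (1 : Ed d → ℝ≥0∞) (x - latticeVec i j ε z)
    _ ≤ ∑ z ∈ S, if z = (⌊(x i - a i) / ε⌋, ⌊(x j - a j) / ε⌋) then (1 : ℝ≥0∞) else 0 := by
        refine Finset.sum_le_sum fun z _ => ?_
        by_cases h : x - latticeVec i j ε z ∈ tile a l ε i j
        · rw [if_pos (eq_floor_of_sub_mem_tile hij hε h), indicator_of_mem h, Pi.one_apply]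
        · simp [h]
    _ ≤ 1 := by
        rw [Finset.sum_ite_eq']
        split_ifs <;> simp

theorem setLIntegral_cube_le_sum (hij : i ≠ j) (hε : 0 < ε) (hN : N * ε = l) {F : Ed d → ℝ≥0∞}
    (hF : Measurable F) : ∫⁻ x in cube a l, F x ≤
      ∑ z ∈ indexBox N, ∫⁻ x in tile a l ε i j, F (x + latticeVec i j ε z) := by
  rw [sum_lintegral_tile_eq _ hF]
  refine le_trans (setLIntegral_mono_ae ?_ (Filter.Eventually.of_forall fun x hx => ?_))
    (setLIntegral_le_lintegral (cube a l) _)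
  · have h1 : Measurable ((tile a l ε i j).indicator (1 : Ed d → ℝ≥0∞)) :=
      measurable_one.indicator measurableSet_tile
    exact ((Finset.measurable_fun_sum _ fun z _ =>
      h1.comp (measurable_sub_const (latticeVec i j ε z))).mul hF).aemeasurable
  · obtain ⟨z, hz, hxz⟩ := exists_sub_mem_tile hij hε hN hx
    refine le_mul_of_one_le_left' ?_
    refine le_trans ?_ (Finset.single_le_sum (fun _ _ => zero_le) hz)
    rw [indicator_of_mem hxz]; rfl

/-- The closed cube with corner `a` and sidelength `l`. -/
def closedCube (a : Ed d) (l : ℝ) : Set (Ed d) := {x | ∀ k, x k ∈ Icc (a k) (a k + l)}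

theorem isOpen_cube (a : Ed d) (l : ℝ) : IsOpen (cube a l) := by
  simp only [cube, Set.ofPred_forall]
  exact isOpen_iInter_of_finite fun k =>
    isOpen_Ioo.preimage (by fun_prop : Continuous fun x : Ed d => x k)

theorem isClosed_closedCube (a : Ed d) (l : ℝ) : IsClosed (closedCube a l) := by
  simp only [closedCube, Set.ofPred_forall]
  exact isClosed_iInter fun k =>
    isClosed_Icc.preimage (by fun_prop : Continuous fun x : Ed d => x k)

theorem cube_subset_closedCube (a : Ed d) (l : ℝ) : cube a l ⊆ closedCube a l :=
  fun _ hx k => Ioo_subset_Icc_self (hx k)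

theorem volume_closedCube_lt_top (a : Ed d) (l : ℝ) : volume (closedCube a l) < ⊤ := by
  have h : closedCube a l = (EuclideanSpace.equiv (Fin d) ℝ).toHomeomorph ⁻¹'
      (Set.univ.pi fun k => Icc (a k) (a k + l)) := by
    ext x
    simp only [closedCube, Set.mem_ofPred_eq, mem_preimage, Set.mem_univ_pi]
    rfl
  rw [h]
  exact ((Homeomorph.isCompact_preimage _).2
    (isCompact_univ_pi fun k => isCompact_Icc)).measure_lt_top

theorem sq_mul_volume_tile_le (hij : i ≠ j) (hε : 0 < ε) (hN : N * ε = l) :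
    (N : ℝ≥0∞) ^ 2 * volume (tile a l ε i j) ≤ volume (closedCube a l) := by
  have hm : MeasurableSet (closedCube a l) := (isClosed_closedCube a l).measurableSet
  have h := sum_lintegral_tile_le (a := a) (l := l) hij hε (indexBox N)
    (F := (closedCube a l).indicator 1) (measurable_one.indicator hm)
  rw [lintegral_indicator_one hm] at h
  refine le_trans (le_of_eq ?_) h
  have h2 : ∀ z ∈ indexBox N, ∫⁻ x in tile a l ε i j,
      (closedCube a l).indicator (1 : Ed d → ℝ≥0∞) (x + latticeVec i j ε z) =
        volume (tile a l ε i j) := fun z hz => by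
    rw [← setLIntegral_one]
    refine setLIntegral_congr_fun measurableSet_tile fun x hx => ?_
    refine indicator_of_mem (fun k => ?_) _
    simp only [Finset.mem_product, Finset.mem_Ico] at hz
    have e1 : (0 : ℝ) ≤ z.1 := by exact_mod_cast hz.1.1
    have e2 : (0 : ℝ) ≤ z.2 := by exact_mod_cast hz.2.1
    have e3 : (z.1 : ℝ) + 1 ≤ N := by exact_mod_cast hz.1.2
    have e4 : (z.2 : ℝ) + 1 ≤ N := by exact_mod_cast hz.2.2
    rw [PiLp.add_apply]
    by_cases hi : k = i
    · subst hi
      rw [latticeVec_apply_fst hij]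
      constructor <;> nlinarith [hx.1.1, hx.1.2]
    · by_cases hj : k = j
      · subst hj
        rw [latticeVec_apply_snd hij]
        constructor <;> nlinarith [hx.2.1.1, hx.2.1.2]
      · rw [latticeVec_apply_of_ne hi hj, add_zero]
        exact Ioo_subset_Icc_self (hx.2.2 k hi hj)
  rw [Finset.sum_congr rfl h2, Finset.sum_const, nsmul_eq_mul]
  simp [sq]

end Tiling

section Increments

variable {d : ℕ} {a : Ed d} {l ε : ℝ} {i j : Fin d} {N : ℕ} {Ω : Set (Ed d)} {u : Ed d → Ed d}

/-- The three directions in the coordinate plane of `i` and `j` whose strains are controlled. -/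
def planeDir (i j : Fin d) : Fin 3 → Ed d := ![dirVec i, dirVec j, dirVec i + dirVec j]

theorem norm_planeDir_le (i j : Fin d) (n : Fin 3) : ‖planeDir i j n‖ ≤ 2 := by
  fin_cases n
  · simp [planeDir]
  · simp [planeDir]
  · refine (norm_add_le _ _).trans ?_
    simp; norm_num

theorem planeDir_apply_mem (hij : i ≠ j) (n : Fin 3) {k : Fin d} :
    0 ≤ planeDir i j n k ∧ planeDir i j n k ≤ 1 ∧ (k ≠ i → k ≠ j → planeDir i j n k = 0) := by
  fin_cases n
  · by_cases h : k = i <;> simp [planeDir, h]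
  · by_cases h : k = j <;> simp [planeDir, h]
  · by_cases h : k = i
    · subst h; simp [planeDir, hij]
    · by_cases h' : k = j
      · subst h'; simp [planeDir, h]
      · simp [planeDir, h, h']

theorem abs_apply_le_matNormD (A : Matrix (Fin d) (Fin d) ℝ) (i j : Fin d) :
    |A i j| ≤ matNormD A := by
  refine Real.abs_le_sqrt ?_
  refine le_trans ?_ (Finset.single_le_sum (f := fun i => ∑ j, A i j ^ 2)
    (fun _ _ => Finset.sum_nonneg fun _ _ => sq_nonneg _) (Finset.mem_univ i))
  exact Finset.single_le_sum (f := fun j => A i j ^ 2) (fun _ _ => sq_nonneg _) (Finset.mem_univ j)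

theorem matNormD_nonneg (A : Matrix (Fin d) (Fin d) ℝ) : 0 ≤ matNormD A := Real.sqrt_nonneg _

theorem inner_dirVec (k : Fin d) (x : Ed d) : inner ℝ (dirVec k) x = x k := by
  simp [EuclideanSpace.inner_single_left]

theorem abs_strain_planeDir_le (u : Ed d → Ed d) (y : Ed d) (n : Fin 3) :
    |strain u (planeDir i j n) y| ≤ 4 * matNormD (symGradD u y) := by
  have h0 := matNormD_nonneg (symGradD u y)
  have h1 := abs_apply_le_matNormD (symGradD u y) i i
  have h2 := abs_apply_le_matNormD (symGradD u y) j j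
  have h3 := abs_apply_le_matNormD (symGradD u y) i j
  fin_cases n
  · have : strain u (planeDir i j 0) y = symGradD u y i i := by
      change inner ℝ (dirVec i) (fderiv ℝ u y (dirVec i)) = _
      rw [inner_dirVec]; simp [symGradD, mgradD]
    simp only [Fin.zero_eta, this]
    linarith
  · have : strain u (planeDir i j 1) y = symGradD u y j j := by
      change inner ℝ (dirVec j) (fderiv ℝ u y (dirVec j)) = _
      rw [inner_dirVec]; simp [symGradD, mgradD]
    simp only [Fin.mk_one, this]
    linarith
  · have : strain u (planeDir i j 2) y =
        symGradD u y i i + symGradD u y j j + 2 * symGradD u y i j := by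
      change inner ℝ (dirVec i + dirVec j) (fderiv ℝ u y (dirVec i + dirVec j)) = _
      rw [inner_add_left, inner_dirVec, inner_dirVec, map_add]
      simp only [PiLp.add_apply, symGradD, mgradD]
      ring
    simp only [Fin.reduceFinMk, this]
    refine (abs_add_three _ _ _).trans ?_
    rw [abs_mul, abs_two]
    linarith

/-- Points whose three segments of length `ε` remain in `Ω`. -/
def goodSet (Ω : Set (Ed d)) (i j : Fin d) (ε : ℝ) : Set (Ed d) :=
  {x | ∀ n, ∀ s ∈ Icc 0 ε, x + s • planeDir i j n ∈ Ω}

theorem measurableSet_goodSet (hΩ : IsOpen Ω) : MeasurableSet (goodSet Ω i j ε) := by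
  have : goodSet Ω i j ε = ⋂ n, (sweep Ωᶜ (planeDir i j n) ε)ᶜ := by
    ext x; simp [goodSet, sweep]
  rw [this]
  exact .iInter fun n => (isClosed_sweep hΩ.isClosed_compl _ _).measurableSet.compl

theorem goodSet_subset (hε : 0 ≤ ε) : goodSet Ω i j ε ⊆ Ω := fun x hx => by
  simpa using hx 0 0 ⟨le_rfl, hε⟩

/-- The total increment of `w` along the three directions, on the good set. -/
def incr (Ω : Set (Ed d)) (w : Ed d → Ed d) (i j : Fin d) (ε : ℝ) : Ed d → ℝ :=
  (goodSet Ω i j ε).indicator fun x =>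
    ∑ n, |inner ℝ (planeDir i j n) (w (x + ε • planeDir i j n) - w x)|

theorem incr_nonneg (Ω : Set (Ed d)) (w : Ed d → Ed d) (x : Ed d) : 0 ≤ incr Ω w i j ε x :=
  indicator_nonneg (fun _ _ => Finset.sum_nonneg fun _ _ => abs_nonneg _) _

theorem measurable_incr (hΩ : IsOpen Ω) {w : Ed d → Ed d} (hw : Measurable w) :
    Measurable (incr Ω w i j ε) := by
  refine Measurable.indicator ?_ (measurableSet_goodSet hΩ)
  refine Finset.measurable_fun_sum _ fun n _ => ?_
  refine Measurable.abs (Measurable.const_inner ?_)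
  exact (hw.comp (measurable_add_const _)).sub hw

theorem abs_le_incr {w : Ed d → Ed d} {x : Ed d} (hx : x ∈ goodSet Ω i j ε) (n : Fin 3) :
    |inner ℝ (planeDir i j n) (w (x + ε • planeDir i j n) - w x)| ≤ incr Ω w i j ε x := by
  rw [incr, indicator_of_mem hx]
  exact Finset.single_le_sum
    (f := fun n => |inner ℝ (planeDir i j n) (w (x + ε • planeDir i j n) - w x)|)
    (fun _ _ => abs_nonneg _) (Finset.mem_univ n)

theorem LocLip.measurable_indicator (h : LocLip Ω u) (hΩ : IsOpen Ω) :
    Measurable (Ω.indicator u) := by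
  have hc : ContinuousOn u Ω := fun x hx => by
    obtain ⟨t, ht, L, hL⟩ := h x hx
    exact (hL.continuousOn.continuousAt ht).continuousWithinAt
  classical
  rw [← Set.piecewise_eq_indicator]
  exact hc.measurable_piecewise continuousOn_const hΩ.measurableSet

theorem ofReal_sum_abs_sq_le (b : Fin 3 → ℝ) :
    ENNReal.ofReal (∑ n, |b n|) ^ 2 ≤ ∑ n, 3 * ‖b n‖ₑ ^ 2 := by
  simp only [Real.enorm_eq_ofReal_abs, ← ENNReal.ofReal_pow (abs_nonneg _)]
  rw [← Finset.mul_sum, ← ENNReal.ofReal_pow (Finset.sum_nonneg fun _ _ => abs_nonneg _),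
    ← ENNReal.ofReal_sum_of_nonneg fun _ _ => sq_nonneg _, ← ENNReal.ofReal_ofNat,
    ← ENNReal.ofReal_mul (by norm_num)]
  apply ENNReal.ofReal_le_ofReal
  simpa using sq_sum_le_card_mul_sum_sq (s := Finset.univ) (f := fun n => |b n|)

theorem LocLip.lintegral_incr_sq_le (h : LocLip Ω u) (hΩ : IsOpen Ω) (hε : 0 ≤ ε)
    {Q : Set (Ed d)} (hQ : Ω ⊆ Q) :
    ∫⁻ x, ENNReal.ofReal (incr Ω (Ω.indicator u) i j ε x) ^ 2 ≤
      144 * ENNReal.ofReal ε ^ 2 * ∫⁻ y in Q, ‖matNormD (symGradD u y)‖ₑ ^ 2 := by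
  set G := goodSet Ω i j ε
  have hG : MeasurableSet G := measurableSet_goodSet hΩ
  have hw := h.measurable_indicator hΩ
  have hm : ∀ n, Measurable fun x => ‖(inner ℝ (planeDir i j n)
      (Ω.indicator u (x + ε • planeDir i j n) - Ω.indicator u x) : ℝ)‖ₑ ^ 2 := fun n =>
    ((Measurable.const_inner ((hw.comp (measurable_add_const _)).sub hw)).enorm).pow_const 2
  have h1 : ∀ x, ENNReal.ofReal (incr Ω (Ω.indicator u) i j ε x) ^ 2 ≤
      G.indicator (fun x => ∑ n, 3 * ‖(inner ℝ (planeDir i j n)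
        (Ω.indicator u (x + ε • planeDir i j n) - Ω.indicator u x) : ℝ)‖ₑ ^ 2) x := by
    intro x
    by_cases hx : x ∈ G
    · rw [indicator_of_mem hx, incr, indicator_of_mem hx]
      exact ofReal_sum_abs_sq_le _
    · rw [indicator_of_notMem hx, incr, indicator_of_notMem hx]
      simp
  have h2 : ∀ n, ∫⁻ x in G, ‖(inner ℝ (planeDir i j n)
      (Ω.indicator u (x + ε • planeDir i j n) - Ω.indicator u x) : ℝ)‖ₑ ^ 2 ≤
      ENNReal.ofReal ε ^ 2 * (16 * ∫⁻ y in Q, ‖matNormD (symGradD u y)‖ₑ ^ 2) := by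
    intro n
    have h3 := h.lintegral_sq_le hΩ hε hG (v := planeDir i j n) fun x hx s hs => hx n s hs
    calc _ = ∫⁻ x in G, ‖(inner ℝ (planeDir i j n)
          (u (x + ε • planeDir i j n) - u x) : ℝ)‖ₑ ^ 2 := by
          refine setLIntegral_congr_fun hG fun x hx => ?_
          rw [indicator_of_mem (hx n ε ⟨hε, le_rfl⟩), indicator_of_mem (goodSet_subset hε hx)]
      _ ≤ _ := h3
      _ ≤ _ := by
          gcongr
          rw [← lintegral_const_mul' _ _ (by norm_num)]
          refine (lintegral_mono_set hQ).trans (lintegral_mono fun y => ?_)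
          have h4 := abs_strain_planeDir_le (i := i) (j := j) u y n
          rw [Real.enorm_eq_ofReal_abs, Real.enorm_eq_ofReal_abs, abs_of_nonneg (matNormD_nonneg _),
            ← ENNReal.ofReal_pow (abs_nonneg _), ← ENNReal.ofReal_pow (matNormD_nonneg _),
            ← ENNReal.ofReal_ofNat, ← ENNReal.ofReal_mul (by norm_num)]
          apply ENNReal.ofReal_le_ofReal
          calc _ ≤ _ := pow_le_pow_left₀ (abs_nonneg _) h4 2
            _ = _ := by ring
  calc _ ≤ _ := lintegral_mono h1
    _ = ∑ n, 3 * ∫⁻ x in G, ‖(inner ℝ (planeDir i j n)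
        (Ω.indicator u (x + ε • planeDir i j n) - Ω.indicator u x) : ℝ)‖ₑ ^ 2 := by
        rw [lintegral_indicator hG, lintegral_finsetSum _ fun n _ => (hm n).const_mul 3]
        exact Finset.sum_congr rfl fun n _ => lintegral_const_mul _ (hm n)
    _ ≤ ∑ _n : Fin 3, 3 * (ENNReal.ofReal ε ^ 2 *
        (16 * ∫⁻ y in Q, ‖matNormD (symGradD u y)‖ₑ ^ 2)) := by
        refine Finset.sum_le_sum fun n _ => ?_
        gcongr
        exact h2 n
    _ = _ := by
        rw [Finset.sum_const, Finset.card_univ, Fintype.card_fin, nsmul_eq_mul]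
        ring

end Increments

section Assembly

variable {d : ℕ} {a : Ed d} {l ε : ℝ} {i j : Fin d} {N : ℕ} {Γ : Set (Ed d)} {u : Ed d → Ed d}
  {X : Ed d}

theorem mem_indexBox_of_mem_cube (hij : i ≠ j) (hε : 0 < ε) (hN : N * ε = l)
    (hX : X ∈ tile a l ε i j) {z : ℤ × ℤ} (hz : X + latticeVec i j ε z ∈ cube a l) :
    z ∈ indexBox N := by
  obtain ⟨z', hz', h⟩ := exists_sub_mem_tile hij hε hN hz
  have h1 := eq_floor_of_sub_mem_tile hij hε h
  have h2 : X + latticeVec i j ε z - latticeVec i j ε z ∈ tile a l ε i j := by simpa using hX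
  have h3 := eq_floor_of_sub_mem_tile hij hε h2
  rwa [h3, ← h1]

open Classical in
/-- The indices near the box whose translates of `X` are not good points. -/
def badIdx (Ω : Set (Ed d)) (i j : Fin d) (ε : ℝ) (N : ℕ) (X : Ed d) : Finset (ℤ × ℤ) :=
  {z ∈ Finset.Ico (-1 : ℤ) N ×ˢ Finset.Ico (-1 : ℤ) N | X + latticeVec i j ε z ∉ goodSet Ω i j ε}

theorem compat_slice (hij : i ≠ j) (hε : 0 < ε) (hN : N * ε = l) (hX : X ∈ tile a l ε i j)
    {w : Ed d → Ed d} (hw : ∀ x ∉ cube a l, w x = 0) :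
    Compat (fun z => w (X + latticeVec i j ε z) i) (fun z => w (X + latticeVec i j ε z) j)
      (fun z => incr (cube a l \ Γ) w i j ε (X + latticeVec i j ε z))
      (badIdx (cube a l \ Γ) i j ε N X) := by
  have key : ∀ z ∉ badIdx (cube a l \ Γ) i j ε N X, ∀ e : ℤ × ℤ, ∀ n : Fin 3,
      0 ≤ e.1 → e.1 ≤ 1 → 0 ≤ e.2 → e.2 ≤ 1 → latticeVec i j ε e = ε • planeDir i j n →
      |inner ℝ (planeDir i j n) (w (X + latticeVec i j ε (z + e)) - w (X + latticeVec i j ε z))| ≤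
        incr (cube a l \ Γ) w i j ε (X + latticeVec i j ε z) := by
    intro z hz e n h1 h2 h3 h4 he
    rw [latticeVec_add, ← add_assoc, he]
    by_cases hg : X + latticeVec i j ε z ∈ goodSet (cube a l \ Γ) i j ε
    · exact abs_le_incr hg n
    · have hz' : z ∉ Finset.Ico (-1 : ℤ) N ×ˢ Finset.Ico (-1 : ℤ) N := fun h => hz <| by
        simp only [badIdx, Finset.mem_filter]; exact ⟨h, hg⟩
      simp only [Finset.mem_product, Finset.mem_Ico] at hz'
      have e1 : w (X + latticeVec i j ε z) = 0 := hw _ fun hc => by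
        have := mem_indexBox_of_mem_cube hij hε hN hX hc
        simp only [Finset.mem_product, Finset.mem_Ico] at this
        omega
      have e2 : w (X + latticeVec i j ε z + ε • planeDir i j n) = 0 := hw _ fun hc => by
        rw [← he, add_assoc, ← latticeVec_add] at hc
        have := mem_indexBox_of_mem_cube hij hε hN hX hc
        simp only [Finset.mem_product, Finset.mem_Ico, Prod.fst_add, Prod.snd_add] at this
        omega
      rw [e1, e2, sub_zero, inner_zero_right, abs_zero]
      exact incr_nonneg _ _ _
  refine ⟨fun z => incr_nonneg _ _ _, fun z hz => ?_, fun z hz => ?_, fun z hz => ?_⟩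
  · have := key z hz (1, 0) 0 (by norm_num) (by norm_num) (by norm_num) (by norm_num)
      (by simp [latticeVec, planeDir])
    simpa [planeDir, inner_dirVec] using this
  · have := key z hz (0, 1) 1 (by norm_num) (by norm_num) (by norm_num) (by norm_num)
      (by simp [latticeVec, planeDir])
    simpa [planeDir, inner_dirVec] using this
  · have := key z hz (1, 1) 2 (by norm_num) (by norm_num) (by norm_num) (by norm_num)
      (by simp [latticeVec, planeDir])
    simp only [planeDir, Matrix.cons_val, inner_add_left, inner_dirVec, PiLp.sub_apply] at this
    simp only [Pi.add_apply]
    convert this using 2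
    ring

theorem le_card_badIdx (hij : i ≠ j) (hε : 0 < ε) (hN : N * ε = l) (hX : X ∈ tile a l ε i j) :
    N ≤ (badIdx (cube a l \ Γ) i j ε N X).card := by
  have h : ({-1} : Finset ℤ) ×ˢ Finset.Ico (0 : ℤ) N ⊆ badIdx (cube a l \ Γ) i j ε N X := by
    intro z hz
    simp only [Finset.mem_product, Finset.mem_singleton, Finset.mem_Ico] at hz
    simp only [badIdx, Finset.mem_filter, Finset.mem_product, Finset.mem_Ico]
    refine ⟨by omega, fun hc => ?_⟩
    have := mem_indexBox_of_mem_cube hij hε hN hX (goodSet_subset hε.le hc).1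
    simp only [Finset.mem_product, Finset.mem_Ico] at this
    omega
  simpa using Finset.card_le_card h

open Classical in
theorem card_badIdx_le (hij : i ≠ j) (hε : 0 < ε) (hN : N * ε = l) (hN1 : 1 ≤ N)
    (hX : X ∈ tile a l ε i j) :
    (badIdx (cube a l \ Γ) i j ε N X).card ≤ 6 * N +
      ∑ n, (indexBox N).sum fun z =>
        if X + latticeVec i j ε z ∈ sweep Γ (planeDir i j n) ε then 1 else 0 := by
  set A := Finset.Ico (-1 : ℤ) N ×ˢ Finset.Ico (-1 : ℤ) N with hA
  set B := Finset.Ico (1 : ℤ) (N - 1) ×ˢ Finset.Ico (1 : ℤ) (N - 1) with hB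
  have hsub : badIdx (cube a l \ Γ) i j ε N X ⊆ (A \ B) ∪ Finset.univ.biUnion fun n =>
      {z ∈ indexBox N | X + latticeVec i j ε z ∈ sweep Γ (planeDir i j n) ε} := by
    intro z hz
    simp only [badIdx, Finset.mem_filter] at hz
    obtain ⟨hzA, hzg⟩ := hz
    simp only [Finset.mem_union, Finset.mem_sdiff, Finset.mem_biUnion, Finset.mem_univ, true_and,
      Finset.mem_filter]
    by_cases hzB : z ∈ B
    · right
      simp only [goodSet, Set.mem_ofPred_eq, not_forall] at hzg
      obtain ⟨n, s, hs, hns⟩ := hzg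
      simp only [hB, Finset.mem_product, Finset.mem_Ico] at hzB
      refine ⟨n, ?_, s, hs, ?_⟩
      · simp only [Finset.mem_product, Finset.mem_Ico]; omega
      by_contra hc
      refine hns ⟨fun k => ?_, hc⟩
      have e1 : (1 : ℝ) ≤ z.1 := by exact_mod_cast hzB.1.1
      have e2 : (1 : ℝ) ≤ z.2 := by exact_mod_cast hzB.2.1
      have e3 : (z.1 : ℝ) + 2 ≤ N := by
        have : z.1 + 2 ≤ N := by omega
        exact_mod_cast this
      have e4 : (z.2 : ℝ) + 2 ≤ N := by
        have : z.2 + 2 ≤ N := by omega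
        exact_mod_cast this
      obtain ⟨p0, p1, p2⟩ := planeDir_apply_mem hij n (k := k)
      have q0 : 0 ≤ s * planeDir i j n k := mul_nonneg hs.1 p0
      have q1 : s * planeDir i j n k ≤ ε := by nlinarith [hs.1, hs.2]
      rw [PiLp.add_apply, PiLp.add_apply, PiLp.smul_apply, smul_eq_mul]
      by_cases hi : k = i
      · subst hi
        rw [latticeVec_apply_fst hij]
        constructor <;> nlinarith [hX.1.1, hX.1.2]
      · by_cases hj : k = j
        · subst hj
          rw [latticeVec_apply_snd hij]
          constructor <;> nlinarith [hX.2.1.1, hX.2.1.2]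
        · rw [latticeVec_apply_of_ne hi hj, p2 hi hj, add_zero, mul_zero, add_zero]
          exact hX.2.2 k hi hj
    · exact Or.inl ⟨hzA, hzB⟩
  have hcard : (A \ B).card ≤ 6 * N := by
    have hBA : B ⊆ A := fun z hz => by
      simp only [hA, hB, Finset.mem_product, Finset.mem_Ico] at hz ⊢
      omega
    rw [Finset.card_sdiff_of_subset hBA, hA, hB, Finset.card_product, Finset.card_product,
      Int.card_Ico, Int.card_Ico]
    rcases N with _ | _ | m
    · omega
    · decide
    · have h1 : ((↑(m + 1 + 1) : ℤ) - -1).toNat = m + 3 := by omega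
      have h2 : ((↑(m + 1 + 1) : ℤ) - 1 - 1).toNat = m := by omega
      rw [h1, h2, Nat.sub_le_iff_le_add]
      nlinarith
  refine (Finset.card_le_card hsub).trans ((Finset.card_union_le _ _).trans ?_)
  refine Nat.add_le_add hcard (Finset.card_biUnion_le.trans (le_of_eq ?_))
  refine Finset.sum_congr rfl fun n _ => ?_
  rw [Finset.card_filter]

end Assembly

section Increment

variable {d : ℕ} {a : Ed d} {l ε : ℝ} {i j : Fin d} {N : ℕ} {Γ : Set (Ed d)} {u : Ed d → Ed d}
  {M : ℝ}

/-- The increment of the `i`-th component in direction `j` where both values are at most `M`. -/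
def truncIncr (w : Ed d → Ed d) (i j : Fin d) (ε M : ℝ) : Ed d → ℝ≥0∞ :=
  {x | |w x i| ≤ M ∧ |w (x + ε • dirVec j) i| ≤ M}.indicator
    fun x => ‖w (x + ε • dirVec j) i - w x i‖ₑ

theorem measurable_truncIncr {w : Ed d → Ed d} (hw : Measurable w) :
    Measurable (truncIncr w i j ε M) := by
  have h1 : Measurable fun x => w x i := by fun_prop
  have h2 : Measurable fun x => w (x + ε • dirVec j) i := by fun_prop
  refine Measurable.indicator (h2.sub h1).enorm ?_
  exact (measurableSet_le h1.abs measurable_const).inter (measurableSet_le h2.abs measurable_const)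

theorem sum_truncIncr_le (hij : i ≠ j) (hε : 0 < ε) (hN : N * ε = l) (hN1 : 1 ≤ N) (hM : 0 < M)
    {w : Ed d → Ed d} (hw : ∀ x ∉ cube a l, w x = 0) {X : Ed d} (hX : X ∈ tile a l ε i j) :
    ∑ z ∈ indexBox N, truncIncr w i j ε M (X + latticeVec i j ε z) ≤
      10 ^ 50 * (ENNReal.ofReal M * (6 * N + ∑ n, ∑ z ∈ indexBox N,
        (sweep Γ (planeDir i j n) ε).indicator 1 (X + latticeVec i j ε z)) +
        N * ENNReal.ofReal (Real.sqrt (∑ z ∈ indexBox N,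
          incr (cube a l \ Γ) w i j ε (X + latticeVec i j ε z) ^ 2))) := by
  classical
  set t : ℤ × ℤ → ℝ := fun z => incr (cube a l \ Γ) w i j ε (X + latticeVec i j ε z) with ht
  set S := {z ∈ indexBox N | X + latticeVec i j ε z ∈
    {x | |w x i| ≤ M ∧ |w (x + ε • dirVec j) i| ≤ M}} with hS
  have hstep : ∀ z, X + latticeVec i j ε z + ε • dirVec j = X + latticeVec i j ε (z + (0, 1)) := by
    intro z
    rw [latticeVec_add, add_assoc]
    simp [latticeVec]
  have hsupp : ∀ z, t z ≠ 0 → z ∈ indexBox N := by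
    intro z hz
    have h1 : X + latticeVec i j ε z ∈ goodSet (cube a l \ Γ) i j ε := by
      by_contra hc
      exact hz (indicator_of_notMem hc _)
    exact mem_indexBox_of_mem_cube hij hε hN hX (goodSet_subset hε.le h1).1
  have hsum0 : 0 ≤ ∑ z ∈ indexBox N, t z ^ 2 := Finset.sum_nonneg fun _ _ => sq_nonneg _
  have hmain := (compat_slice (Γ := Γ) hij hε hN hX hw).sum_abs_sub_le hN1
    (le_card_badIdx hij hε hN hX)
    (fun z hz => by simpa only [Finset.mem_product, Finset.mem_Ico] using hsupp z hz)
    (Real.sqrt_nonneg (∑ z ∈ indexBox N, t z ^ 2))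
    (fun S' => by
      rw [Real.sq_sqrt hsum0, ← Finset.sum_filter_ne_zero]
      refine Finset.sum_le_sum_of_subset_of_nonneg (fun z hz => hsupp z fun h0 => ?_)
        fun _ _ _ => sq_nonneg _
      simp only [Finset.mem_filter] at hz
      exact hz.2 (by simp only [ht] at h0; rw [h0]; norm_num)) hM (S := S) (fun z hz => by
        simp only [hS, Finset.mem_filter, Finset.mem_product, Finset.mem_Ico,
          Set.mem_ofPred_eq, hstep] at hz
        exact hz)
  have hcard := card_badIdx_le (Γ := Γ) hij hε hN hN1 hX
  calc _ = ∑ z ∈ S, ENNReal.ofReal |w (X + latticeVec i j ε (z + (0, 1))) i -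
        w (X + latticeVec i j ε z) i| := by
        rw [hS, Finset.sum_filter]
        refine Finset.sum_congr rfl fun z _ => ?_
        rw [truncIncr, indicator_apply, Real.enorm_eq_ofReal_abs, ← hstep]
    _ ≤ ENNReal.ofReal (10 ^ 50 * (M * (badIdx (cube a l \ Γ) i j ε N X).card +
        N * Real.sqrt (∑ z ∈ indexBox N, t z ^ 2))) := by
        rw [← ENNReal.ofReal_sum_of_nonneg fun _ _ => abs_nonneg _]
        exact ENNReal.ofReal_le_ofReal hmain
    _ = 10 ^ 50 * (ENNReal.ofReal M * (badIdx (cube a l \ Γ) i j ε N X).card +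
        N * ENNReal.ofReal (Real.sqrt (∑ z ∈ indexBox N, t z ^ 2))) := by
        rw [ENNReal.ofReal_mul (by positivity), ENNReal.ofReal_add (by positivity) (by positivity),
          ENNReal.ofReal_mul hM.le, ENNReal.ofReal_mul (by positivity), ENNReal.ofReal_natCast,
          ENNReal.ofReal_natCast, ENNReal.ofReal_pow (by norm_num), ENNReal.ofReal_ofNat]
    _ ≤ _ := by
        gcongr
        refine le_trans (Nat.cast_le.2 hcard) (le_of_eq ?_)
        push_cast
        simp only [indicator_apply, Pi.one_apply]

theorem natCast_mul_volume_tile_le (hij : i ≠ j) (hε : 0 < ε) (hl : 0 < l) (hN : N * ε = l) :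
    (N : ℝ≥0∞) * volume (tile a l ε i j) ≤
      ENNReal.ofReal ε * ENNReal.ofReal l⁻¹ * volume (closedCube a l) := by
  have h : (N : ℝ≥0∞) = ENNReal.ofReal ε * ENNReal.ofReal l⁻¹ * N ^ 2 := by
    rw [← ENNReal.ofReal_natCast, ← ENNReal.ofReal_mul hε.le, ← ENNReal.ofReal_pow (by positivity),
      ← ENNReal.ofReal_mul (by positivity)]
    congr 1
    rw [← hN] at hl ⊢
    have : (N : ℝ) ≠ 0 := fun h => by simp [h] at hl
    field_simp
  rw [h, mul_assoc (ENNReal.ofReal ε * ENNReal.ofReal l⁻¹)]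
  gcongr
  exact sq_mul_volume_tile_le hij hε hN

theorem LocLip.lintegral_sqrt_incr_le (h : LocLip (cube a l \ Γ) u) (hΓ : IsClosed Γ)
    (hij : i ≠ j) (hε : 0 < ε) (hN : N * ε = l) :
    N * ∫⁻ X in tile a l ε i j, ENNReal.ofReal (Real.sqrt (∑ z ∈ indexBox N,
      incr (cube a l \ Γ) ((cube a l \ Γ).indicator u) i j ε (X + latticeVec i j ε z) ^ 2)) ≤
      ENNReal.ofReal ε * (12 * volume (closedCube a l) ^ (1 / 2 : ℝ)) *
        (∫⁻ y in cube a l, ‖matNormD (symGradD u y)‖ₑ ^ 2) ^ (1 / 2 : ℝ) := by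
  have hΩ : IsOpen (cube a l \ Γ) := (isOpen_cube a l).sdiff hΓ
  have hm := measurable_incr (i := i) (j := j) (ε := ε) hΩ (h.measurable_indicator hΩ)
  set τ := incr (cube a l \ Γ) ((cube a l \ Γ).indicator u) i j ε with hτ
  set I := ∫⁻ y in cube a l, ‖matNormD (symGradD u y)‖ₑ ^ 2
  set W := volume (closedCube a l)
  set T : Ed d → ℝ≥0∞ := fun X => ENNReal.ofReal (Real.sqrt (∑ z ∈ indexBox N,
      τ (X + latticeVec i j ε z) ^ 2)) with hT
  have hTm : Measurable T := by
    refine (Real.continuous_sqrt.measurable.comp (Finset.measurable_fun_sum _ fun z _ => ?_)).ennreal_ofReal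
    exact (hm.comp (measurable_add_const _)).pow_const 2
  have hTsq : ∀ X, T X ^ 2 = ∑ z ∈ indexBox N, ENNReal.ofReal (τ (X + latticeVec i j ε z)) ^ 2 := by
    intro X
    simp only [hT, ← ENNReal.ofReal_pow (incr_nonneg _ _ _), hτ]
    rw [← ENNReal.ofReal_pow (Real.sqrt_nonneg _), Real.sq_sqrt
      (Finset.sum_nonneg fun _ _ => sq_nonneg _), ENNReal.ofReal_sum_of_nonneg
      fun _ _ => sq_nonneg _]
  have h1 : ∫⁻ X in tile a l ε i j, T X ^ 2 ≤ 144 * ENNReal.ofReal ε ^ 2 * I := by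
    simp only [hTsq]
    rw [lintegral_finsetSum _ fun z _ => show Measurable fun X =>
      ENNReal.ofReal (τ (X + latticeVec i j ε z)) ^ 2 from
        ((hm.comp (measurable_add_const (latticeVec i j ε z))).ennreal_ofReal).pow_const 2]
    refine (sum_lintegral_tile_le hij hε (indexBox N) (hm.ennreal_ofReal.pow_const 2)).trans ?_
    exact h.lintegral_incr_sq_le hΩ hε.le sdiff_subset
  have h2 : (N * ∫⁻ X in tile a l ε i j, T X) ^ 2 ≤
      (ENNReal.ofReal ε * (12 * W ^ (1 / 2 : ℝ)) * I ^ (1 / 2 : ℝ)) ^ 2 := by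
    calc _ = (N : ℝ≥0∞) ^ 2 * (∫⁻ X in tile a l ε i j, T X) ^ 2 := mul_pow _ _ _
      _ ≤ (N : ℝ≥0∞) ^ 2 * (volume (tile a l ε i j) * ∫⁻ X in tile a l ε i j, T X ^ 2) := by
          gcongr
          refine (sq_lintegral_le _ hTm.aemeasurable).trans ?_
          rw [Measure.restrict_apply_univ]
      _ = ((N : ℝ≥0∞) ^ 2 * volume (tile a l ε i j)) * ∫⁻ X in tile a l ε i j, T X ^ 2 := by ring
      _ ≤ W * (144 * ENNReal.ofReal ε ^ 2 * I) := by
          gcongr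
          exact sq_mul_volume_tile_le hij hε hN
      _ = _ := by
          simp only [mul_pow]
          rw [← ENNReal.rpow_natCast (W ^ (1 / 2 : ℝ)), ← ENNReal.rpow_natCast (I ^ (1 / 2 : ℝ)),
            ← ENNReal.rpow_mul, ← ENNReal.rpow_mul]
          norm_num
          ring
  exact (ENNReal.pow_le_pow_left_iff two_ne_zero).1 h2

/-- The constant in the increment estimate on a cube. -/
def tileConst (d : ℕ) (a : Ed d) (l : ℝ) : ℝ≥0∞ :=
  10 ^ 50 * (6 * (ENNReal.ofReal l⁻¹ * volume (closedCube a l)) +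
    3 * (ENNReal.ofReal (2 * 3 ^ d) * volume (Metric.ball (0 : Ed d) 1)) +
    12 * volume (closedCube a l) ^ (1 / 2 : ℝ))

theorem tileConst_ne_top (d : ℕ) (a : Ed d) (l : ℝ) : tileConst d a l ≠ ⊤ := by
  have h1 := (volume_closedCube_lt_top a l).ne
  have h2 : volume (Metric.ball (0 : Ed d) 1) ≠ ⊤ := measure_ball_lt_top.ne
  unfold tileConst
  finiteness

theorem LocLip.lintegral_truncIncr_le (h : LocLip (cube a l \ Γ) u) (hΓ : IsClosed Γ)
    (hd : 2 ≤ d) (hH : μH[(d : ℝ) - 1] Γ ≠ ⊤) (hij : i ≠ j) (hε : 0 < ε) (hl : 0 < l)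
    (hN : N * ε = l) (hN1 : 1 ≤ N) (hM : 0 < M) :
    ∫⁻ x in cube a l, truncIncr ((cube a l \ Γ).indicator u) i j ε M x ≤
      ENNReal.ofReal ε * tileConst d a l * (ENNReal.ofReal M * (μH[(d : ℝ) - 1] Γ + 1) +
        (∫⁻ y in cube a l, ‖matNormD (symGradD u y)‖ₑ ^ 2) ^ (1 / 2 : ℝ)) := by
  have hΩ : IsOpen (cube a l \ Γ) := (isOpen_cube a l).sdiff hΓ
  have hw := h.measurable_indicator hΩ
  have hw0 : ∀ x ∉ cube a l, (cube a l \ Γ).indicator u x = 0 := fun x hx =>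
    indicator_of_notMem (fun hc => hx hc.1) _
  have hT := h.lintegral_sqrt_incr_le hΓ hij hε hN
  have hm := measurable_incr (i := i) (j := j) (ε := ε) hΩ hw
  set w := (cube a l \ Γ).indicator u
  set τ := incr (cube a l \ Γ) w i j ε with hτ
  set I := ∫⁻ y in cube a l, ‖matNormD (symGradD u y)‖ₑ ^ 2
  set W := volume (closedCube a l)
  set T : Ed d → ℝ≥0∞ := fun X => ENNReal.ofReal (Real.sqrt (∑ z ∈ indexBox N,
      τ (X + latticeVec i j ε z) ^ 2)) with hTdef
  have hTm : Measurable T := by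
    refine (Real.continuous_sqrt.measurable.comp (Finset.measurable_fun_sum _ fun z _ => ?_)).ennreal_ofReal
    exact (hm.comp (measurable_add_const _)).pow_const 2
  set V : Fin 3 → Set (Ed d) := fun n => sweep Γ (planeDir i j n) ε with hV
  have hVm : ∀ n, MeasurableSet (V n) := fun n => (isClosed_sweep hΓ _ _).measurableSet
  have hVm' : ∀ n, Measurable ((V n).indicator (1 : Ed d → ℝ≥0∞)) := fun n =>
    measurable_one.indicator (hVm n)
  have hVs : ∀ n z, Measurable fun X => (V n).indicator (1 : Ed d → ℝ≥0∞)
      (X + latticeVec i j ε z) := fun n z => (hVm' n).comp (measurable_add_const _)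
  set R : Ed d → ℝ≥0∞ := fun X => ∑ n, ∑ z ∈ indexBox N,
    (V n).indicator 1 (X + latticeVec i j ε z) with hR
  have hRm : Measurable R := Finset.measurable_fun_sum _ fun n _ =>
    Finset.measurable_fun_sum _ fun z _ => hVs n z
  have hRint : ∫⁻ X in tile a l ε i j, R X ≤ ENNReal.ofReal ε *
      (3 * (ENNReal.ofReal (2 * 3 ^ d) * volume (Metric.ball (0 : Ed d) 1))) *
        (μH[(d : ℝ) - 1] Γ + 1) := by
    simp only [hR]
    rw [lintegral_finsetSum _ fun n _ => Finset.measurable_fun_sum _ fun z _ =>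
      hVs n z]
    calc _ ≤ ∑ _n : Fin 3, ENNReal.ofReal (2 * 3 ^ d * ε) * volume (Metric.ball (0 : Ed d) 1) *
          (μH[(d : ℝ) - 1] Γ + 1) := by
          refine Finset.sum_le_sum fun n _ => ?_
          rw [lintegral_finsetSum _ fun z _ => hVs n z]
          refine (sum_lintegral_tile_le hij hε (indexBox N) (hVm' n)).trans ?_
          rw [lintegral_indicator_one (hVm n)]
          exact volume_sweep_le hd hH (norm_planeDir_le i j n) hε
      _ = _ := by
          rw [Finset.sum_const, Finset.card_univ, Fintype.card_fin, nsmul_eq_mul,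
            ENNReal.ofReal_mul (by positivity)]
          push_cast
          ring
  calc _ ≤ ∑ z ∈ indexBox N, ∫⁻ X in tile a l ε i j,
        truncIncr w i j ε M (X + latticeVec i j ε z) :=
        setLIntegral_cube_le_sum hij hε hN (measurable_truncIncr hw)
    _ = ∫⁻ X in tile a l ε i j, ∑ z ∈ indexBox N,
        truncIncr w i j ε M (X + latticeVec i j ε z) := by
        rw [lintegral_finsetSum _ fun z _ => show Measurable fun X =>
          truncIncr w i j ε M (X + latticeVec i j ε z) from
            (measurable_truncIncr hw).comp (measurable_add_const (latticeVec i j ε z))]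
    _ ≤ ∫⁻ X in tile a l ε i j,
        10 ^ 50 * (ENNReal.ofReal M * (6 * N + R X) + N * T X) :=
        setLIntegral_mono' measurableSet_tile fun X hX =>
          sum_truncIncr_le hij hε hN hN1 hM hw0 hX
    _ = 10 ^ 50 * (ENNReal.ofReal M * (6 * (N * volume (tile a l ε i j)) +
        ∫⁻ X in tile a l ε i j, R X) + N * ∫⁻ X in tile a l ε i j, T X) := by
        rw [lintegral_const_mul _ (by fun_prop), lintegral_add_left (by fun_prop),
          lintegral_const_mul _ (by fun_prop), lintegral_add_left (by fun_prop), setLIntegral_const,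
          lintegral_const_mul _ hTm]
        simp only [mul_assoc]
    _ ≤ 10 ^ 50 * (ENNReal.ofReal M * (6 * (ENNReal.ofReal ε * ENNReal.ofReal l⁻¹ * W) *
        (μH[(d : ℝ) - 1] Γ + 1) + ENNReal.ofReal ε *
      (3 * (ENNReal.ofReal (2 * 3 ^ d) * volume (Metric.ball (0 : Ed d) 1))) *
        (μH[(d : ℝ) - 1] Γ + 1)) + ENNReal.ofReal ε * (12 * W ^ (1 / 2 : ℝ)) *
          I ^ (1 / 2 : ℝ)) := by
        have h1 : 6 * (N * volume (tile a l ε i j)) ≤ 6 * (ENNReal.ofReal ε *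
            ENNReal.ofReal l⁻¹ * W) * (μH[(d : ℝ) - 1] Γ + 1) :=
          (mul_le_mul_right (natCast_mul_volume_tile_le hij hε hl hN) 6).trans
            (le_mul_of_one_le_right' le_add_self)
        exact mul_le_mul_right (add_le_add (mul_le_mul_right (add_le_add h1 hRint) _) hT) _
    _ ≤ _ := by
        unfold tileConst
        generalize μH[(d : ℝ) - 1] Γ + 1 = h'
        generalize volume (Metric.ball (0 : Ed d) 1) = b
        generalize ENNReal.ofReal (2 * 3 ^ d) = c
        generalize I ^ (1 / 2 : ℝ) = y
        change _ ≤ ENNReal.ofReal ε * (10 ^ 50 * (6 * (ENNReal.ofReal l⁻¹ * W) + 3 * (c * b) +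
          12 * W ^ (1 / 2 : ℝ))) * (ENNReal.ofReal M * h' + y)
        generalize W ^ (1 / 2 : ℝ) = r
        generalize ENNReal.ofReal l⁻¹ = k
        generalize ENNReal.ofReal M = m
        generalize ENNReal.ofReal ε = e
        calc _ = e * 10 ^ 50 * ((6 * (k * W) + 3 * (c * b)) * (m * h') + (12 * r) * y) := by ring
          _ ≤ e * 10 ^ 50 * ((6 * (k * W) + 3 * (c * b) + 12 * r) * (m * h') +
              (6 * (k * W) + 3 * (c * b) + 12 * r) * y) := by
            have h1 : 6 * (k * W) + 3 * (c * b) ≤ 6 * (k * W) + 3 * (c * b) + 12 * r := le_self_add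
            have h2 : 12 * r ≤ 6 * (k * W) + 3 * (c * b) + 12 * r := le_add_self
            exact mul_le_mul_right (add_le_add (mul_le_mul_left h1 _) (mul_le_mul_left h2 _)) _
          _ = _ := by ring

end Increment

section Limit

variable {d : ℕ} {a : Ed d} {l : ℝ} {i j : Fin d} {Γ Ω : Set (Ed d)} {u : Ed d → Ed d} {M : ℝ}

theorem LocLip.continuousAt (h : LocLip Ω u) {x : Ed d} (hx : x ∈ Ω) : ContinuousAt u x := by
  obtain ⟨t, ht, L, hL⟩ := h x hx
  exact hL.continuousOn.continuousAt ht

theorem LocLip.isOpen_inter_abs_lt (h : LocLip Ω u) (hΩ : IsOpen Ω) (i : Fin d) (M : ℝ) :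
    IsOpen (Ω ∩ {x | |u x i| < M}) := by
  have hc : ContinuousOn (fun x => |u x i|) Ω := fun x hx =>
    ((by fun_prop : Continuous fun y : Ed d => |y i|).continuousAt.comp
      (h.continuousAt hx)).continuousWithinAt
  exact hc.isOpen_inter_preimage hΩ isOpen_Iio

theorem LocLip.enorm_mgradD_le_liminf (h : LocLip Ω u) (hΩ : IsOpen Ω) (hl : 0 < l) {x : Ed d}
    (hx : x ∈ Ω) (hxM : |u x i| < M) :
    ‖mgradD u x i j‖ₑ ≤ Filter.liminf (fun n : ℕ => (ENNReal.ofReal (l / (n + 1)))⁻¹ *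
      truncIncr (Ω.indicator u) i j (l / (n + 1)) M x) Filter.atTop := by
  by_cases hd : DifferentiableAt ℝ u x
  swap
  · simp [mgradD, fderiv_zero_of_not_differentiableAt hd]
  have hε : Filter.Tendsto (fun n : ℕ => l / ((n : ℝ) + 1)) Filter.atTop (nhds 0) :=
    tendsto_const_div_atTop_nhds_zero_nat l |>.comp (Filter.tendsto_add_atTop_nat 1) |>.congr
      fun n => by simp
  have hεpos : ∀ n : ℕ, 0 < l / ((n : ℝ) + 1) := fun n => by positivity
  have hε' : Filter.Tendsto (fun n : ℕ => l / ((n : ℝ) + 1)) Filter.atTop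
      (nhdsWithin 0 {0}ᶜ) :=
    tendsto_nhdsWithin_iff.2 ⟨hε, Filter.Eventually.of_forall fun n => (hεpos n).ne'⟩
  have hpt : Filter.Tendsto (fun n : ℕ => x + (l / ((n : ℝ) + 1)) • dirVec j) Filter.atTop
      (nhds x) := by
    simpa using (hε.smul_const (dirVec j)).const_add x
  have hmem : ∀ᶠ n : ℕ in Filter.atTop,
      x + (l / ((n : ℝ) + 1)) • dirVec j ∈ Ω ∩ {x | |u x i| < M} :=
    hpt.eventually ((h.isOpen_inter_abs_lt hΩ i M).mem_nhds ⟨hx, hxM⟩)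
  have hder : HasDerivAt (fun s : ℝ => u (x + s • dirVec j) i) (mgradD u x i j) 0 := by
    have h4 : HasDerivAt (fun s : ℝ => x + s • dirVec j) (dirVec j) 0 := by
      simpa using ((hasDerivAt_id (0 : ℝ)).smul_const (dirVec j)).const_add x
    have h3 : HasFDerivAt u (fderiv ℝ u x) (x + (0 : ℝ) • dirVec j) := by
      simpa using hd.hasFDerivAt
    have h5 := h3.comp_hasDerivAt (0 : ℝ) h4
    have h6 := (hasDerivAt_const (0 : ℝ) (dirVec i)).inner ℝ h5
    simpa [inner_dirVec, mgradD] using h6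
  have hslope := (hasDerivAt_iff_tendsto_slope.1 hder).comp hε'
  have hlim := hslope.enorm
  rw [← hlim.liminf_eq]
  refine Filter.liminf_le_liminf ?_
  filter_upwards [hmem] with n hn
  have hmemA : x ∈ {x | |Ω.indicator u x i| ≤ M ∧
      |Ω.indicator u (x + (l / ((n : ℝ) + 1)) • dirVec j) i| ≤ M} :=
    ⟨by rw [indicator_of_mem hx]; exact hxM.le, by rw [indicator_of_mem hn.1]; exact hn.2.le⟩
  rw [truncIncr, indicator_of_mem hmemA, indicator_of_mem hn.1, indicator_of_mem hx]
  simp only [Function.comp, slope_def_field, zero_smul, add_zero, sub_zero]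
  rw [div_eq_inv_mul, enorm_mul, enorm_inv (hεpos n).ne', Real.enorm_of_nonneg (hεpos n).le]

theorem LocLip.lintegral_mgradD_le_of_ne (h : LocLip (cube a l \ Γ) u) (hΓ : IsClosed Γ)
    (hd : 2 ≤ d) (hH : μH[(d : ℝ) - 1] Γ ≠ ⊤) (hij : i ≠ j) (hl : 0 < l) (hM : 0 < M) :
    ∫⁻ x in (cube a l \ Γ) ∩ {x | |u x i| < M}, ‖mgradD u x i j‖ₑ ≤
      tileConst d a l * (ENNReal.ofReal M * (μH[(d : ℝ) - 1] Γ + 1) +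
        (∫⁻ y in cube a l, ‖matNormD (symGradD u y)‖ₑ ^ 2) ^ (1 / 2 : ℝ)) := by
  have hΩ : IsOpen (cube a l \ Γ) := (isOpen_cube a l).sdiff hΓ
  have hw := h.measurable_indicator hΩ
  have hmeas : MeasurableSet ((cube a l \ Γ) ∩ {x | |u x i| < M}) :=
    (h.isOpen_inter_abs_lt hΩ i M).measurableSet
  refine (setLIntegral_mono' hmeas fun x hx =>
    h.enorm_mgradD_le_liminf hΩ hl (j := j) hx.1 hx.2).trans ?_
  refine (lintegral_liminf_le fun n => (measurable_truncIncr hw).const_mul _).trans ?_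
  have key : ∀ n : ℕ, ∫⁻ x in (cube a l \ Γ) ∩ {x | |u x i| < M},
      (ENNReal.ofReal (l / (n + 1)))⁻¹ *
        truncIncr ((cube a l \ Γ).indicator u) i j (l / (n + 1)) M x ≤
      tileConst d a l * (ENNReal.ofReal M * (μH[(d : ℝ) - 1] Γ + 1) +
        (∫⁻ y in cube a l, ‖matNormD (symGradD u y)‖ₑ ^ 2) ^ (1 / 2 : ℝ)) := fun n => by
    have hε : 0 < l / ((n : ℝ) + 1) := by positivity
    have hN : ((n + 1 : ℕ) : ℝ) * (l / ((n : ℝ) + 1)) = l := by push_cast; field_simp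
    have hmain := h.lintegral_truncIncr_le (N := n + 1) hΓ hd hH hij hε hl hN (by omega) hM
    refine (lintegral_mono_set (inter_subset_left.trans sdiff_subset)).trans ?_
    rw [lintegral_const_mul _ (measurable_truncIncr hw)]
    refine (mul_le_mul_right hmain _).trans (le_of_eq ?_)
    rw [mul_assoc, ← mul_assoc, ENNReal.inv_mul_cancel
      (ENNReal.ofReal_pos.2 hε).ne' ENNReal.ofReal_ne_top, one_mul]
  revert key
  generalize tileConst d a l * (ENNReal.ofReal M * (μH[(d : ℝ) - 1] Γ + 1) +
    (∫⁻ y in cube a l, ‖matNormD (symGradD u y)‖ₑ ^ 2) ^ (1 / 2 : ℝ)) = K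
  intro key
  calc _ ≤ Filter.liminf (fun _ : ℕ => K) Filter.atTop :=
        Filter.liminf_le_liminf (Filter.Eventually.of_forall key)
    _ = K := Filter.liminf_const K

theorem measurable_mgradD (u : Ed d → Ed d) (i j : Fin d) : Measurable fun x => mgradD u x i j := by
  have h := measurable_fderiv_apply_const ℝ u (dirVec j)
  exact (by fun_prop : Continuous fun y : Ed d => y i).measurable.comp h

theorem measurable_matNormD_symGradD (u : Ed d → Ed d) :
    Measurable fun x => matNormD (symGradD u x) := by
  refine Real.continuous_sqrt.measurable.comp (Finset.measurable_fun_sum _ fun i _ =>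
    Finset.measurable_fun_sum _ fun j _ => Measurable.pow_const ?_ 2)
  exact ((measurable_mgradD u i j).add (measurable_mgradD u j i)).div_const 2

theorem lintegral_mgradD_self_le (u : Ed d → Ed d) (i : Fin d) :
    ∫⁻ x in cube a l, ‖mgradD u x i i‖ₑ ≤ tileConst d a l *
      (∫⁻ y in cube a l, ‖matNormD (symGradD u y)‖ₑ ^ 2) ^ (1 / 2 : ℝ) := by
  set I := ∫⁻ y in cube a l, ‖matNormD (symGradD u y)‖ₑ ^ 2
  have h1 : ∫⁻ x in cube a l, ‖mgradD u x i i‖ₑ ≤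
      ∫⁻ x in cube a l, ‖matNormD (symGradD u x)‖ₑ := by
    refine lintegral_mono fun x => ?_
    rw [Real.enorm_eq_ofReal_abs, Real.enorm_of_nonneg (matNormD_nonneg _)]
    refine ENNReal.ofReal_le_ofReal ?_
    have := abs_apply_le_matNormD (symGradD u x) i i
    simpa [symGradD] using this
  have h2 : (∫⁻ x in cube a l, ‖matNormD (symGradD u x)‖ₑ) ^ 2 ≤
      (volume (closedCube a l) ^ (1 / 2 : ℝ) * I ^ (1 / 2 : ℝ)) ^ 2 := by
    refine (sq_lintegral_le _ (measurable_matNormD_symGradD u).enorm.aemeasurable).trans ?_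
    rw [Measure.restrict_apply_univ, mul_pow, ← ENNReal.rpow_natCast, ← ENNReal.rpow_natCast,
      ← ENNReal.rpow_mul, ← ENNReal.rpow_mul]
    norm_num
    exact mul_le_mul_left (measure_mono (cube_subset_closedCube a l)) _
  refine h1.trans (((ENNReal.pow_le_pow_left_iff two_ne_zero).1 h2).trans ?_)
  gcongr
  rw [tileConst, mul_add]
  refine le_trans ?_ le_add_self
  rw [← mul_assoc]
  exact le_mul_of_one_le_left' (by norm_num)

theorem rowGradNorm_le_sum (u : Ed d → Ed d) (i : Fin d) (x : Ed d) :
    rowGradNorm u i x ≤ ∑ j, |mgradD u x i j| := by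
  refine Real.sqrt_le_iff.2 ⟨Finset.sum_nonneg fun _ _ => abs_nonneg _, ?_⟩
  simp only [← sq_abs (mgradD u x i _)]
  exact Finset.sum_sq_le_sq_sum_of_nonneg fun _ _ => abs_nonneg _

theorem FinSimplexUnion.isClosed (h : FinSimplexUnion d Γ) : IsClosed Γ := by
  obtain ⟨n, f, -, rfl⟩ := h
  exact isClosed_iUnion_of_finite fun k =>
    (Set.finite_range (f k)).isClosed_convexHull ℝ

theorem LocLip.lintegral_rowGradNorm_le (h : LocLip (cube a l \ Γ) u) (hΓ : IsClosed Γ)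
    (hd : 2 ≤ d) (hH : μH[(d : ℝ) - 1] Γ ≠ ⊤) (hl : 0 < l) (hM : 0 < M) (i : Fin d) :
    ∫⁻ x in cube a l ∩ {x | |u x i| < M}, ENNReal.ofReal (rowGradNorm u i x) ≤
      d * tileConst d a l * (ENNReal.ofReal M * (μH[(d : ℝ) - 1] Γ + 1) +
        (∫⁻ y in cube a l, ‖matNormD (symGradD u y)‖ₑ ^ 2) ^ (1 / 2 : ℝ)) := by
  set E := (cube a l \ Γ) ∩ {x | |u x i| < M} with hE
  have hsub : cube a l ∩ {x | |u x i| < M} ⊆ E ∪ Γ := fun x hx => by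
    by_cases hxΓ : x ∈ Γ
    · exact Or.inr hxΓ
    · exact Or.inl ⟨⟨hx.1, hxΓ⟩, hx.2⟩
  calc _ ≤ ∫⁻ x in E ∪ Γ, ENNReal.ofReal (rowGradNorm u i x) := lintegral_mono_set hsub
    _ ≤ (∫⁻ x in E, ENNReal.ofReal (rowGradNorm u i x)) +
        ∫⁻ x in Γ, ENNReal.ofReal (rowGradNorm u i x) := lintegral_union_le _ _ _
    _ = ∫⁻ x in E, ENNReal.ofReal (rowGradNorm u i x) := by
        rw [setLIntegral_measure_zero _ _ (volume_eq_zero_of_hausdorffMeasure_ne_top hd hH),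
          add_zero]
    _ ≤ ∫⁻ x in E, ∑ j, ‖mgradD u x i j‖ₑ := by
        refine lintegral_mono fun x => ?_
        simp only [Real.enorm_eq_ofReal_abs]
        rw [← ENNReal.ofReal_sum_of_nonneg fun _ _ => abs_nonneg _]
        exact ENNReal.ofReal_le_ofReal (rowGradNorm_le_sum u i x)
    _ = ∑ j, ∫⁻ x in E, ‖mgradD u x i j‖ₑ :=
        lintegral_finsetSum _ fun j _ => (measurable_mgradD u i j).enorm
    _ ≤ ∑ _j : Fin d, tileConst d a l * (ENNReal.ofReal M * (μH[(d : ℝ) - 1] Γ + 1) +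
        (∫⁻ y in cube a l, ‖matNormD (symGradD u y)‖ₑ ^ 2) ^ (1 / 2 : ℝ)) := by
        refine Finset.sum_le_sum fun j _ => ?_
        by_cases hij : i = j
        · subst hij
          refine (lintegral_mono_set (inter_subset_left.trans sdiff_subset)).trans
            ((lintegral_mgradD_self_le u i).trans ?_)
          exact mul_le_mul_right le_add_self _
        · exact h.lintegral_mgradD_le_of_ne hΓ hd hH hij hl hM
    _ = _ := by
        rw [Finset.sum_const, Finset.card_univ, Fintype.card_fin, nsmul_eq_mul, mul_assoc]

end Limit

/-- **Gradient bound for truncations of configurations with regular jump set**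
(core estimate of Theorem 2.7). -/
theorem truncation_gradient_bound (d : ℕ) (hd : 2 ≤ d) (a : Ed d) (l : ℝ) (hl : 0 < l) :
    ∃ C : ℝ, 0 < C ∧
      ∀ (u : Ed d → Ed d) (Γ : Set (Ed d)), IsWd d (cube a l) u Γ →
        ∀ M : ℝ, 0 < M → ∀ i : Fin d,
          ∫⁻ x in cube a l ∩ {x | |u x i| < M}, ENNReal.ofReal (rowGradNorm u i x) ≤
            ENNReal.ofReal (C * M) * (μH[(d : ℝ) - 1] Γ + 1) +
              ENNReal.ofReal C *
                eLpNorm (fun x => matNormD (symGradD u x)) 2 (volume.restrict (cube a l)) := by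
  have hK : (d : ℝ≥0∞) * tileConst d a l ≠ ⊤ :=
    ENNReal.mul_ne_top (ENNReal.natCast_ne_top d) (tileConst_ne_top d a l)
  refine ⟨((d : ℝ≥0∞) * tileConst d a l).toReal + 1, by positivity, fun u Γ hu M hM i => ?_⟩
  set C := ((d : ℝ≥0∞) * tileConst d a l).toReal + 1 with hC
  have hC0 : 0 < C := by positivity
  have hKC : (d : ℝ≥0∞) * tileConst d a l ≤ ENNReal.ofReal C := by
    rw [← ENNReal.ofReal_toReal hK]
    exact ENNReal.ofReal_le_ofReal (by simp [hC])
  by_cases hH : μH[(d : ℝ) - 1] Γ = ⊤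
  · rw [hH, top_add, ENNReal.mul_top (ENNReal.ofReal_pos.2 (by positivity)).ne', top_add]
    exact le_top
  refine (LocLip.lintegral_rowGradNorm_le hu.2.2.1 hu.2.1.isClosed hd hH hl hM i).trans ?_
  rw [eLpNorm_eq_lintegral_rpow_enorm_toReal two_ne_zero ENNReal.ofNat_ne_top, mul_add,
    ENNReal.ofReal_mul hC0.le]
  simp only [ENNReal.toReal_ofNat, ENNReal.rpow_ofNat]
  rw [mul_assoc (ENNReal.ofReal C)]
  exact add_le_add (mul_le_mul_left hKC _) (mul_le_mul_left hKC _)
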